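/- Let (a_n)_{n≥1} be a sequence of positive real numbers such that inf_{1≤m≠n≤N} |a_m − a_n| ≥ 1 for all N, and let (η(N))_{N≥1} be a sequence of non-negative reals. Let 𝒜 be the set of α ∈ [0,1] for which ⌊δ_min^α⌋(N) ≤ η(N) holds for infinitely many N. Then the Lebesgue measure λ(𝒜) equals 0 if the series ∑_{k=1}^∞ φ(k) · sup_{b≥1} ( sup_{ℓ ≥ 𝒩(bk)} η(ℓ) / (bk) ) converges, and λ(𝒜) = 1 if this series diverges, where φ is Euler's totient function. -/

import Mathlib

open MeasureTheory Filter
open scoped ENNReal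

/-- Distance from a real number to the nearest integer. -/
noncomputable def nint (x : ℝ) : ℝ := |x - round x|

/-- `floorDeltaMin a α N = min { ‖α ⌊|a_m − a_n|⌋‖ : 1 ≤ m ≠ n ≤ N }`. -/
noncomputable def floorDeltaMin (a : ℕ → ℝ) (α : ℝ) (N : ℕ) : ℝ :=
  sInf {d : ℝ | ∃ m n : ℕ, 1 ≤ m ∧ m ≤ N ∧ 1 ≤ n ∧ n ≤ N ∧ m ≠ n ∧
    d = nint (α * (⌊|a m - a n|⌋ : ℝ))}

/-- `calN a k` is the first index `M ≥ 1` at which the integer `k` occurs as a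
floored positive difference of the first `M` terms; it is `⊤` if `k` never
occurs. -/
noncomputable def calN (a : ℕ → ℝ) (k : ℕ) : ℕ∞ :=
  sInf {M : ℕ∞ | ∃ M' : ℕ, M = (M' : ℕ∞) ∧ 1 ≤ M' ∧
    ∃ m n : ℕ, 1 ≤ m ∧ m ≤ M' ∧ 1 ≤ n ∧ n ≤ M' ∧ m ≠ n ∧ (k : ℤ) = ⌊|a m - a n|⌋}

/-- The `k`-th term `φ(k) · sup_{b ≥ 1} ( sup_{ℓ ≥ 𝒩(bk)} η(ℓ) / (bk) )` of the
series in the zero-one law, valued in `ℝ≥0∞` (the inner supremum over an empty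
index set is `0`, corresponding to `𝒩(bk) = ∞`). -/
noncomputable def seriesTerm (a : ℕ → ℝ) (η : ℕ → ℝ) (k : ℕ) : ℝ≥0∞ :=
  (Nat.totient k : ℝ≥0∞) *
    ⨆ (b : ℕ) (_ : 1 ≤ b),
      (⨆ (ℓ : ℕ) (_ : calN a (b * k) ≤ (ℓ : ℕ∞)), ENNReal.ofReal (η ℓ)) /
        ((b * k : ℕ) : ℝ≥0∞)

theorem holder_three_quarters {ι : Type*} (s : Finset ι) (x c : ι → ℝ)
    (hx : ∀ i ∈ s, 0 ≤ x i) (hc : ∀ i ∈ s, 0 ≤ c i) :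
    ∑ i ∈ s, x i ^ (3/4 : ℝ) * c i ^ (1/4 : ℝ) ≤
      (∑ i ∈ s, x i) ^ (3/4 : ℝ) * (∑ i ∈ s, c i) ^ (1/4 : ℝ) := by
  have hpq : (4/3 : ℝ).HolderConjugate 4 := by
    rw [Real.holderConjugate_iff]; norm_num
  have h := Real.inner_le_Lp_mul_Lq_of_nonneg s (f := fun i => x i ^ (3/4 : ℝ))
    (g := fun i => c i ^ (1/4 : ℝ)) hpq
    (fun i hi => Real.rpow_nonneg (hx i hi) _) (fun i hi => Real.rpow_nonneg (hc i hi) _)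
  have e1 : ∑ i ∈ s, (x i ^ (3/4 : ℝ)) ^ (4/3 : ℝ) = ∑ i ∈ s, x i :=
    Finset.sum_congr rfl fun i hi => by rw [← Real.rpow_mul (hx i hi)]; norm_num
  have e2 : ∑ i ∈ s, (c i ^ (1/4 : ℝ)) ^ (4 : ℝ) = ∑ i ∈ s, c i :=
    Finset.sum_congr rfl fun i hi => by rw [← Real.rpow_mul (hc i hi)]; norm_num
  rw [e1, e2] at h
  convert h using 3
  norm_num

theorem sum_pow_sub_lt_le {q : ℝ} (hq0 : 0 ≤ q) (hq1 : q < 1) (k : ℕ) :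
    ∑ j ∈ Finset.range k, q ^ (k - j) ≤ q / (1 - q) := by
  have h1 : 0 < 1 - q := by linarith
  induction k with
  | zero => simp; positivity
  | succ k ih =>
    rw [Finset.sum_range_succ]
    have : ∑ j ∈ Finset.range k, q ^ (k + 1 - j) = q * ∑ j ∈ Finset.range k, q ^ (k - j) := by
      rw [Finset.mul_sum]
      refine Finset.sum_congr rfl fun j hj => ?_
      rw [← pow_succ']
      congr 1
      have := Finset.mem_range.1 hj
      omega
    rw [this]
    have h2 : q * ∑ j ∈ Finset.range k, q ^ (k - j) ≤ q * (q / (1 - q)) := by gcongr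
    have h3 : q * (q / (1 - q)) + q = q / (1 - q) := by field_simp; ring
    simp only [Nat.add_sub_cancel_left, pow_one]
    linarith

theorem sum_pow_sub_gt_le {q : ℝ} (hq0 : 0 ≤ q) (hq1 : q < 1) (k n : ℕ) :
    ∑ j ∈ Finset.Ico (k + 1) n, q ^ (j - k) ≤ q / (1 - q) := by
  rw [Finset.sum_Ico_eq_sum_range]
  have : ∀ m ∈ Finset.range (n - (k + 1)), q ^ (k + 1 + m - k) = q * q ^ m := by
    intro m _
    rw [← pow_succ']
    congr 1
    omega
  rw [Finset.sum_congr rfl this, ← Finset.mul_sum, div_eq_mul_inv]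
  gcongr
  rw [← tsum_geometric_of_lt_one hq0 hq1]
  exact (summable_geometric_of_lt_one hq0 hq1).sum_le_tsum _ (fun i _ => by positivity)

theorem sum_pow_dist_le {q : ℝ} (hq0 : 0 ≤ q) (hq1 : q < 1) (k n : ℕ) :
    ∑ j ∈ (Finset.range n).erase k, q ^ ((j - k) + (k - j)) ≤ 2 * q / (1 - q) := by
  have hsub : (Finset.range n).erase k ⊆ Finset.range k ∪ Finset.Ico (k + 1) n := by
    intro j hj
    simp only [Finset.mem_erase, Finset.mem_range, Finset.mem_union, Finset.mem_Ico] at hj ⊢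
    omega
  have hdisj : Disjoint (Finset.range k) (Finset.Ico (k + 1) n) := by
    rw [Finset.disjoint_left]
    intro j hj hj'
    simp only [Finset.mem_range, Finset.mem_Ico] at hj hj'
    omega
  calc ∑ j ∈ (Finset.range n).erase k, q ^ ((j - k) + (k - j))
      ≤ ∑ j ∈ Finset.range k ∪ Finset.Ico (k + 1) n, q ^ ((j - k) + (k - j)) :=
        Finset.sum_le_sum_of_subset_of_nonneg hsub fun _ _ _ => by positivity
    _ = ∑ j ∈ Finset.range k, q ^ (k - j) + ∑ j ∈ Finset.Ico (k + 1) n, q ^ (j - k) := by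
        rw [Finset.sum_union hdisj]
        congr 1
        · refine Finset.sum_congr rfl fun j hj => ?_
          have := Finset.mem_range.1 hj
          congr 1; omega
        · refine Finset.sum_congr rfl fun j hj => ?_
          have := Finset.mem_Ico.1 hj
          congr 1; omega
    _ ≤ q / (1 - q) + q / (1 - q) :=
        add_le_add (sum_pow_sub_lt_le hq0 hq1 k) (sum_pow_sub_gt_le hq0 hq1 k n)
    _ = 2 * q / (1 - q) := by ring

theorem rpow_three_quarters_mul_le {s t : ℝ} (hs : 0 ≤ s) (ht : 0 ≤ t) :
    (s * t) ^ (3/4 : ℝ) ≤ (s * t) ^ (1/4 : ℝ) * ((s + t) / 2) := by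
  have h0 : 0 ≤ s * t := mul_nonneg hs ht
  have h1 : (s * t) ^ (3/4 : ℝ) = (s * t) ^ (1/4 : ℝ) * (s * t) ^ (1/2 : ℝ) := by
    rw [← Real.rpow_add_of_nonneg h0 (by norm_num) (by norm_num)]; norm_num
  rw [h1]
  gcongr
  rw [Real.mul_rpow hs ht]
  have := Real.geom_mean_le_arith_mean2_weighted (w₁ := 1/2) (w₂ := 1/2) (by norm_num)
    (by norm_num) hs ht (by norm_num)
  linarith

/-- Off-diagonal part of the form with kernel `q ^ |i - j|`, in normalised form. -/
theorem offdiag_form_le_of_sum_le_one {q : ℝ} (hq0 : 0 ≤ q) (hq1 : q < 1) (n : ℕ) (x y : ℕ → ℝ)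
    (hx : ∀ i, 0 ≤ x i) (hy : ∀ i, 0 ≤ y i) (hX : ∑ i ∈ Finset.range n, x i ≤ 1)
    (hY : ∑ i ∈ Finset.range n, y i ≤ 1) :
    ∑ i ∈ Finset.range n, ∑ j ∈ (Finset.range n).erase i,
      (x i * y j) ^ (3/4 : ℝ) * q ^ ((i - j) + (j - i)) ≤ 2 * q / (1 - q) := by
  have hx1 : ∀ i ∈ Finset.range n, x i ≤ 1 := fun i hi =>
    (Finset.single_le_sum (fun j _ => hx j) hi).trans hX
  have hy1 : ∀ i ∈ Finset.range n, y i ≤ 1 := fun i hi =>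
    (Finset.single_le_sum (fun j _ => hy j) hi).trans hY
  have hc : 0 ≤ 2 * q / (1 - q) := div_nonneg (by linarith) (by linarith)
  have key : ∀ i ∈ Finset.range n, ∀ j ∈ (Finset.range n).erase i,
      (x i * y j) ^ (3/4 : ℝ) * q ^ ((i - j) + (j - i)) ≤
        x i / 2 * q ^ ((j - i) + (i - j)) + y j / 2 * q ^ ((i - j) + (j - i)) := by
    intro i hi j hj
    have hj' := (Finset.mem_erase.1 hj).2
    have h1 := rpow_three_quarters_mul_le (hx i) (hy j)
    have h2 : (x i * y j) ^ (1/4 : ℝ) ≤ 1 :=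
      Real.rpow_le_one (mul_nonneg (hx i) (hy j))
        (mul_le_one₀ (hx1 i hi) (hy j) (hy1 j hj')) (by norm_num)
    have h3 : (x i * y j) ^ (3/4 : ℝ) ≤ (x i + y j) / 2 :=
      h1.trans (mul_le_of_le_one_left (by linarith [hx i, hy j]) h2)
    rw [add_comm (j - i) (i - j)]
    have : (0 : ℝ) ≤ q ^ ((i - j) + (j - i)) := by positivity
    nlinarith
  refine (Finset.sum_le_sum fun i hi => Finset.sum_le_sum (key i hi)).trans ?_
  simp_rw [Finset.sum_add_distrib]
  have A : ∑ i ∈ Finset.range n, ∑ j ∈ (Finset.range n).erase i,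
      x i / 2 * q ^ ((j - i) + (i - j)) ≤ 1 / 2 * (2 * q / (1 - q)) := by
    calc _ ≤ ∑ i ∈ Finset.range n, x i / 2 * (2 * q / (1 - q)) := by
          refine Finset.sum_le_sum fun i _ => ?_
          rw [← Finset.mul_sum]
          have := hx i
          gcongr
          exact sum_pow_dist_le hq0 hq1 i n
      _ = (∑ i ∈ Finset.range n, x i) / 2 * (2 * q / (1 - q)) := by
          rw [← Finset.sum_mul, Finset.sum_div]
      _ ≤ _ := by gcongr
  have B : ∑ i ∈ Finset.range n, ∑ j ∈ (Finset.range n).erase i,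
      y j / 2 * q ^ ((i - j) + (j - i)) ≤ 1 / 2 * (2 * q / (1 - q)) := by
    rw [Finset.sum_comm' (t' := Finset.range n) (s' := fun j => (Finset.range n).erase j)]
    · calc _ ≤ ∑ i ∈ Finset.range n, y i / 2 * (2 * q / (1 - q)) := by
            refine Finset.sum_le_sum fun i _ => ?_
            rw [← Finset.mul_sum]
            have := hy i
            gcongr
            exact sum_pow_dist_le hq0 hq1 i n
        _ = (∑ i ∈ Finset.range n, y i) / 2 * (2 * q / (1 - q)) := by
            rw [← Finset.sum_mul, Finset.sum_div]
        _ ≤ _ := by gcongr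
    · intro i j
      simp only [Finset.mem_erase, Finset.mem_range, ne_eq]
      constructor
      · rintro ⟨h1, h2, h3⟩; exact ⟨⟨fun h => h2 h.symm, h1⟩, h3⟩
      · rintro ⟨⟨h2, h1⟩, h3⟩; exact ⟨h1, fun h => h2 h.symm, h3⟩
  linarith

theorem form_le {q : ℝ} (hq0 : 0 ≤ q) (hq1 : q < 1) (n : ℕ) (x y : ℕ → ℝ)
    (hx : ∀ i, 0 ≤ x i) (hy : ∀ i, 0 ≤ y i) :
    ∑ i ∈ Finset.range n, ∑ j ∈ Finset.range n,
      (x i * y j) ^ (3/4 : ℝ) * q ^ ((i - j) + (j - i)) ≤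
      (1 + 2 * q / (1 - q)) *
        ((∑ i ∈ Finset.range n, x i) * ∑ i ∈ Finset.range n, y i) ^ (3/4 : ℝ) := by
  set X := ∑ i ∈ Finset.range n, x i with hX
  set Y := ∑ i ∈ Finset.range n, y i with hY
  have hX0 : 0 ≤ X := Finset.sum_nonneg fun i _ => hx i
  have hY0 : 0 ≤ Y := Finset.sum_nonneg fun i _ => hy i
  have hc : 0 ≤ 2 * q / (1 - q) := div_nonneg (by linarith) (by linarith)
  rcases hX0.eq_or_lt with h0 | hXpos
  · have hz : ∀ i ∈ Finset.range n, x i = 0 :=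
      (Finset.sum_eq_zero_iff_of_nonneg fun i _ => hx i).1 h0.symm
    rw [Finset.sum_eq_zero fun i hi => Finset.sum_eq_zero fun j _ => by
      rw [hz i hi, zero_mul, Real.zero_rpow (by norm_num), zero_mul]]
    positivity
  rcases hY0.eq_or_lt with h0 | hYpos
  · have hz : ∀ i ∈ Finset.range n, y i = 0 :=
      (Finset.sum_eq_zero_iff_of_nonneg fun i _ => hy i).1 h0.symm
    rw [Finset.sum_eq_zero fun i hi => Finset.sum_eq_zero fun j hj => by
      rw [hz j hj, mul_zero, Real.zero_rpow (by norm_num), zero_mul]]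
    positivity
  have hXY : 0 < (X * Y) ^ (3/4 : ℝ) := by positivity
  have hsX : ∑ i ∈ Finset.range n, x i / X = 1 := by
    rw [← Finset.sum_div, ← hX, div_self hXpos.ne']
  have hsY : ∑ i ∈ Finset.range n, y i / Y = 1 := by
    rw [← Finset.sum_div, ← hY, div_self hYpos.ne']
  clear_value X Y
  have hoff := offdiag_form_le_of_sum_le_one hq0 hq1 n (fun i => x i / X) (fun i => y i / Y)
    (fun i => div_nonneg (hx i) hX0) (fun i => div_nonneg (hy i) hY0) hsX.le hsY.le
  have hscale : ∀ i j, (x i * y j) ^ (3/4 : ℝ) =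
      (X * Y) ^ (3/4 : ℝ) * (x i / X * (y j / Y)) ^ (3/4 : ℝ) := by
    intro i j
    rw [← Real.mul_rpow (by positivity) (mul_nonneg (div_nonneg (hx i) hX0)
      (div_nonneg (hy j) hY0))]
    congr 1
    field_simp
  have hdiag : ∑ i ∈ Finset.range n, (x i / X * (y i / Y)) ^ (3/4 : ℝ) ≤ 1 := by
    calc _ ≤ ∑ i ∈ Finset.range n, (x i / X + y i / Y) / 2 := by
          refine Finset.sum_le_sum fun i hi => ?_
          have a0 : 0 ≤ x i / X := div_nonneg (hx i) hX0
          have b0 : 0 ≤ y i / Y := div_nonneg (hy i) hY0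
          have a1 : x i / X ≤ 1 := by
            rw [← hsX]
            exact Finset.single_le_sum (f := fun i => x i / X)
              (fun j _ => div_nonneg (hx j) hX0) hi
          have b1 : y i / Y ≤ 1 := by
            rw [← hsY]
            exact Finset.single_le_sum (f := fun i => y i / Y)
              (fun j _ => div_nonneg (hy j) hY0) hi
          refine (rpow_three_quarters_mul_le a0 b0).trans ?_
          refine mul_le_of_le_one_left (by linarith) ?_
          exact Real.rpow_le_one (mul_nonneg a0 b0) (mul_le_one₀ a1 b0 b1) (by norm_num)
      _ = 1 := by rw [← Finset.sum_div, Finset.sum_add_distrib, hsX, hsY]; norm_num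
  calc _ = (X * Y) ^ (3/4 : ℝ) * (∑ i ∈ Finset.range n, (x i / X * (y i / Y)) ^ (3/4 : ℝ) +
        ∑ i ∈ Finset.range n, ∑ j ∈ (Finset.range n).erase i,
          (x i / X * (y j / Y)) ^ (3/4 : ℝ) * q ^ ((i - j) + (j - i))) := by
        rw [← Finset.sum_add_distrib, Finset.mul_sum]
        refine Finset.sum_congr rfl fun i hi => ?_
        rw [← Finset.add_sum_erase _ _ hi, mul_add, Finset.mul_sum]
        congr 1
        · rw [hscale]; simp
        · refine Finset.sum_congr rfl fun j _ => ?_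
          rw [hscale]; ring
    _ ≤ (X * Y) ^ (3/4 : ℝ) * (1 + 2 * q / (1 - q)) := by gcongr
    _ = _ := by ring

/-- The cost of fixing the pair of `p`-adic valuations `(i, j)`. -/
noncomputable def cellWeight (p κ : ℝ) (i j : ℕ) : ℝ :=
  (if i = 0 then 1 else 1 - 1 / p) * (if j = 0 then 1 else 1 - 1 / p) *
    (1 / p) ^ ((i - j) + (j - i)) * (if j < i then κ else 1)

theorem cellWeight_pos {p κ : ℝ} (hp : 2 ≤ p) (hκ : 1 ≤ κ) (i j : ℕ) :
    0 < cellWeight p κ i j := by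
  have h1 : 0 < 1 - 1 / p := by
    rw [sub_pos, div_lt_one (by linarith)]; linarith
  have hp0 : 0 < p := by linarith
  have hκ0 : 0 < κ := by linarith
  unfold cellWeight
  split_ifs <;> positivity

theorem cellWeight_self_le_one {p κ : ℝ} (hp : 2 ≤ p) (i : ℕ) : cellWeight p κ i i ≤ 1 := by
  have h2 : 0 < 1 / p := by positivity
  have h1 : 0 ≤ 1 - 1 / p := by
    rw [sub_nonneg, div_le_one (by linarith)]; linarith
  have h3 : (1 - 1 / p) * (1 - 1 / p) ≤ 1 := mul_le_one₀ (by linarith) h1 (by linarith)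
  unfold cellWeight
  split_ifs <;> simp_all

theorem cellWeight_le {p κ : ℝ} (hp : 2 ≤ p) (hκ : 1 ≤ κ) (i j : ℕ) :
    cellWeight p κ i j ≤ κ * (1 / p) ^ ((i - j) + (j - i)) := by
  have h2 : 0 < 1 / p := by positivity
  have h1 : 0 ≤ 1 - 1 / p := by
    rw [sub_nonneg, div_le_one (by linarith)]; linarith
  have hz : 0 < (1 / p) ^ ((i - j) + (j - i)) := by positivity
  have ha : ∀ k : ℕ, (0 : ℝ) ≤ (if k = 0 then 1 else 1 - 1 / p) ∧
      (if k = 0 then 1 else 1 - 1 / p) ≤ (1 : ℝ) := by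
    intro k; split_ifs <;> constructor <;> linarith
  have hb : (if j < i then κ else 1) ≤ κ := by split_ifs <;> linarith
  unfold cellWeight
  have h3 := mul_le_one₀ (ha i).2 (ha j).1 (ha j).2
  have h4 : (0:ℝ) ≤ (if j < i then κ else 1) := by split_ifs <;> linarith
  calc _ ≤ 1 * (1 / p) ^ ((i - j) + (j - i)) * κ := by gcongr
    _ = _ := by ring

theorem rpow_quarter_cellWeight_le {p κ K : ℝ} (hp : 2 ≤ p) (hκ : 1 ≤ κ) (hK : κ ≤ K) (i j : ℕ) :
    cellWeight p κ i j ^ (1/4 : ℝ) ≤ K * ((1 / p) ^ (1/4 : ℝ)) ^ ((i - j) + (j - i)) := by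
  have h0 : (0:ℝ) ≤ 1 / p := by positivity
  calc _ ≤ (κ * (1 / p) ^ ((i - j) + (j - i))) ^ (1/4 : ℝ) :=
        Real.rpow_le_rpow (cellWeight_pos hp hκ i j).le (cellWeight_le hp hκ i j) (by norm_num)
    _ = κ ^ (1/4 : ℝ) * ((1 / p) ^ (1/4 : ℝ)) ^ ((i - j) + (j - i)) := by
        rw [Real.mul_rpow (by linarith) (by positivity)]
        congr 1
        rw [← Real.rpow_natCast, ← Real.rpow_natCast, ← Real.rpow_mul h0, ← Real.rpow_mul h0,
          mul_comm]
    _ ≤ _ := by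
        gcongr
        calc κ ^ (1/4 : ℝ) ≤ κ ^ (1 : ℝ) := Real.rpow_le_rpow_of_exponent_le hκ (by norm_num)
          _ ≤ K := by simpa using hK

theorem rpow_quarter_inv_lt {p : ℝ} (hp : 2 ≤ p) : (1 / p) ^ (1/4 : ℝ) ≤ 0.845 := by
  have h : (1 / p) ^ (1/4 : ℝ) ≤ ((0.845 : ℝ) ^ (4 : ℝ)) ^ (1/4 : ℝ) := by
    refine Real.rpow_le_rpow (by positivity) ?_ (by norm_num)
    rw [div_le_iff₀ (by linarith)]
    norm_num
    linarith
  rwa [← Real.rpow_mul (by norm_num), show (4 : ℝ) * (1/4) = 1 by norm_num, Real.rpow_one] at h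

theorem two_mul_div_one_sub_le {q : ℝ} (hq0 : 0 ≤ q) (hq : q ≤ 0.845) :
    2 * q / (1 - q) ≤ 13 * q := by
  rw [div_le_iff₀ (by linarith)]
  nlinarith

theorem sum_range_sum_range_split (n k : ℕ) (hk : k ∈ Finset.range n) (e : ℕ → ℕ → ℝ) :
    ∑ i ∈ Finset.range n, ∑ j ∈ Finset.range n, e i j =
      e k k + ∑ i ∈ (Finset.range n).erase k, e i k + ∑ j ∈ (Finset.range n).erase k, e k j +
        ∑ i ∈ (Finset.range n).erase k, ∑ j ∈ (Finset.range n).erase k, e i j := by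
  rw [← Finset.add_sum_erase _ _ hk, ← Finset.add_sum_erase _ (fun j => e k j) hk,
    Finset.sum_congr rfl fun i _ => (Finset.add_sum_erase _ (fun j => e i j) hk).symm,
    Finset.sum_add_distrib]
  ring

theorem sum_cells_le_of_spread
    {p κ K : ℝ} (hp : 2 ≤ p) (hκ : 1 ≤ κ) (hK : κ ≤ K) {n : ℕ} {x y : ℕ → ℝ}
    (hx : ∀ i, 0 ≤ x i) (hy : ∀ i, 0 ≤ y i)
    (hX : ∑ i ∈ Finset.range n, x i = 1) (hY : ∑ i ∈ Finset.range n, y i = 1)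
    {e : ℕ → ℕ → ℝ}
    (he : ∀ i j, e i j ≤ cellWeight p κ i j ^ (1/4 : ℝ) * (x i * y j) ^ (3/4 : ℝ))
    {η : ℝ}
    (hη : ∀ i ∈ Finset.range n, x i * y i ≤ 1 - η) :
    ∑ i ∈ Finset.range n, ∑ j ∈ Finset.range n, e i j ≤
      (1 - η) ^ (1/4 : ℝ) + 13 * K * (1 / p) ^ (1/4 : ℝ) := by
  set q : ℝ := (1 / p) ^ (1/4 : ℝ) with hq
  have hq0 : 0 ≤ q := by positivity
  have hq2 : q ≤ 0.845 := rpow_quarter_inv_lt hp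
  have hq1 : q < 1 := by linarith
  have hx1 : ∀ i ∈ Finset.range n, x i ≤ 1 := fun i hi =>
    (Finset.single_le_sum (fun j _ => hx j) hi).trans hX.le
  have hy1 : ∀ i ∈ Finset.range n, y i ≤ 1 := fun i hi =>
    (Finset.single_le_sum (fun j _ => hy j) hi).trans hY.le
  have hoff := offdiag_form_le_of_sum_le_one hq0 hq1 n x y hx hy hX.le hY.le
  have hdiag : ∑ i ∈ Finset.range n, e i i ≤ (1 - η) ^ (1/4 : ℝ) := by
    calc _ ≤ ∑ i ∈ Finset.range n, (1 - η) ^ (1/4 : ℝ) * ((x i + y i) / 2) := by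
          refine Finset.sum_le_sum fun i hi => (he i i).trans ?_
          have h0 : 0 ≤ x i * y i := mul_nonneg (hx i) (hy i)
          have h1 : cellWeight p κ i i ^ (1/4 : ℝ) ≤ 1 :=
            Real.rpow_le_one (cellWeight_pos hp hκ i i).le (cellWeight_self_le_one hp i)
              (by norm_num)
          have h2 : 0 ≤ (x i + y i) / 2 := by linarith [hx i, hy i]
          calc _ ≤ (x i * y i) ^ (3/4 : ℝ) := mul_le_of_le_one_left (by positivity) h1
            _ ≤ (x i * y i) ^ (1/4 : ℝ) * ((x i + y i) / 2) :=
              rpow_three_quarters_mul_le (hx i) (hy i)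
            _ ≤ _ := by
              gcongr
              exact hη i hi
      _ = (1 - η) ^ (1/4 : ℝ) := by
          rw [← Finset.mul_sum, ← Finset.sum_div, Finset.sum_add_distrib, hX, hY]
          norm_num
  calc _ = ∑ i ∈ Finset.range n, e i i +
        ∑ i ∈ Finset.range n, ∑ j ∈ (Finset.range n).erase i, e i j := by
        rw [← Finset.sum_add_distrib]
        exact Finset.sum_congr rfl fun i hi => (Finset.add_sum_erase _ _ hi).symm
    _ ≤ (1 - η) ^ (1/4 : ℝ) + ∑ i ∈ Finset.range n, ∑ j ∈ (Finset.range n).erase i,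
          K * ((x i * y j) ^ (3/4 : ℝ) * q ^ ((i - j) + (j - i))) := by
        gcongr with i _ j _
        refine (he i j).trans ?_
        have := rpow_quarter_cellWeight_le hp hκ hK i j
        have h0 : 0 ≤ (x i * y j) ^ (3/4 : ℝ) := Real.rpow_nonneg (mul_nonneg (hx i) (hy j)) _
        nlinarith
    _ ≤ (1 - η) ^ (1/4 : ℝ) + K * (13 * q) := by
        simp_rw [← Finset.mul_sum]
        have : 0 ≤ K := by linarith
        gcongr
        exact hoff.trans (two_mul_div_one_sub_le hq0 hq2)
    _ = _ := by ring

theorem sum_cells_erase_le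
    {p κ K : ℝ} (hp : 2 ≤ p) (hκ : 1 ≤ κ) (hK : κ ≤ K) {n : ℕ} {x y : ℕ → ℝ}
    (hx : ∀ i, 0 ≤ x i) (hy : ∀ i, 0 ≤ y i)
    (hX : ∑ i ∈ Finset.range n, x i = 1) (hY : ∑ i ∈ Finset.range n, y i = 1)
    {e : ℕ → ℕ → ℝ}
    (he : ∀ i j, e i j ≤ cellWeight p κ i j ^ (1/4 : ℝ) * (x i * y j) ^ (3/4 : ℝ))
    {k : ℕ} (hk : k ∈ Finset.range n) :
    ∑ i ∈ (Finset.range n).erase k, ∑ j ∈ (Finset.range n).erase k, e i j ≤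
      14 * K * ((1 - x k) * (1 - y k)) ^ (3/4 : ℝ) := by
  set q : ℝ := (1 / p) ^ (1/4 : ℝ) with hq
  have hq0 : 0 ≤ q := by positivity
  have hq2 : q ≤ 0.845 := rpow_quarter_inv_lt hp
  have hq1 : q < 1 := by linarith
  have hK0 : 0 ≤ K := by linarith
  have hform := form_le hq0 hq1 n (fun i => if i = k then 0 else x i)
    (fun i => if i = k then 0 else y i)
    (fun i => by split_ifs <;> simp [hx])
    (fun i => by split_ifs <;> simp [hy])
  have hsum : ∀ z : ℕ → ℝ, ∑ i ∈ Finset.range n, z i = 1 →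
      ∑ i ∈ Finset.range n, (if i = k then 0 else z i) = 1 - z k := by
    intro z hz
    rw [← Finset.add_sum_erase _ _ hk] at hz ⊢
    rw [Finset.sum_congr rfl fun i hi => if_neg (Finset.mem_erase.1 hi).1]
    simp
    linarith
  rw [hsum x hX, hsum y hY] at hform
  have h13 := two_mul_div_one_sub_le hq0 hq2
  have hxk : 0 ≤ 1 - x k := by
    have := (Finset.single_le_sum (fun j _ => hx j) hk).trans hX.le; linarith
  have hyk : 0 ≤ 1 - y k := by
    have := (Finset.single_le_sum (fun j _ => hy j) hk).trans hY.le; linarith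
  have hpos : 0 ≤ ((1 - x k) * (1 - y k)) ^ (3/4 : ℝ) := by positivity
  calc _ ≤ ∑ i ∈ (Finset.range n).erase k, ∑ j ∈ (Finset.range n).erase k,
        K * (((if i = k then 0 else x i) * (if j = k then 0 else y j)) ^ (3/4 : ℝ) *
          q ^ ((i - j) + (j - i))) := by
        refine Finset.sum_le_sum fun i hi => Finset.sum_le_sum fun j hj => ?_
        rw [if_neg (Finset.mem_erase.1 hi).1, if_neg (Finset.mem_erase.1 hj).1]
        refine (he i j).trans ?_
        have := rpow_quarter_cellWeight_le hp hκ hK i j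
        have h0 : 0 ≤ (x i * y j) ^ (3/4 : ℝ) := Real.rpow_nonneg (mul_nonneg (hx i) (hy j)) _
        nlinarith
    _ ≤ ∑ i ∈ Finset.range n, ∑ j ∈ Finset.range n,
        K * (((if i = k then 0 else x i) * (if j = k then 0 else y j)) ^ (3/4 : ℝ) *
          q ^ ((i - j) + (j - i))) := by
        have hnn : ∀ i j, 0 ≤ K * (((if i = k then 0 else x i) * (if j = k then 0 else y j)) ^
            (3/4 : ℝ) * q ^ ((i - j) + (j - i))) := by
          intro i j
          have h1 : 0 ≤ (if i = k then 0 else x i) := by split_ifs <;> simp [hx]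
          have h2 : 0 ≤ (if j = k then 0 else y j) := by split_ifs <;> simp [hy]
          positivity
        refine (Finset.sum_le_sum fun i _ => Finset.sum_le_sum_of_subset_of_nonneg
          (Finset.erase_subset _ _) fun j _ _ => hnn i j).trans ?_
        exact Finset.sum_le_sum_of_subset_of_nonneg (Finset.erase_subset _ _)
          fun i _ _ => Finset.sum_nonneg fun j _ => hnn i j
    _ ≤ K * ((1 + 2 * q / (1 - q)) * ((1 - x k) * (1 - y k)) ^ (3/4 : ℝ)) := by
        simp_rw [← Finset.mul_sum]
        gcongr
    _ ≤ K * (14 * ((1 - x k) * (1 - y k)) ^ (3/4 : ℝ)) := by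
        gcongr
        linarith
    _ = _ := by ring

theorem rpow_mul_rpow_le_linear {s p u : ℝ} (hs : 0 ≤ s) (hp : 0 < p) (hu : 0 < u) :
    s ^ (3/4 : ℝ) * (4 / p) ^ (1/4 : ℝ) ≤ u * s + 1 / u ^ 3 / p := by
  have h := Real.geom_mean_le_arith_mean2_weighted (w₁ := 3/4) (w₂ := 1/4) (p₁ := u * s)
    (p₂ := (1 / u ^ 3) * (4 / p)) (by norm_num) (by norm_num) (by positivity) (by positivity)
    (by norm_num)
  have e : (u * s) ^ (3/4 : ℝ) * ((1 / u ^ 3) * (4 / p)) ^ (1/4 : ℝ) =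
      s ^ (3/4 : ℝ) * (4 / p) ^ (1/4 : ℝ) := by
    rw [Real.mul_rpow hu.le hs, Real.mul_rpow (by positivity) (by positivity)]
    have : u ^ (3/4 : ℝ) * (1 / u ^ 3) ^ (1/4 : ℝ) = 1 := by
      rw [one_div, ← Real.rpow_natCast, ← Real.rpow_neg hu.le, ← Real.rpow_mul hu.le,
        ← Real.rpow_add hu]
      norm_num
    calc _ = (u ^ (3/4 : ℝ) * (1 / u ^ 3) ^ (1/4 : ℝ)) *
          (s ^ (3/4 : ℝ) * (4 / p) ^ (1/4 : ℝ)) := by ring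
      _ = _ := by rw [this, one_mul]
  rw [e] at h
  have h2 : 1 / 4 * ((1 / u ^ 3) * (4 / p)) = 1 / u ^ 3 / p := by field_simp
  have h3 : 0 ≤ u * s := by positivity
  linarith

theorem rpow_three_quarters_one_sub_le {s : ℝ} (hs : s ≤ 1) :
    (1 - s) ^ (3/4 : ℝ) ≤ 1 - 3 / 4 * s := by
  have h := Real.geom_mean_le_arith_mean2_weighted (w₁ := 3/4) (w₂ := 1/4) (p₁ := 1 - s)
    (p₂ := 1) (by norm_num) (by norm_num) (by linarith) (by norm_num) (by norm_num)
  rw [Real.one_rpow] at h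
  linarith

theorem sum_rpow_mul_dist_le {p : ℝ} {n : ℕ} {x : ℕ → ℝ} (hp : 2 ≤ p) (hx : ∀ i, 0 ≤ x i)
    (hX : ∑ i ∈ Finset.range n, x i = 1) {k : ℕ} (hk : k ∈ Finset.range n) :
    ∑ i ∈ (Finset.range n).erase k,
      x i ^ (3/4 : ℝ) * ((1 / p) ^ ((i - k) + (k - i))) ^ (1/4 : ℝ) ≤
      (1 - x k) ^ (3/4 : ℝ) * (4 / p) ^ (1/4 : ℝ) := by
  have hp0 : 0 < p := by linarith
  refine (holder_three_quarters _ _ _ (fun i _ => hx i) (fun i _ => by positivity)).trans ?_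
  have h1 : ∑ i ∈ (Finset.range n).erase k, x i = 1 - x k := by
    rw [← hX, ← Finset.add_sum_erase _ _ hk]; ring
  rw [h1]
  have hxk : 0 ≤ 1 - x k := by rw [← h1]; exact Finset.sum_nonneg fun i _ => hx i
  gcongr
  have hp1 : 1 / p < 1 := by rw [div_lt_one hp0]; linarith
  refine (sum_pow_dist_le (by positivity) hp1 k n).trans ?_
  rw [div_le_div_iff₀ (by linarith) hp0]
  field_simp
  linarith

theorem sum_cells_le_of_concentrated
    {p κ K : ℝ} (hp : 2 ≤ p) (hκ : 1 ≤ κ) (hK : κ ≤ K) {n : ℕ} {x y : ℕ → ℝ}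
    (hx : ∀ i, 0 ≤ x i) (hy : ∀ i, 0 ≤ y i)
    (hX : ∑ i ∈ Finset.range n, x i = 1) (hY : ∑ i ∈ Finset.range n, y i = 1)
    {e : ℕ → ℕ → ℝ}
    (he : ∀ i j, e i j ≤ cellWeight p κ i j ^ (1/4 : ℝ) * (x i * y j) ^ (3/4 : ℝ))
    {k : ℕ} (hk : k ∈ Finset.range n) :
    ∑ i ∈ Finset.range n, ∑ j ∈ Finset.range n, e i j ≤
      (x k * y k) ^ (3/4 : ℝ) + K * ((1 - x k) ^ (3/4 : ℝ) * (4 / p) ^ (1/4 : ℝ)) +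
      K * ((1 - y k) ^ (3/4 : ℝ) * (4 / p) ^ (1/4 : ℝ)) +
      14 * K * ((1 - x k) * (1 - y k)) ^ (3/4 : ℝ) := by
  have hp0 : 0 < p := by linarith
  have hK0 : 0 ≤ K := by linarith
  have hx1 : x k ≤ 1 := (Finset.single_le_sum (fun j _ => hx j) hk).trans hX.le
  have hy1 : y k ≤ 1 := (Finset.single_le_sum (fun j _ => hy j) hk).trans hY.le
  have hcell : ∀ i j, cellWeight p κ i j ^ (1/4 : ℝ) ≤
      K * ((1 / p) ^ ((i - j) + (j - i))) ^ (1/4 : ℝ) := by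
    intro i j
    refine (rpow_quarter_cellWeight_le hp hκ hK i j).trans_eq ?_
    have h0 : (0:ℝ) ≤ 1 / p := by positivity
    rw [← Real.rpow_natCast, ← Real.rpow_natCast, ← Real.rpow_mul h0, ← Real.rpow_mul h0,
      mul_comm (1/4 : ℝ)]
  rw [sum_range_sum_range_split n k hk]
  gcongr ?_ + ?_ + ?_ + ?_
  · refine (he k k).trans (mul_le_of_le_one_left ?_ ?_)
    · exact Real.rpow_nonneg (mul_nonneg (hx k) (hy k)) _
    · exact Real.rpow_le_one (cellWeight_pos hp hκ k k).le (cellWeight_self_le_one hp k)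
        (by norm_num)
  · calc _ ≤ ∑ i ∈ (Finset.range n).erase k,
          K * (x i ^ (3/4 : ℝ) * ((1 / p) ^ ((i - k) + (k - i))) ^ (1/4 : ℝ)) := by
          refine Finset.sum_le_sum fun i _ => (he i k).trans ?_
          have h1 : (x i * y k) ^ (3/4 : ℝ) ≤ x i ^ (3/4 : ℝ) :=
            Real.rpow_le_rpow (mul_nonneg (hx i) (hy k)) (mul_le_of_le_one_right (hx i) hy1)
              (by norm_num)
          calc _ ≤ (K * ((1 / p) ^ ((i - k) + (k - i))) ^ (1/4 : ℝ)) * x i ^ (3/4 : ℝ) := by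
                gcongr
                · exact Real.rpow_nonneg (mul_nonneg (hx i) (hy k)) _
                · exact hcell i k
            _ = _ := by ring
      _ ≤ _ := by
          rw [← Finset.mul_sum]
          gcongr
          exact sum_rpow_mul_dist_le hp hx hX hk
  · calc _ ≤ ∑ i ∈ (Finset.range n).erase k,
          K * (y i ^ (3/4 : ℝ) * ((1 / p) ^ ((i - k) + (k - i))) ^ (1/4 : ℝ)) := by
          refine Finset.sum_le_sum fun i _ => (he k i).trans ?_
          have h1 : (x k * y i) ^ (3/4 : ℝ) ≤ y i ^ (3/4 : ℝ) :=
            Real.rpow_le_rpow (mul_nonneg (hx k) (hy i)) (mul_le_of_le_one_left (hy i) hx1)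
              (by norm_num)
          calc _ ≤ (K * ((1 / p) ^ ((k - i) + (i - k))) ^ (1/4 : ℝ)) * y i ^ (3/4 : ℝ) := by
                gcongr
                · exact Real.rpow_nonneg (mul_nonneg (hx k) (hy i)) _
                · exact hcell k i
            _ = _ := by rw [add_comm (k - i)]; ring
      _ ≤ _ := by
          rw [← Finset.mul_sum]
          gcongr
          exact sum_rpow_mul_dist_le hp hy hY hk
  · exact sum_cells_erase_le hp hκ hK hx hy hX hY he hk

theorem sum_level_weight {p : ℝ} (hp : 2 ≤ p) (k : ℕ) (hk : k ≠ 0) :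
    ∑ i ∈ Finset.range k, (if i = 0 then 1 else 1 - 1 / p) * (1 / p) ^ (k - i) = 1 / p := by
  have hp0 : p ≠ 0 := by positivity
  induction k with
  | zero => exact absurd rfl hk
  | succ k ih =>
    rw [Finset.sum_range_succ]
    have h : ∑ i ∈ Finset.range k, (if i = 0 then 1 else 1 - 1 / p) * (1 / p) ^ (k + 1 - i) =
        (1 / p) * ∑ i ∈ Finset.range k, (if i = 0 then 1 else 1 - 1 / p) * (1 / p) ^ (k - i) := by
      rw [Finset.mul_sum]
      refine Finset.sum_congr rfl fun i hi => ?_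
      rw [Nat.succ_sub (Finset.mem_range.1 hi).le, pow_succ]
      ring
    rw [h]
    rcases Nat.eq_zero_or_pos k with rfl | hk
    · simp
    · rw [ih hk.ne', if_neg hk.ne', Nat.add_sub_cancel_left]
      ring

theorem two_term_holder {D p κ c : ℝ} (hp : 0 < p) (hκ : 0 ≤ κ) (hD : 0 ≤ D) (hD1 : D ≤ 1)
    (hc : 0 ≤ c) :
    (1 - D) ^ (3/4 : ℝ) * c ^ (1/4 : ℝ) + D ^ (3/4 : ℝ) * (κ / p) ^ (1/4 : ℝ) ≤
      (c + κ / p) ^ (1/4 : ℝ) := by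
  have h := holder_three_quarters (Finset.univ : Finset Bool) (fun b => if b then 1 - D else D)
    (fun b => if b then c else κ / p)
    (by intro i _; split_ifs <;> linarith)
    (by intro i _; split_ifs <;> positivity)
  simp only [Fintype.sum_bool, if_true, Bool.false_eq_true, if_false] at h
  refine h.trans_eq ?_
  norm_num

theorem sum_lower_cells_le {p : ℝ} (hp : 2 ≤ p) {k : ℕ} (hk : k ≠ 0) {x : ℕ → ℝ}
    (hx : ∀ i, 0 ≤ x i) :
    ∑ i ∈ Finset.range k, x i ^ (3/4 : ℝ) *
      ((if i = 0 then 1 else 1 - 1 / p) * (1 / p) ^ (k - i)) ^ (1/4 : ℝ) ≤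
      (∑ i ∈ Finset.range k, x i) ^ (3/4 : ℝ) * (1 / p) ^ (1/4 : ℝ) := by
  refine (holder_three_quarters _ _ _ (fun i _ => hx i) (fun i _ => ?_)).trans_eq ?_
  · have h1 : 1 / p ≤ 1 := by rw [div_le_one] <;> linarith
    have h2 : 0 ≤ 1 / p := by positivity
    have : (0:ℝ) ≤ if i = 0 then 1 else 1 - 1 / p := by split_ifs <;> linarith
    positivity
  · rw [sum_level_weight hp k hk]

theorem sum_cells_le_of_star {p κ K : ℝ} (hp : 2 ≤ p) (hκ : 1 ≤ κ) (hK : κ ≤ K) {n : ℕ}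
    {x y : ℕ → ℝ} (hx : ∀ i, 0 ≤ x i) (hy : ∀ i, 0 ≤ y i)
    (hX : ∑ i ∈ Finset.range n, x i = 1) (hY : ∑ i ∈ Finset.range n, y i = 1)
    {e : ℕ → ℕ → ℝ}
    (he : ∀ i j, e i j ≤ cellWeight p κ i j ^ (1/4 : ℝ) * (x i * y j) ^ (3/4 : ℝ))
    {k : ℕ} (hk : k ∈ Finset.range n)
    (hstar : ∑ i ∈ Finset.range n, ∑ j ∈ Finset.range n, (if min i j = k then e i j else 0) ≤
      cellWeight p κ k k ^ (1/4 : ℝ) *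
        ((∑ i ∈ Finset.range n, if k ≤ i then x i else 0) *
          ∑ j ∈ Finset.range n, if k ≤ j then y j else 0) ^ (3/4 : ℝ)) :
    ∑ i ∈ Finset.range n, ∑ j ∈ Finset.range n, e i j ≤
      Real.exp (2 * ((κ - 1) / p)) + 14 * K * ((1 - x k) * (1 - y k)) ^ (3/4 : ℝ) := by
  have hp0 : 0 < p := by linarith
  have hkn : k < n := Finset.mem_range.1 hk
  set c : ℝ := if k = 0 then 1 else 1 - 1 / p with hc
  have hp1 : 1 / p ≤ 1 := by rw [div_le_one] <;> linarith
  have hpi : 0 ≤ 1 / p := by positivity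
  have hc0 : 0 ≤ c := by rw [hc]; split_ifs <;> linarith
  have hDz : ∀ z : ℕ → ℝ, (∀ i, 0 ≤ z i) → ∑ i ∈ Finset.range n, z i = 1 →
      (∑ i ∈ Finset.range n, if k ≤ i then z i else 0) = 1 - ∑ i ∈ Finset.range k, z i ∧
      0 ≤ ∑ i ∈ Finset.range k, z i ∧ ∑ i ∈ Finset.range k, z i ≤ 1 ∧
      z k ≤ 1 - ∑ i ∈ Finset.range k, z i ∧
      (1 - ∑ i ∈ Finset.range k, z i) ^ (3/4 : ℝ) * c ^ (1/4 : ℝ) +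
        (∑ i ∈ Finset.range k, z i) ^ (3/4 : ℝ) * (κ / p) ^ (1/4 : ℝ) ≤
        Real.exp ((κ - 1) / p) := by
    intro z hz hZ
    have h0 : 0 ≤ ∑ i ∈ Finset.range k, z i := Finset.sum_nonneg fun i _ => hz i
    have h1 : ∑ i ∈ Finset.range (k + 1), z i ≤ 1 := by
      rw [← hZ]
      exact Finset.sum_le_sum_of_subset_of_nonneg (Finset.range_subset_range.2 hkn)
        fun i _ _ => hz i
    rw [Finset.sum_range_succ] at h1
    have h2 : ∑ i ∈ Finset.range k, z i ≤ 1 := by linarith [hz k]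
    refine ⟨?_, h0, h2, by linarith, ?_⟩
    · rw [← hZ, eq_sub_iff_add_eq,
        show ∑ i ∈ Finset.range k, z i = ∑ i ∈ Finset.range n, if k ≤ i then 0 else z i by
          rw [← Finset.sum_subset (Finset.range_subset_range.2 hkn.le) (fun i _ hi => if_pos (by simpa using hi))]
          exact Finset.sum_congr rfl fun i hi => (if_neg (by simpa using hi)).symm,
        ← Finset.sum_add_distrib]
      exact Finset.sum_congr rfl fun i _ => by split_ifs <;> simp
    · have h4 : 0 ≤ (κ - 1) / p := by apply div_nonneg <;> linarith
      rcases Nat.eq_zero_or_pos k with hk0 | hk0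
      · rw [hc, if_pos hk0, hk0]
        simpa using h4
      · refine (two_term_holder hp0 (by linarith) h0 h2 hc0).trans ?_
        rw [hc, if_neg hk0.ne']
        have h5 : 1 - 1 / p + κ / p = 1 + (κ - 1) / p := by ring
        rw [h5]
        calc _ ≤ 1 + (κ - 1) / p := Real.rpow_le_self_of_one_le (by linarith) (by norm_num)
          _ ≤ _ := by linarith [Real.add_one_le_exp ((κ - 1) / p)]
  obtain ⟨hx1, hD0, hD1, hxk, hxe⟩ := hDz x hx hX
  obtain ⟨hy1, hD0', hD1', hyk, hye⟩ := hDz y hy hY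
  set D := ∑ i ∈ Finset.range k, x i with hD
  set D' := ∑ i ∈ Finset.range k, y i with hD'
  set A := (1 - D) ^ (3/4 : ℝ) * c ^ (1/4 : ℝ) with hA
  set A' := (1 - D') ^ (3/4 : ℝ) * c ^ (1/4 : ℝ) with hA'
  set B := D ^ (3/4 : ℝ) * (κ / p) ^ (1/4 : ℝ) with hB
  set B' := D' ^ (3/4 : ℝ) * (κ / p) ^ (1/4 : ℝ) with hB'
  have hcell : cellWeight p κ k k = c * c := by
    simp [cellWeight, hc]
  have e1 : (∑ i ∈ Finset.range n, ∑ j ∈ Finset.range n, if min i j = k then e i j else 0) ≤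
      A * A' := by
    refine hstar.trans_eq ?_
    rw [hx1, hy1, hcell, Real.mul_rpow hc0 hc0, Real.mul_rpow (by linarith) (by linarith)]
    ring
  have hκp : (1 / p) ^ (1/4 : ℝ) ≤ (κ / p) ^ (1/4 : ℝ) := by gcongr
  -- sums of the row and column cells below level `k`
  have hlow : ∀ (z : ℕ → ℝ), (∀ i, 0 ≤ z i) → ∀ (t E : ℝ) (f : ℕ → ℝ), 0 ≤ t → t ≤ E →
      (∀ i < k, f i ≤ (c * ((if i = 0 then 1 else 1 - 1 / p) * (1 / p) ^ (k - i)) * κ) ^ (1/4 : ℝ) *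
        (z i * t) ^ (3/4 : ℝ)) →
      ∑ i ∈ Finset.range k, f i ≤ (∑ i ∈ Finset.range k, z i) ^ (3/4 : ℝ) *
        (κ / p) ^ (1/4 : ℝ) * (E ^ (3/4 : ℝ) * c ^ (1/4 : ℝ)) := by
    intro z hz t E f ht htE hf
    rcases Nat.eq_zero_or_pos k with hk0 | hk0
    · rw [hk0]; simp
    calc _ ≤ ∑ i ∈ Finset.range k, (κ ^ (1/4 : ℝ) * c ^ (1/4 : ℝ) * E ^ (3/4 : ℝ)) *
          (z i ^ (3/4 : ℝ) *
            ((if i = 0 then 1 else 1 - 1 / p) * (1 / p) ^ (k - i)) ^ (1/4 : ℝ)) := by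
          refine Finset.sum_le_sum fun i hi => (hf i (Finset.mem_range.1 hi)).trans ?_
          have h6 : 0 ≤ (if i = 0 then 1 else 1 - 1 / p) * (1 / p) ^ (k - i) := by
            have : (0:ℝ) ≤ if i = 0 then 1 else 1 - 1 / p := by split_ifs <;> linarith
            positivity
          have h7 : t ^ (3/4 : ℝ) ≤ E ^ (3/4 : ℝ) := by gcongr
          rw [Real.mul_rpow (by positivity) (by linarith), Real.mul_rpow hc0 h6,
            Real.mul_rpow (hz i) ht]
          have h8 := hz i
          calc _ ≤ c ^ (1/4 : ℝ) * ((if i = 0 then 1 else 1 - 1 / p) * (1 / p) ^ (k - i)) ^ (1/4 : ℝ) *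
                κ ^ (1/4 : ℝ) * (z i ^ (3/4 : ℝ) * E ^ (3/4 : ℝ)) := by gcongr
            _ = _ := by ring
      _ ≤ (κ ^ (1/4 : ℝ) * c ^ (1/4 : ℝ) * E ^ (3/4 : ℝ)) *
          ((∑ i ∈ Finset.range k, z i) ^ (3/4 : ℝ) * (1 / p) ^ (1/4 : ℝ)) := by
          rw [← Finset.mul_sum]
          have : 0 ≤ E := ht.trans htE
          gcongr
          exact sum_lower_cells_le hp hk0.ne' hz
      _ = _ := by
          rw [show κ / p = κ * (1 / p) by ring, Real.mul_rpow (by linarith) hpi]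
          ring
  have hrow : ∑ i ∈ Finset.range k, e i k ≤ B * A' := by
    refine hlow x hx (y k) (1 - D') _ (hy k) hyk fun i hi => (he i k).trans ?_
    have := hx i
    have := hy k
    gcongr ?_ ^ _ * _
    · exact (cellWeight_pos hp hκ i k).le
    · rw [cellWeight, if_neg (show ¬ k < i by omega), show i - k + (k - i) = k - i by omega]
      have : (0:ℝ) ≤ if i = 0 then 1 else 1 - 1 / p := by split_ifs <;> linarith
      calc _ = (c * ((if i = 0 then 1 else 1 - 1 / p) * (1 / p) ^ (k - i))) * 1 := by rw [hc]; ring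
        _ ≤ _ := by gcongr
  have hcol : ∑ j ∈ Finset.range k, e k j ≤ B' * A := by
    refine hlow y hy (x k) (1 - D) _ (hx k) hxk fun i hi => (he k i).trans ?_
    have := hx k
    have := hy i
    rw [mul_comm (x k)]
    gcongr ?_ ^ _ * _
    · exact (cellWeight_pos hp hκ k i).le
    · rw [cellWeight, if_pos hi, show k - i + (i - k) = k - i by omega]
      exact le_of_eq (by rw [hc]; ring)
  have hrest : ∑ i ∈ Finset.range n, ∑ j ∈ Finset.range n, (if min i j = k then 0 else e i j) ≤
      B * A' + B' * A + 14 * K * ((1 - x k) * (1 - y k)) ^ (3/4 : ℝ) := by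
    have he' : ∀ i j, (if min i j = k then 0 else e i j) ≤
        cellWeight p κ i j ^ (1/4 : ℝ) * (x i * y j) ^ (3/4 : ℝ) := by
      intro i j
      split_ifs
      · have := hx i
        have := hy j
        have := cellWeight_pos hp hκ i j
        positivity
      · exact he i j
    have h9 := sum_cells_erase_le hp hκ hK hx hy hX hY he' hk
    rw [sum_range_sum_range_split n k hk]
    have hsub : Finset.range k ⊆ (Finset.range n).erase k := fun i hi => by
      simp at hi ⊢; omega
    have h10 : ∑ i ∈ (Finset.range n).erase k, (if min i k = k then 0 else e i k) =
        ∑ i ∈ Finset.range k, e i k := by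
      rw [← Finset.sum_subset hsub fun i hi hi' => if_pos (by simp at hi'; omega)]
      exact Finset.sum_congr rfl fun i hi => if_neg (by simp at hi; omega)
    have h11 : ∑ j ∈ (Finset.range n).erase k, (if min k j = k then 0 else e k j) =
        ∑ j ∈ Finset.range k, e k j := by
      rw [← Finset.sum_subset hsub fun i hi hi' => if_pos (by simp at hi'; omega)]
      exact Finset.sum_congr rfl fun i hi => if_neg (by simp at hi; omega)
    rw [h10, h11, if_pos (min_self k)]
    linarith
  have hsplit : ∑ i ∈ Finset.range n, ∑ j ∈ Finset.range n, e i j =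
      (∑ i ∈ Finset.range n, ∑ j ∈ Finset.range n, if min i j = k then e i j else 0) +
      ∑ i ∈ Finset.range n, ∑ j ∈ Finset.range n, (if min i j = k then 0 else e i j) := by
    simp_rw [← Finset.sum_add_distrib]
    exact Finset.sum_congr rfl fun i _ => Finset.sum_congr rfl fun j _ => by split_ifs <;> simp
  have hB0 : 0 ≤ B := by positivity
  have hB0' : 0 ≤ B' := by positivity
  have hA0' : 0 ≤ A' := by have : 0 ≤ 1 - D' := by linarith
                           positivity
  have hfin : (A + B) * (A' + B') ≤ Real.exp (2 * ((κ - 1) / p)) := by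
    rw [two_mul, Real.exp_add]
    gcongr
  have h12 : 0 ≤ B * B' := by positivity
  have h13 : (A + B) * (A' + B') = A * A' + B * A' + B' * A + B * B' := by ring
  linarith

theorem exp_add_le_exp_add {a b : ℝ} (ha : 0 ≤ a) (hb : 0 ≤ b) :
    Real.exp a + b ≤ Real.exp (a + b) := by
  rw [Real.exp_add]
  nlinarith [Real.add_one_le_exp b, Real.one_le_exp ha]

theorem exists_local_constant_normalized (K : ℝ) (hK1 : 1 ≤ K) : ∃ C : ℝ, 0 ≤ C ∧
    ∀ (p κ : ℝ), 2 ≤ p → 1 ≤ κ → κ ≤ K → ∀ (n : ℕ) (x y : ℕ → ℝ) (e : ℕ → ℕ → ℝ),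
    (∀ i, 0 ≤ x i) → (∀ i, 0 ≤ y i) →
    ∑ i ∈ Finset.range n, x i = 1 → ∑ i ∈ Finset.range n, y i = 1 →
    (∀ i j, e i j ≤ cellWeight p κ i j ^ (1/4 : ℝ) * (x i * y j) ^ (3/4 : ℝ)) →
    (∀ k ∈ Finset.range n,
      ∑ i ∈ Finset.range n, ∑ j ∈ Finset.range n, (if min i j = k then e i j else 0) ≤
      cellWeight p κ k k ^ (1/4 : ℝ) *
        ((∑ i ∈ Finset.range n, if k ≤ i then x i else 0) *
          ∑ j ∈ Finset.range n, if k ≤ j then y j else 0) ^ (3/4 : ℝ)) →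
    ∑ i ∈ Finset.range n, ∑ j ∈ Finset.range n, e i j ≤
      Real.exp (2 * ((κ - 1) / p) + C * (1 / p) ^ (3/2 : ℝ)) := by
  set η : ℝ := 1 / (64 * (14 * K) ^ 2) with hη
  set B : ℝ := (16 * K) ^ 3 with hB
  set C : ℝ := 8 * K * B with hC
  set p₀ : ℝ := (52 * K / η) ^ 4 with hp₀
  have hη0 : 0 < η := by positivity
  have hη64 : η ≤ 1 / 64 := by
    rw [hη]
    apply one_div_le_one_div_of_le (by norm_num)
    nlinarith
  have hC0 : 0 < C := by positivity
  have hp₀0 : 0 < p₀ := by positivity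
  refine ⟨13 * K * p₀ ^ (3/2 : ℝ) + 14 * K * C ^ (3/2 : ℝ), by positivity, ?_⟩
  intro p κ hp hκ hK n x y e hx hy hX hY he hstar
  have hp0 : 0 < p := by linarith
  have hκp : 0 ≤ 2 * ((κ - 1) / p) := by
    have : 0 ≤ κ - 1 := by linarith
    positivity
  have hr : 0 ≤ (1 / p) ^ (3/2 : ℝ) := by positivity
  have hone : (1 : ℝ) ≤ Real.exp (2 * ((κ - 1) / p) +
      (13 * K * p₀ ^ (3/2 : ℝ) + 14 * K * C ^ (3/2 : ℝ)) * (1 / p) ^ (3/2 : ℝ)) :=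
    Real.one_le_exp (by positivity)
  have hx1 : ∀ i ∈ Finset.range n, x i ≤ 1 := fun i hi =>
    (Finset.single_le_sum (fun j _ => hx j) hi).trans hX.le
  have hy1 : ∀ i ∈ Finset.range n, y i ≤ 1 := fun i hi =>
    (Finset.single_le_sum (fun j _ => hy j) hi).trans hY.le
  by_cases hpp : p < p₀
  · have h1 := sum_cells_le_of_spread hp hκ hK hx hy hX hY he (η := 0)
      (fun i hi => by nlinarith [hx1 i hi, hy1 i hi, hx i, hy i])
    have h2 := rpow_quarter_inv_lt hp
    have h3 : 1 ≤ p₀ ^ (3/2 : ℝ) * (1 / p) ^ (3/2 : ℝ) := by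
      rw [← Real.mul_rpow hp₀0.le (by positivity)]
      apply Real.one_le_rpow _ (by norm_num)
      rw [mul_one_div, one_le_div hp0]
      exact hpp.le
    calc _ ≤ _ := h1
      _ ≤ 1 + 13 * K := by
        rw [sub_zero, Real.one_rpow]
        nlinarith
      _ ≤ Real.exp (13 * K) := by linarith [Real.add_one_le_exp (13 * K)]
      _ ≤ _ := by
        apply Real.exp_le_exp.2
        have h4 : 0 ≤ 14 * K * C ^ (3/2 : ℝ) * (1 / p) ^ (3/2 : ℝ) := by positivity
        nlinarith
  push Not at hpp
  by_cases hsp : ∀ i ∈ Finset.range n, x i * y i ≤ 1 - η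
  · refine le_trans ?_ hone
    have h1 := sum_cells_le_of_spread hp hκ hK hx hy hX hY he hsp
    have h2 : (1 - η) ^ (1/4 : ℝ) ≤ 1 - η / 4 := by
      have h := Real.geom_mean_le_arith_mean2_weighted (w₁ := 1/4) (w₂ := 3/4) (p₁ := 1 - η)
        (p₂ := 1) (by norm_num) (by norm_num) (by linarith) (by norm_num) (by norm_num)
      rw [Real.one_rpow] at h
      linarith
    have h3 : (1 / p) ^ (1/4 : ℝ) ≤ η / (52 * K) := by
      calc _ ≤ (1 / p₀) ^ (1/4 : ℝ) := by gcongr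
        _ = η / (52 * K) := by
          rw [hp₀, ← one_div_pow, ← Real.rpow_natCast, ← Real.rpow_mul (by positivity)]
          norm_num
    have h4 : 13 * K * (1 / p) ^ (1/4 : ℝ) ≤ 13 * K * (η / (52 * K)) := by gcongr
    have h5 : 13 * K * (η / (52 * K)) = η / 4 := by field_simp; norm_num
    linarith
  push Not at hsp
  obtain ⟨k, hk, hxy⟩ := hsp
  have hxk := hx1 k hk
  have hyk := hy1 k hk
  have hxk0 := hx k
  have hyk0 := hy k
  set s := 1 - x k with hs
  set t := 1 - y k with ht
  have hs0 : 0 ≤ s := by linarith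
  have ht0 : 0 ≤ t := by linarith
  have hsη : s ≤ η := by nlinarith
  have htη : t ≤ η := by nlinarith
  by_cases hσ : s < C / p ∧ t < C / p
  · have h1 := sum_cells_le_of_star hp hκ hK hx hy hX hY he hk (hstar k hk)
    rw [← hs, ← ht] at h1
    have h2 : (s * t) ^ (3/4 : ℝ) ≤ C ^ (3/2 : ℝ) * (1 / p) ^ (3/2 : ℝ) := by
      calc _ ≤ ((C / p) * (C / p)) ^ (3/4 : ℝ) := by
            gcongr
            · exact hσ.1.le
            · exact hσ.2.le
        _ = (C * (1 / p)) ^ (3/2 : ℝ) := by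
            rw [← sq, ← Real.rpow_natCast, ← Real.rpow_mul (by positivity), mul_one_div]
            norm_num
        _ = _ := by rw [Real.mul_rpow hC0.le (by positivity)]
    have h3 : 14 * K * (s * t) ^ (3/4 : ℝ) ≤
        (13 * K * p₀ ^ (3/2 : ℝ) + 14 * K * C ^ (3/2 : ℝ)) * (1 / p) ^ (3/2 : ℝ) := by
      calc _ ≤ 14 * K * (C ^ (3/2 : ℝ) * (1 / p) ^ (3/2 : ℝ)) := by gcongr
        _ ≤ 13 * K * p₀ ^ (3/2 : ℝ) * (1 / p) ^ (3/2 : ℝ) +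
            14 * K * (C ^ (3/2 : ℝ) * (1 / p) ^ (3/2 : ℝ)) :=
          le_add_of_nonneg_left (by positivity)
        _ = _ := by ring
    refine h1.trans (le_trans ?_ (exp_add_le_exp_add hκp (by positivity)))
    linarith
  · refine le_trans ?_ hone
    have hst : C / p ≤ s + t := by
      by_contra! hlt
      exact hσ ⟨by linarith, by linarith⟩
    have h1 := sum_cells_le_of_concentrated hp hκ hK hx hy hX hY he hk
    rw [← hs, ← ht] at h1
    have h2 : (x k * y k) ^ (3/4 : ℝ) ≤ (1 - 3/4 * s) * (1 - 3/4 * t) := by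
      rw [Real.mul_rpow hxk0 hyk0]
      have h3 := rpow_three_quarters_one_sub_le (s := s) (by linarith)
      have h4 := rpow_three_quarters_one_sub_le (s := t) (by linarith)
      rw [show 1 - s = x k by rw [hs]; ring] at h3
      rw [show 1 - t = y k by rw [ht]; ring] at h4
      gcongr
      linarith
    have hlin : ∀ r : ℝ, 0 ≤ r →
        K * (r ^ (3/4 : ℝ) * (4 / p) ^ (1/4 : ℝ)) ≤ r / 16 + K * B / p := by
      intro r hr
      have h3 := rpow_mul_rpow_le_linear hr hp0 (u := 1 / (16 * K)) (by positivity)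
      calc _ ≤ K * (1 / (16 * K) * r + 1 / (1 / (16 * K)) ^ 3 / p) := by gcongr
        _ = _ := by rw [hB]; field_simp
    have h5 : 14 * K * (s * t) ^ (3/4 : ℝ) ≤ (s + t) / 16 := by
      have h6 := rpow_three_quarters_mul_le hs0 ht0
      have h7 : (s * t) ^ (1/4 : ℝ) ≤ 1 / (8 * (14 * K)) := by
        calc _ ≤ (η * η) ^ (1/4 : ℝ) := by gcongr
          _ = ((1 / (8 * (14 * K))) ^ 4) ^ (1/4 : ℝ) := by rw [hη]; congr 1; field_simp; norm_num
          _ = _ := by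
            rw [← Real.rpow_natCast, ← Real.rpow_mul (by positivity)]
            norm_num
      calc _ ≤ 14 * K * (1 / (8 * (14 * K)) * ((s + t) / 2)) := by
            gcongr
            exact h6.trans (by gcongr)
        _ = _ := by field_simp; ring
    have h8 : s * t ≤ (s + t) / 64 := by nlinarith
    have h9 : C / p = 8 * (K * B / p) := by rw [hC]; ring
    have h10 := hlin s hs0
    have h11 := hlin t ht0
    nlinarith

theorem exists_local_constant (K : ℝ) (hK1 : 1 ≤ K) : ∃ C : ℝ, 0 ≤ C ∧
    ∀ (p κ : ℝ), 2 ≤ p → 1 ≤ κ → κ ≤ K → ∀ (n : ℕ) (x y : ℕ → ℝ) (e : ℕ → ℕ → ℝ),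
    (∀ i, 0 ≤ x i) → (∀ i, 0 ≤ y i) →
    (∀ i j, e i j ≤ cellWeight p κ i j ^ (1/4 : ℝ) * (x i * y j) ^ (3/4 : ℝ)) →
    (∀ k ∈ Finset.range n,
      ∑ i ∈ Finset.range n, ∑ j ∈ Finset.range n, (if min i j = k then e i j else 0) ≤
      cellWeight p κ k k ^ (1/4 : ℝ) *
        ((∑ i ∈ Finset.range n, if k ≤ i then x i else 0) *
          ∑ j ∈ Finset.range n, if k ≤ j then y j else 0) ^ (3/4 : ℝ)) →
    ∑ i ∈ Finset.range n, ∑ j ∈ Finset.range n, e i j ≤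
      Real.exp (2 * ((κ - 1) / p) + C * (1 / p) ^ (3/2 : ℝ)) *
      ((∑ i ∈ Finset.range n, x i) * ∑ j ∈ Finset.range n, y j) ^ (3/4 : ℝ) := by
  obtain ⟨C, hC0, hC⟩ := exists_local_constant_normalized K hK1
  refine ⟨C, hC0, fun p κ hp hκ hK n x y e hx hy he hstar => ?_⟩
  set X := ∑ i ∈ Finset.range n, x i with hX
  set Y := ∑ i ∈ Finset.range n, y i with hY
  have hX0 : 0 ≤ X := Finset.sum_nonneg fun i _ => hx i
  have hY0 : 0 ≤ Y := Finset.sum_nonneg fun i _ => hy i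
  rcases (mul_nonneg hX0 hY0).eq_or_lt with h0 | hpos
  · have hz : ∀ i ∈ Finset.range n, ∀ j ∈ Finset.range n, x i * y j = 0 := by
      intro i hi j hj
      rcases mul_eq_zero.1 h0.symm with h | h
      · rw [(Finset.sum_eq_zero_iff_of_nonneg fun i _ => hx i).1 h i hi, zero_mul]
      · rw [(Finset.sum_eq_zero_iff_of_nonneg fun i _ => hy i).1 h j hj, mul_zero]
    refine (Finset.sum_nonpos fun i hi => Finset.sum_nonpos fun j hj => ?_).trans (by positivity)
    have := he i j
    rwa [hz i hi j hj, Real.zero_rpow (by norm_num), mul_zero] at this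
  have hX1 : 0 < X := hX0.lt_of_ne fun h => by rw [← h] at hpos; simp at hpos
  have hY1 : 0 < Y := hY0.lt_of_ne fun h => by rw [← h] at hpos; simp at hpos
  have hR : 0 < (X * Y) ^ (3/4 : ℝ) := by positivity
  have h := hC p κ hp hκ hK n (fun i => x i / X) (fun j => y j / Y)
    (fun i j => e i j / (X * Y) ^ (3/4 : ℝ)) (fun i => div_nonneg (hx i) hX0)
    (fun i => div_nonneg (hy i) hY0) (by rw [← Finset.sum_div, div_self hX1.ne'])
    (by rw [← Finset.sum_div, div_self hY1.ne']) ?_ ?_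
  · simp_rw [← Finset.sum_div] at h
    rwa [div_le_iff₀ hR] at h
  · intro i j
    rw [div_le_iff₀ hR, mul_assoc, div_mul_div_comm,
      Real.div_rpow (mul_nonneg (hx i) (hy j)) hpos.le, div_mul_cancel₀ _ hR.ne']
    exact he i j
  · intro k hk
    have e1 : ∀ i j, (if min i j = k then e i j / (X * Y) ^ (3/4 : ℝ) else 0) =
        (if min i j = k then e i j else 0) / (X * Y) ^ (3/4 : ℝ) := by
      intro i j; split_ifs <;> simp
    have e2 : ∀ i, (if k ≤ i then x i / X else 0) = (if k ≤ i then x i else 0) / X := by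
      intro i; split_ifs <;> simp
    have e3 : ∀ i, (if k ≤ i then y i / Y else 0) = (if k ≤ i then y i else 0) / Y := by
      intro i; split_ifs <;> simp
    simp_rw [e1, e2, e3, ← Finset.sum_div]
    rw [div_le_iff₀ hR, mul_assoc, div_mul_div_comm,
      Real.div_rpow (mul_nonneg ?_ ?_) hpos.le, div_mul_cancel₀ _ hR.ne']
    · exact hstar k hk
    · exact Finset.sum_nonneg fun i _ => by split_ifs <;> simp [hx]
    · exact Finset.sum_nonneg fun i _ => by split_ifs <;> simp [hy]

theorem exists_subgraph_min_degree {μ : ℕ → ℝ} (hμ : ∀ v, 0 ≤ μ v) {V W : Finset ℕ}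
    {E : Finset (ℕ × ℕ)} (hE : E ⊆ V ×ˢ W) (hpos : 0 < ∑ e ∈ E, μ e.1 * μ e.2)
    (hv : ∀ e ∈ E, 0 < μ e.1 ∧ 0 < μ e.2) :
    ∃ E' ⊆ E, E'.Nonempty ∧
      (∀ v ∈ E'.image Prod.fst,
        (∑ e ∈ E, μ e.1 * μ e.2) / (3 * ∑ v ∈ V, μ v) ≤ ∑ e ∈ E' with e.1 = v, μ e.2) ∧
      (∀ w ∈ E'.image Prod.snd,
        (∑ e ∈ E, μ e.1 * μ e.2) / (3 * ∑ w ∈ W, μ w) ≤ ∑ e ∈ E' with e.2 = w, μ e.1) := by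
  set m := ∑ e ∈ E, μ e.1 * μ e.2 with hm
  set mV := ∑ v ∈ V, μ v with hmV
  set mW := ∑ w ∈ W, μ w with hmW
  have hmV0 : 0 ≤ mV := Finset.sum_nonneg fun v _ => hμ v
  have hmW0 : 0 ≤ mW := Finset.sum_nonneg fun v _ => hμ v
  have hd1 : 0 ≤ m / (3 * mV) := by positivity
  have hd2 : 0 ≤ m / (3 * mW) := by positivity
  let F : Finset (ℕ × ℕ) → ℝ := fun E' => ∑ e ∈ E', μ e.1 * μ e.2 -
    m / (3 * mV) * ∑ v ∈ E'.image Prod.fst, μ v - m / (3 * mW) * ∑ w ∈ E'.image Prod.snd, μ w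
  obtain ⟨E', hE', hmax⟩ := Finset.exists_max_image E.powerset F ⟨E, Finset.mem_powerset_self E⟩
  have hsub := Finset.mem_powerset.1 hE'
  have hle : ∀ (S T : Finset ℕ), S ⊆ T → ∑ v ∈ S, μ v ≤ ∑ v ∈ T, μ v := fun S T h =>
    Finset.sum_le_sum_of_subset_of_nonneg h fun v _ _ => hμ v
  have hthird : ∀ s t : ℝ, 0 ≤ t → s ≤ t → m / (3 * t) * s ≤ m / 3 := by
    intro s t ht hst
    rcases ht.eq_or_lt with rfl | ht
    · simp; positivity
    · rw [div_mul_eq_mul_div, div_le_div_iff₀ (by positivity) (by norm_num)]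
      nlinarith
  have hFE : m / 3 ≤ F E := by
    have h1 := hthird _ _ hmV0 (hle (E.image Prod.fst) V fun v h => by
      obtain ⟨e, he, rfl⟩ := Finset.mem_image.1 h
      exact (Finset.mem_product.1 (hE he)).1)
    have h2 := hthird _ _ hmW0 (hle (E.image Prod.snd) W fun v h => by
      obtain ⟨e, he, rfl⟩ := Finset.mem_image.1 h
      exact (Finset.mem_product.1 (hE he)).2)
    simp only [F]
    linarith
  have hFE' : 0 < F E' := by
    have := hmax E (Finset.mem_powerset_self E)
    linarith
  refine ⟨E', hsub, ?_, ?_, ?_⟩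
  · rw [Finset.nonempty_iff_ne_empty]
    rintro rfl
    simp [F] at hFE'
  · intro v hvE
    have hvpos : 0 < μ v := by
      obtain ⟨e, he, rfl⟩ := Finset.mem_image.1 hvE
      exact (hv e (hsub he)).1
    have h := hmax (E'.filter fun e => ¬ e.1 = v)
      (Finset.mem_powerset.2 ((Finset.filter_subset _ _).trans hsub))
    have h1 : ∑ e ∈ E', μ e.1 * μ e.2 = μ v * ∑ e ∈ E' with e.1 = v, μ e.2 +
        ∑ e ∈ E' with ¬ e.1 = v, μ e.1 * μ e.2 := by
      rw [← Finset.sum_filter_add_sum_filter_not E' (fun e => e.1 = v), Finset.mul_sum]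
      congr 1
      exact Finset.sum_congr rfl fun e he => by rw [(Finset.mem_filter.1 he).2]
    have h2 : ∑ v ∈ (E'.filter fun e => ¬ e.1 = v).image Prod.fst, μ v + μ v ≤
        ∑ v ∈ E'.image Prod.fst, μ v := by
      rw [← Finset.sum_erase_add _ _ hvE]
      refine add_le_add (hle _ _ fun u hu => ?_) le_rfl
      obtain ⟨e, he, rfl⟩ := Finset.mem_image.1 hu
      rw [Finset.mem_filter] at he
      exact Finset.mem_erase.2 ⟨he.2, Finset.mem_image_of_mem _ he.1⟩
    have h3 := hle ((E'.filter fun e => ¬ e.1 = v).image Prod.snd) (E'.image Prod.snd)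
      (Finset.image_subset_image (Finset.filter_subset _ _))
    simp only [F] at h
    have h4 := mul_le_mul_of_nonneg_left h2 hd1
    have h5 := mul_le_mul_of_nonneg_left h3 hd2
    rw [h1] at h
    have h6 : m / (3 * mV) * μ v ≤ (∑ e ∈ E' with e.1 = v, μ e.2) * μ v := by linarith
    exact le_of_mul_le_mul_right h6 hvpos
  · intro w hwE
    have hwpos : 0 < μ w := by
      obtain ⟨e, he, rfl⟩ := Finset.mem_image.1 hwE
      exact (hv e (hsub he)).2
    have h := hmax (E'.filter fun e => ¬ e.2 = w)
      (Finset.mem_powerset.2 ((Finset.filter_subset _ _).trans hsub))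
    have h1 : ∑ e ∈ E', μ e.1 * μ e.2 = (∑ e ∈ E' with e.2 = w, μ e.1) * μ w +
        ∑ e ∈ E' with ¬ e.2 = w, μ e.1 * μ e.2 := by
      rw [← Finset.sum_filter_add_sum_filter_not E' (fun e => e.2 = w), Finset.sum_mul]
      congr 1
      exact Finset.sum_congr rfl fun e he => by rw [(Finset.mem_filter.1 he).2]
    have h2 : ∑ v ∈ (E'.filter fun e => ¬ e.2 = w).image Prod.snd, μ v + μ w ≤
        ∑ v ∈ E'.image Prod.snd, μ v := by
      rw [← Finset.sum_erase_add _ _ hwE]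
      refine add_le_add (hle _ _ fun u hu => ?_) le_rfl
      obtain ⟨e, he, rfl⟩ := Finset.mem_image.1 hu
      rw [Finset.mem_filter] at he
      exact Finset.mem_erase.2 ⟨he.2, Finset.mem_image_of_mem _ he.1⟩
    have h3 := hle ((E'.filter fun e => ¬ e.2 = w).image Prod.fst) (E'.image Prod.fst)
      (Finset.image_subset_image (Finset.filter_subset _ _))
    simp only [F] at h
    have h4 := mul_le_mul_of_nonneg_left h2 hd2
    have h5 := mul_le_mul_of_nonneg_left h3 hd1
    rw [h1] at h
    have h6 : m / (3 * mW) * μ w ≤ (∑ e ∈ E' with e.2 = w, μ e.1) * μ w := by linarith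
    exact le_of_mul_le_mul_right h6 hwpos

/-- The product of `κ p` over the primes `p ∈ P` dividing `n`. -/
noncomputable def primeWeight (P : Finset ℕ) (κ : ℕ → ℝ) (n : ℕ) : ℝ :=
  ∏ p ∈ P, if p ∣ n then κ p else 1

theorem card_multiples_le (N d : ℕ) :
    (((Finset.Icc 1 N).filter fun x => d ∣ x).card : ℝ) ≤ N / d := by
  have : ((Finset.Icc 1 N).filter fun x => d ∣ x).card = N / d := by
    rw [← Nat.Ioc_filter_dvd_card_eq_div]
    rfl
  rw [this]
  exact Nat.cast_div_le

theorem sum_primeWeight_le {P : Finset ℕ} (hP : ∀ p ∈ P, p.Prime) {κ : ℕ → ℝ}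
    (hκ : ∀ p ∈ P, 1 ≤ κ p) (N : ℕ) :
    ∑ x ∈ Finset.Icc 1 N, primeWeight P κ x ≤ N * ∏ p ∈ P, (1 + (κ p - 1) / p) := by
  have hexp : ∀ x, primeWeight P κ x =
      ∑ S ∈ P.powerset, (∏ p ∈ S, (κ p - 1)) * if (∏ p ∈ S, p) ∣ x then 1 else 0 := by
    intro x
    have h1 : primeWeight P κ x = ∏ p ∈ P, (1 + (κ p - 1) * if p ∣ x then 1 else 0) :=
      Finset.prod_congr rfl fun p _ => by split_ifs <;> ring
    rw [h1, Finset.prod_one_add]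
    refine Finset.sum_congr rfl fun S hS => ?_
    have hSP := Finset.mem_powerset.1 hS
    rw [Finset.prod_mul_distrib]
    congr 1
    by_cases h : ∀ p ∈ S, p ∣ x
    · rw [if_pos (Finset.prod_primes_dvd x (fun p hp => (hP p (hSP hp)).prime) h)]
      exact Finset.prod_eq_one fun p hp => if_pos (h p hp)
    · rw [if_neg fun h' => h fun p hp => (Finset.dvd_prod_of_mem _ hp).trans h']
      push Not at h
      obtain ⟨p, hp, hpx⟩ := h
      exact Finset.prod_eq_zero hp (if_neg hpx)
  simp_rw [hexp]
  rw [Finset.sum_comm, Finset.prod_one_add, Finset.mul_sum]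
  refine Finset.sum_le_sum fun S hS => ?_
  have hSP := Finset.mem_powerset.1 hS
  rw [← Finset.mul_sum, Finset.sum_boole, Finset.prod_div_distrib]
  have h3 := card_multiples_le N (∏ p ∈ S, p)
  have h4 : 0 ≤ ∏ p ∈ S, (κ p - 1) := Finset.prod_nonneg fun p hp => by
    linarith [hκ p (hSP hp)]
  calc _ ≤ (∏ p ∈ S, (κ p - 1)) * (N / ((∏ p ∈ S, p : ℕ) : ℝ)) := by gcongr
    _ = _ := by push_cast; ring

theorem totient_div_eq_prod {n : ℕ} (hn : n ≠ 0) :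
    (n.totient : ℝ) / n = ∏ p ∈ n.primeFactors, (1 - 1 / (p : ℝ)) := by
  have h := Nat.totient_eq_mul_prod_factors n
  have h2 : (n.totient : ℝ) = n * ∏ p ∈ n.primeFactors, (1 - (p : ℝ)⁻¹) := by
    have := congrArg (fun x : ℚ => (x : ℝ)) h
    push_cast at this
    exact this
  rw [h2, mul_div_cancel_left₀ _ (Nat.cast_ne_zero.2 hn)]
  simp [one_div]

theorem one_sub_one_div_nonneg {p : ℕ} (hp : p.Prime) : 0 ≤ 1 - 1 / (p : ℝ) := by
  have : (1:ℝ) ≤ p := by exact_mod_cast hp.one_lt.le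
  have : 1 / (p : ℝ) ≤ 1 := by rw [div_le_one] <;> linarith
  linarith

theorem one_sub_one_div_le_one (p : ℕ) : 1 - 1 / (p : ℝ) ≤ 1 := by
  have : 0 ≤ 1 / (p : ℝ) := by positivity
  linarith

theorem prod_le_prod_of_subset_of_mem_unit {S T : Finset ℕ} (h : S ⊆ T) {f : ℕ → ℝ}
    (h0 : ∀ p ∈ T, 0 ≤ f p) (h1 : ∀ p ∈ T, f p ≤ 1) : ∏ p ∈ T, f p ≤ ∏ p ∈ S, f p := by
  rw [← Finset.prod_sdiff h]
  refine mul_le_of_le_one_left (Finset.prod_nonneg fun p hp => h0 p (h hp)) ?_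
  exact Finset.prod_le_one (fun p hp => h0 p (Finset.sdiff_subset hp))
    fun p hp => h1 p (Finset.sdiff_subset hp)

theorem totient_div_le_prod_of_level {P : Finset ℕ} {v : ℕ} (hv : v ≠ 0)
    {a : ℕ → ℕ} (ha : ∀ p ∈ P, a p ≤ v.factorization p) :
    (v.totient : ℝ) / v ≤ ∏ p ∈ P, (if a p = 0 then 1 else 1 - 1 / (p : ℝ)) := by
  rw [totient_div_eq_prod hv]
  have h1 : ∏ p ∈ P, (if a p = 0 then 1 else 1 - 1 / (p : ℝ)) =
      ∏ p ∈ P with ¬ a p = 0, (1 - 1 / (p : ℝ)) := by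
    rw [Finset.prod_filter]
    exact Finset.prod_congr rfl fun p _ => by split_ifs <;> simp_all
  rw [h1]
  refine prod_le_prod_of_subset_of_mem_unit (fun p hp => ?_)
    (fun p hp => one_sub_one_div_nonneg (Nat.prime_of_mem_primeFactors hp))
    fun p _ => one_sub_one_div_le_one p
  rw [Finset.mem_filter] at hp
  have := ha p hp.1
  rw [← Nat.support_factorization, Finsupp.mem_support_iff]
  omega

theorem prod_pow_dvd_of_level {P : Finset ℕ} (hP : ∀ p ∈ P, p.Prime) {v : ℕ}
    {a : ℕ → ℕ} (ha : ∀ p ∈ P, a p ≤ v.factorization p) : ∏ p ∈ P, p ^ a p ∣ v := by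
  refine Finset.prod_dvd_of_isRelPrime (fun p hp q hq hpq => ?_) fun p hp => ?_
  · rw [Function.onFun, ← Nat.coprime_iff_isRelPrime]
    exact Nat.Coprime.pow _ _ ((Nat.coprime_primes (hP p hp) (hP q hq)).2 hpq)
  · exact (pow_dvd_pow p (ha p hp)).trans (Nat.ordProj_dvd v p)

theorem eq_prod_pow_factorization {P : Finset ℕ} {v : ℕ} (hv : v ≠ 0)
    (h : v.primeFactors ⊆ P) : v = ∏ p ∈ P, p ^ v.factorization p := by
  conv_lhs => rw [← Nat.prod_factorization_pow_eq_self hv]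
  exact Finsupp.prod_of_support_subset _ (by simpa using h) _ (by simp)

/-- The pairs `(v, w)` over which the bilinear estimate runs: all primes of `v, w` lie in `P`,
the gcd is large compared to `w ψ(v)` and `v ψ(w)`, and `v / gcd v w` has weight at least `T`. -/
structure IsGoodPair (P : Finset ℕ) (κ : ℕ → ℝ) (T : ℝ) (ψ : ℕ → ℝ) (v w : ℕ) : Prop where
  left_pos : 0 < v
  right_pos : 0 < w
  left_primes : v.primeFactors ⊆ P
  right_primes : w.primeFactors ⊆ P
  left_val_pos : 0 < ψ v
  right_val_pos : 0 < ψ w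
  left_le_gcd : w * ψ v ≤ Nat.gcd v w
  right_le_gcd : v * ψ w ≤ Nat.gcd v w
  le_weight : T ≤ primeWeight P κ (v / Nat.gcd v w)

/-- The mass `φ(v) ψ(v) / v` of a vertex. -/
noncomputable def vertexMass (ψ : ℕ → ℝ) (v : ℕ) : ℝ := (v.totient : ℝ) / v * ψ v

theorem vertexMass_nonneg {ψ : ℕ → ℝ} (hψ : ∀ v, 0 ≤ ψ v) (v : ℕ) : 0 ≤ vertexMass ψ v :=
  mul_nonneg (by positivity) (hψ v)

theorem vertexMass_pos {ψ : ℕ → ℝ} {v : ℕ} (hv : 0 < v) (hψ : 0 < ψ v) : 0 < vertexMass ψ v := by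
  have := Nat.totient_pos.2 hv
  unfold vertexMass
  positivity

theorem primeWeight_mul_le {P : Finset ℕ} {κ : ℕ → ℝ} (hP : ∀ p ∈ P, p.Prime)
    (hκ : ∀ p ∈ P, 1 ≤ κ p) {g x M : ℕ} (hg : g ≠ 0) (hx : x ≠ 0) (hM : M ≠ 0) (hd : g ∣ M * x)
    {c : ℕ → Prop} [DecidablePred c]
    (hc : ∀ p ∈ P, ¬ c p → M.factorization p ≤ g.factorization p) :
    primeWeight P κ (M * x / g) ≤ primeWeight P κ x * ∏ p ∈ P, if c p then κ p else 1 := by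
  unfold primeWeight
  rw [← Finset.prod_mul_distrib]
  refine Finset.prod_le_prod (fun p hp => ?_) fun p hp => ?_
  · have := hκ p hp
    split_ifs <;> linarith
  · have h1 := hκ p hp
    by_cases hcp : c p
    · rw [if_pos hcp]
      split_ifs <;> nlinarith
    · have h2 := hc p hp hcp
      rw [if_neg hcp, mul_one]
      by_cases hpx : p ∣ x
      · rw [if_pos hpx]
        split_ifs <;> linarith
      · rw [if_neg hpx, if_neg]
        intro hpd
        have h3 : x.factorization p = 0 := Nat.factorization_eq_zero_of_not_dvd hpx
        have h4 : (M * x / g).factorization p = 0 := by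
          rw [Nat.factorization_div hd, Nat.factorization_mul hM hx]
          simp
          omega
        rw [Nat.factorization_eq_zero_iff] at h4
        rcases h4 with h | h | h
        · exact h (hP p hp)
        · exact h hpd
        · exact Nat.div_ne_zero_iff.2 ⟨hg, Nat.le_of_dvd (by positivity) hd⟩ h

theorem prod_cellWeight_eq {P : Finset ℕ} (hP : ∀ p ∈ P, p.Prime) (κ : ℕ → ℝ) (a b : ℕ → ℕ) :
    ∏ p ∈ P, cellWeight p (κ p) (a p) (b p) =
      (∏ p ∈ P, (if a p = 0 then 1 else 1 - 1 / (p : ℝ))) *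
      (∏ p ∈ P, (if b p = 0 then 1 else 1 - 1 / (p : ℝ))) *
      (((∏ p ∈ P, p ^ min (a p) (b p) : ℕ) : ℝ) ^ 2 /
        (((∏ p ∈ P, p ^ a p : ℕ) : ℝ) * ((∏ p ∈ P, p ^ b p : ℕ) : ℝ))) *
      ∏ p ∈ P, (if b p < a p then κ p else 1) := by
  unfold cellWeight
  push_cast
  rw [← Finset.prod_pow, ← Finset.prod_mul_distrib, ← Finset.prod_mul_distrib,
    ← Finset.prod_div_distrib, ← Finset.prod_mul_distrib, ← Finset.prod_mul_distrib]
  refine Finset.prod_congr rfl fun p hp => ?_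
  have hp0 : (p : ℝ) ≠ 0 := Nat.cast_ne_zero.2 (hP p hp).ne_zero
  congr 2
  rw [one_div_pow, div_eq_div_iff (by positivity) (by positivity), one_mul, ← pow_mul,
    ← pow_add, ← pow_add]
  congr 1
  rcases le_total (a p) (b p) with h | h
  · rw [min_eq_left h]; omega
  · rw [min_eq_right h]; omega

theorem sum_vertexMass_le {ψ : ℕ → ℝ} {α : Type*} (s : Finset α) (g : α → ℕ) {f B : ℝ}
    (hf : 0 ≤ f) (h : ∀ x ∈ s, ((g x).totient : ℝ) / g x ≤ f ∧ 0 ≤ ψ (g x) ∧ ψ (g x) ≤ B) :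
    ∑ x ∈ s, vertexMass ψ (g x) ≤ s.card * (f * B) := by
  rw [← nsmul_eq_mul]
  refine Finset.sum_le_card_nsmul _ _ _ fun x hx => ?_
  obtain ⟨h1, h2, h3⟩ := h x hx
  unfold vertexMass
  gcongr

theorem gcd_eq_of_settled {P : Finset ℕ} {a b : ℕ → ℕ} {v w : ℕ} (hv : v ≠ 0) (hw : w ≠ 0)
    (hvP : v.primeFactors ⊆ P)
    (h : ∀ p ∈ P, min (v.factorization p) (w.factorization p) = min (a p) (b p)) :
    Nat.gcd v w = ∏ p ∈ P, p ^ min (a p) (b p) := by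
  have hg : Nat.gcd v w ≠ 0 := Nat.gcd_ne_zero_left hv
  rw [eq_prod_pow_factorization hg
    ((Nat.primeFactors_mono (Nat.gcd_dvd_left v w) hv).trans hvP)]
  refine Finset.prod_congr rfl fun p hp => ?_
  rw [Nat.factorization_gcd hv hw, ← h p hp]
  rfl

theorem factorization_prod_pow {P : Finset ℕ} (hP : ∀ p ∈ P, p.Prime) (a : ℕ → ℕ) {q : ℕ}
    (hq : q ∈ P) : (∏ p ∈ P, p ^ a p).factorization q = a q := by
  rw [Nat.factorization_prod_apply fun p hp => pow_ne_zero _ (hP p hp).ne_zero,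
    Finset.sum_eq_single q]
  · simp [(hP q hq).factorization_self]
  · intro p hp hpq
    rw [(hP p hp).factorization_pow, Finsupp.single_eq_of_ne (Ne.symm hpq)]
  · exact fun h => absurd hq h

theorem sq_edge_mass_le_of_settled {P : Finset ℕ} (hP : ∀ p ∈ P, p.Prime) {κ : ℕ → ℝ}
    (hκ : ∀ p ∈ P, 1 ≤ κ p) {T : ℝ} (hT : 0 < T) {ψ : ℕ → ℝ} (hψ : ∀ v, 0 ≤ ψ v)
    {V W : Finset ℕ} {E : Finset (ℕ × ℕ)} (hE : E ⊆ V ×ˢ W) {a b : ℕ → ℕ}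
    (hgood : ∀ e ∈ E, IsGoodPair P κ T ψ e.1 e.2)
    (hset : ∀ e ∈ E, ∀ p ∈ P, a p ≤ e.1.factorization p ∧ b p ≤ e.2.factorization p ∧
      min (e.1.factorization p) (e.2.factorization p) = min (a p) (b p)) :
    (∑ e ∈ E, vertexMass ψ e.1 * vertexMass ψ e.2) ^ 2 ≤
      9 * ((∑ v ∈ V, vertexMass ψ v) * ∑ w ∈ W, vertexMass ψ w) *
      ((∏ p ∈ P, cellWeight p (κ p) (a p) (b p)) * (∏ p ∈ P, (1 + (κ p - 1) / p)) / T) := by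
  set μ := vertexMass ψ with hμ
  have hμ0 : ∀ v, 0 ≤ μ v := vertexMass_nonneg hψ
  set m := ∑ e ∈ E, μ e.1 * μ e.2 with hm
  set mV := ∑ v ∈ V, μ v with hmV
  set mW := ∑ w ∈ W, μ w with hmW
  have hmV0 : 0 ≤ mV := Finset.sum_nonneg fun v _ => hμ0 v
  have hmW0 : 0 ≤ mW := Finset.sum_nonneg fun v _ => hμ0 v
  have hQ0 : 0 ≤ ∏ p ∈ P, (1 + (κ p - 1) / p) := Finset.prod_nonneg fun p hp => by
    have : 0 ≤ κ p - 1 := by linarith [hκ p hp]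
    positivity
  have hY0 : 0 ≤ ∏ p ∈ P, cellWeight p (κ p) (a p) (b p) := Finset.prod_nonneg fun p hp =>
    (cellWeight_pos (by exact_mod_cast (hP p hp).two_le) (hκ p hp) _ _).le
  have hm0 : 0 ≤ m := Finset.sum_nonneg fun e _ => mul_nonneg (hμ0 _) (hμ0 _)
  rcases hm0.eq_or_lt with h0 | hmpos
  · rw [← h0, zero_pow two_ne_zero]
    positivity
  obtain ⟨E', hsub, hne, hdv, hdw⟩ := exists_subgraph_min_degree hμ0 hE hmpos fun e he =>
    ⟨vertexMass_pos (hgood e he).left_pos (hgood e he).left_val_pos,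
      vertexMass_pos (hgood e he).right_pos (hgood e he).right_val_pos⟩
  have hmVpos : 0 < mV := hmV0.lt_of_ne fun h => by
    obtain ⟨e, he⟩ := hne
    have h1 := (Finset.sum_eq_zero_iff_of_nonneg fun v _ => hμ0 v).1 h.symm e.1
      (Finset.mem_product.1 (hE (hsub he))).1
    have := vertexMass_pos (hgood e (hsub he)).left_pos (hgood e (hsub he)).left_val_pos
    exact this.ne' h1
  have hmWpos : 0 < mW := hmW0.lt_of_ne fun h => by
    obtain ⟨e, he⟩ := hne
    have h1 := (Finset.sum_eq_zero_iff_of_nonneg fun v _ => hμ0 v).1 h.symm e.2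
      (Finset.mem_product.1 (hE (hsub he))).2
    have := vertexMass_pos (hgood e (hsub he)).right_pos (hgood e (hsub he)).right_val_pos
    exact this.ne' h1
  obtain ⟨v₀, hv₀, hv₀max⟩ := Finset.exists_max_image (E'.image Prod.fst) id (hne.image _)
  obtain ⟨w₀, hw₀, hw₀max⟩ := Finset.exists_max_image (E'.image Prod.snd) id (hne.image _)
  have hd1 := hdv v₀ hv₀
  have hd2 := hdw w₀ hw₀
  have hv₀pos : 0 < v₀ := by
    obtain ⟨e, he, rfl⟩ := Finset.mem_image.1 hv₀
    exact (hgood e (hsub he)).left_pos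
  have hw₀pos : 0 < w₀ := by
    obtain ⟨e, he, rfl⟩ := Finset.mem_image.1 hw₀
    exact (hgood e (hsub he)).right_pos
  set fa := ∏ p ∈ P, (if a p = 0 then 1 else 1 - 1 / (p : ℝ)) with hfa
  set fb := ∏ p ∈ P, (if b p = 0 then 1 else 1 - 1 / (p : ℝ)) with hfb
  have hf0 : ∀ c : ℕ → ℕ, 0 ≤ ∏ p ∈ P, (if c p = 0 then 1 else 1 - 1 / (p : ℝ)) := fun c =>
    Finset.prod_nonneg fun p hp => by
      have := one_sub_one_div_nonneg (hP p hp)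
      split_ifs <;> linarith
  have hfa0 : 0 ≤ fa := hf0 a
  have hfb0 : 0 ≤ fb := hf0 b
  set M := ∏ p ∈ P, p ^ a p with hM
  set M' := ∏ p ∈ P, p ^ b p with hM'
  set G := ∏ p ∈ P, p ^ min (a p) (b p) with hG
  have hpow0 : ∀ c : ℕ → ℕ, 0 < ∏ p ∈ P, p ^ c p := fun c =>
    Finset.prod_pos fun p hp => pow_pos (hP p hp).pos _
  have hM0 : 0 < M := hpow0 a
  have hM0' : 0 < M' := hpow0 b
  have hG0 : 0 < G := hpow0 _
  set h := ∏ p ∈ P, (if b p < a p then κ p else 1) with hh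
  have hh1 : 1 ≤ h := by
    refine (Finset.prod_const_one (s := P)).ge.trans
      (Finset.prod_le_prod (fun _ _ => zero_le_one) fun p hp => ?_)
    have := hκ p hp
    split_ifs <;> linarith
  set Q := ∏ p ∈ P, (1 + (κ p - 1) / p) with hQ
  have hgcd : ∀ e ∈ E, Nat.gcd e.1 e.2 = G := fun e he =>
    gcd_eq_of_settled (hgood e he).left_pos.ne' (hgood e he).right_pos.ne'
      (hgood e he).left_primes fun p hp => (hset e he p hp).2.2
  have hMdvd : ∀ e ∈ E, M ∣ e.1 := fun e he => prod_pow_dvd_of_level hP fun p hp =>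
    (hset e he p hp).1
  have hMdvd' : ∀ e ∈ E, M' ∣ e.2 := fun e he => prod_pow_dvd_of_level hP fun p hp =>
    (hset e he p hp).2.1
  -- the degree of the largest left vertex
  have hb1 : ∑ e ∈ E' with e.1 = v₀, μ e.2 ≤ fb * (G / v₀) * (w₀ / M') := by
    refine (sum_vertexMass_le (B := (G : ℝ) / v₀) _ _ hfb0 fun e he => ?_).trans ?_
    · rw [Finset.mem_filter] at he
      have hg := hgood e (hsub he.1)
      refine ⟨totient_div_le_prod_of_level hg.right_pos.ne' fun p hp =>
        (hset e (hsub he.1) p hp).2.1, hψ _, ?_⟩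
      rw [le_div_iff₀ (by positivity), mul_comm, ← hgcd e (hsub he.1), ← he.2]
      exact hg.right_le_gcd
    · have hcard : ((E'.filter fun e => e.1 = v₀).card : ℝ) ≤ w₀ / M' := by
        refine le_trans ?_ (card_multiples_le w₀ M')
        rw [Nat.cast_le]
        refine Finset.card_le_card_of_injOn Prod.snd (fun e he => ?_) fun e he e' he' hee => ?_
        · rw [Finset.mem_coe, Finset.mem_filter] at he
          simp only [Finset.coe_filter, Set.mem_ofPred_eq, Finset.mem_Icc]
          exact ⟨⟨(hgood e (hsub he.1)).right_pos, hw₀max _ (Finset.mem_image_of_mem _ he.1)⟩,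
            hMdvd' e (hsub he.1)⟩
        · rw [Finset.mem_coe, Finset.mem_filter] at he he'
          exact Prod.ext (he.2.trans he'.2.symm) hee
      calc _ ≤ w₀ / M' * (fb * ((G : ℝ) / v₀)) := by gcongr
        _ = _ := by ring
  have hb2 : ∑ e ∈ E' with e.2 = w₀, μ e.1 ≤ fa * (G / w₀) * (v₀ / M * (h * Q / T)) := by
    refine (sum_vertexMass_le (B := (G : ℝ) / w₀) _ _ hfa0 fun e he => ?_).trans ?_
    · rw [Finset.mem_filter] at he
      have hg := hgood e (hsub he.1)
      refine ⟨totient_div_le_prod_of_level hg.left_pos.ne' fun p hp =>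
        (hset e (hsub he.1) p hp).1, hψ _, ?_⟩
      rw [le_div_iff₀ (by positivity), mul_comm, ← hgcd e (hsub he.1), ← he.2]
      exact hg.left_le_gcd
    · have hcard : ((E'.filter fun e => e.2 = w₀).card : ℝ) ≤ v₀ / M * (h * Q / T) := by
        have h1 : (E'.filter fun e => e.2 = w₀).card ≤
            ((Finset.Icc 1 (v₀ / M)).filter fun x => T / h ≤ primeWeight P κ x).card := by
          refine Finset.card_le_card_of_injOn (fun e => e.1 / M) (fun e he => ?_)
            fun e he e' he' hee => ?_
          · rw [Finset.mem_coe, Finset.mem_filter] at he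
            simp only [Finset.coe_filter, Set.mem_ofPred_eq, Finset.mem_Icc]
            have hg := hgood e (hsub he.1)
            have hMe := hMdvd e (hsub he.1)
            have hx1 : 1 ≤ e.1 / M := Nat.div_pos (Nat.le_of_dvd hg.left_pos hMe) hM0
            refine ⟨⟨hx1, Nat.div_le_div_right (hv₀max _ (Finset.mem_image_of_mem _ he.1))⟩, ?_⟩
            rw [div_le_iff₀ (by linarith)]
            refine hg.le_weight.trans ?_
            rw [hgcd e (hsub he.1)]
            have hMx : M * (e.1 / M) = e.1 := Nat.mul_div_cancel' hMe
            have h2 := primeWeight_mul_le (x := e.1 / M) (c := fun p => b p < a p) hP hκ hG0.ne'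
              (by omega) hM0.ne' (by
                rw [hMx, ← hgcd e (hsub he.1)]; exact Nat.gcd_dvd_left _ _) (fun p hp hc => by
                rw [hM, hG, factorization_prod_pow hP _ hp, factorization_prod_pow hP _ hp]
                omega)
            rwa [hMx] at h2
          · rw [Finset.mem_coe, Finset.mem_filter] at he he'
            refine Prod.ext ?_ (he.2.trans he'.2.symm)
            rw [← Nat.mul_div_cancel' (hMdvd e (hsub he.1)),
              ← Nat.mul_div_cancel' (hMdvd e' (hsub he'.1))]
            exact congrArg _ hee
        have h2 : ((((Finset.Icc 1 (v₀ / M)).filter fun x => T / h ≤ primeWeight P κ x).card : ℝ)) *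
            (T / h) ≤ (v₀ / M) * Q := by
          calc _ = ∑ x ∈ (Finset.Icc 1 (v₀ / M)).filter (fun x => T / h ≤ primeWeight P κ x),
                T / h := by rw [Finset.sum_const, nsmul_eq_mul]
            _ ≤ ∑ x ∈ (Finset.Icc 1 (v₀ / M)).filter (fun x => T / h ≤ primeWeight P κ x),
                primeWeight P κ x := Finset.sum_le_sum fun x hx => (Finset.mem_filter.1 hx).2
            _ ≤ ∑ x ∈ Finset.Icc 1 (v₀ / M), primeWeight P κ x :=
              Finset.sum_le_sum_of_subset_of_nonneg (Finset.filter_subset _ _) fun x _ _ =>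
                Finset.prod_nonneg fun p hp => by
                  have := hκ p hp
                  split_ifs <;> linarith
            _ ≤ ((v₀ / M : ℕ) : ℝ) * Q := sum_primeWeight_le hP hκ _
            _ ≤ _ := by
              gcongr
              exact Nat.cast_div_le
        have hh0 : 0 < h := by linarith
        calc _ ≤ ((((Finset.Icc 1 (v₀ / M)).filter fun x => T / h ≤ primeWeight P κ x).card : ℝ)) := by
              exact_mod_cast h1
          _ = ((((Finset.Icc 1 (v₀ / M)).filter fun x => T / h ≤ primeWeight P κ x).card : ℝ)) *
              (T / h) * (h / T) := by field_simp
          _ ≤ (v₀ / M) * Q * (h / T) := by gcongr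
          _ = _ := by ring
      calc _ ≤ v₀ / M * (h * Q / T) * (fa * ((G : ℝ) / w₀)) := by gcongr
        _ = _ := by ring
  rw [prod_cellWeight_eq hP, ← hfa, ← hfb, ← hh, ← hM, ← hM', ← hG]
  have hprod : m / (3 * mV) * (m / (3 * mW)) ≤
      fb * (G / v₀) * (w₀ / M') * (fa * (G / w₀) * (v₀ / M * (h * Q / T))) :=
    mul_le_mul (hd1.trans hb1) (hd2.trans hb2) (by positivity) (by positivity)
  have e1 : m ^ 2 = 9 * (mV * mW) * (m / (3 * mV) * (m / (3 * mW))) := by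
    field_simp
    norm_num
  have e2 : fb * (G / v₀) * (w₀ / M') * (fa * (G / w₀) * (v₀ / M * (h * Q / T))) =
      fa * fb * ((G : ℝ) ^ 2 / (M * M')) * h * Q / T := by
    field_simp
  rw [e1, ← e2]
  gcongr

theorem edge_mass_le_of_settled {P : Finset ℕ} (hP : ∀ p ∈ P, p.Prime) {κ : ℕ → ℝ}
    (hκ : ∀ p ∈ P, 1 ≤ κ p) {T : ℝ} (hT : 0 < T) {ψ : ℕ → ℝ} (hψ : ∀ v, 0 ≤ ψ v)
    {V W : Finset ℕ} {E : Finset (ℕ × ℕ)} (hE : E ⊆ V ×ˢ W) {a b : ℕ → ℕ}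
    (hgood : ∀ e ∈ E, IsGoodPair P κ T ψ e.1 e.2)
    (hset : ∀ e ∈ E, ∀ p ∈ P, a p ≤ e.1.factorization p ∧ b p ≤ e.2.factorization p ∧
      min (e.1.factorization p) (e.2.factorization p) = min (a p) (b p)) :
    ∑ e ∈ E, vertexMass ψ e.1 * vertexMass ψ e.2 ≤
      2 * ((∏ p ∈ P, cellWeight p (κ p) (a p) (b p)) *
        ((∏ p ∈ P, (1 + (κ p - 1) / p)) / T)) ^ (1/4 : ℝ) *
      ((∑ v ∈ V, vertexMass ψ v) * ∑ w ∈ W, vertexMass ψ w) ^ (3/4 : ℝ) := by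
  have h := sq_edge_mass_le_of_settled hP hκ hT hψ hE hgood hset
  rw [mul_div_assoc] at h
  have hμ0 := vertexMass_nonneg hψ
  set m := ∑ e ∈ E, vertexMass ψ e.1 * vertexMass ψ e.2 with hm
  set Z := (∑ v ∈ V, vertexMass ψ v) * ∑ w ∈ W, vertexMass ψ w with hZ
  set A := (∏ p ∈ P, cellWeight p (κ p) (a p) (b p)) *
        ((∏ p ∈ P, (1 + (κ p - 1) / p)) / T) with hA
  have hm0 : 0 ≤ m := Finset.sum_nonneg fun e _ => mul_nonneg (hμ0 _) (hμ0 _)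
  have hmZ : m ≤ Z := by
    rw [hZ, Finset.sum_mul_sum, ← Finset.sum_product']
    exact Finset.sum_le_sum_of_subset_of_nonneg hE fun e _ _ => mul_nonneg (hμ0 _) (hμ0 _)
  have hZ0 : 0 ≤ Z := hm0.trans hmZ
  have hA0 : 0 ≤ A := by
    have h1 : 0 ≤ ∏ p ∈ P, (1 + (κ p - 1) / p) := Finset.prod_nonneg fun p hp => by
      have : 0 ≤ κ p - 1 := by linarith [hκ p hp]
      positivity
    have h2 : 0 ≤ ∏ p ∈ P, cellWeight p (κ p) (a p) (b p) := Finset.prod_nonneg fun p hp =>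
      (cellWeight_pos (by exact_mod_cast (hP p hp).two_le) (hκ p hp) _ _).le
    positivity
  calc m = (m ^ 4) ^ (1/4 : ℝ) := by
        rw [← Real.rpow_natCast, ← Real.rpow_mul hm0]; norm_num
    _ ≤ (2 ^ 4 * A * Z ^ 3) ^ (1/4 : ℝ) := by
        gcongr
        calc m ^ 4 = m ^ 2 * m ^ 2 := by ring
          _ ≤ (9 * Z * A) * Z ^ 2 := by gcongr
          _ = 9 * (A * Z ^ 3) := by ring
          _ ≤ 16 * (A * Z ^ 3) := by gcongr; norm_num
          _ = _ := by ring
    _ = _ := by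
        rw [Real.mul_rpow (by positivity) (by positivity), Real.mul_rpow (by positivity) hA0,
          ← Real.rpow_natCast, ← Real.rpow_natCast, ← Real.rpow_mul (by norm_num),
          ← Real.rpow_mul hZ0]
        norm_num

theorem edge_mass_le_of_partially_settled {K C : ℝ}
    (hC : ∀ (p κ : ℝ), 2 ≤ p → 1 ≤ κ → κ ≤ K → ∀ (n : ℕ) (x y : ℕ → ℝ) (e : ℕ → ℕ → ℝ),
    (∀ i, 0 ≤ x i) → (∀ i, 0 ≤ y i) →
    (∀ i j, e i j ≤ cellWeight p κ i j ^ (1/4 : ℝ) * (x i * y j) ^ (3/4 : ℝ)) →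
    (∀ k ∈ Finset.range n,
      ∑ i ∈ Finset.range n, ∑ j ∈ Finset.range n, (if min i j = k then e i j else 0) ≤
      cellWeight p κ k k ^ (1/4 : ℝ) *
        ((∑ i ∈ Finset.range n, if k ≤ i then x i else 0) *
          ∑ j ∈ Finset.range n, if k ≤ j then y j else 0) ^ (3/4 : ℝ)) →
    ∑ i ∈ Finset.range n, ∑ j ∈ Finset.range n, e i j ≤
      Real.exp (2 * ((κ - 1) / p) + C * (1 / p) ^ (3/2 : ℝ)) *
      ((∑ i ∈ Finset.range n, x i) * ∑ j ∈ Finset.range n, y j) ^ (3/4 : ℝ))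
    {P : Finset ℕ} (hP : ∀ p ∈ P, p.Prime) {κ : ℕ → ℝ}
    (hκ : ∀ p ∈ P, 1 ≤ κ p) (hκK : ∀ p ∈ P, κ p ≤ K) {T : ℝ} (hT : 0 < T) {ψ : ℕ → ℝ}
    (hψ : ∀ v, 0 ≤ ψ v) (U : Finset ℕ) :
    ∀ (R : Finset ℕ), Disjoint U R → U ∪ R = P → ∀ (a b : ℕ → ℕ)
    (V W : Finset ℕ) (E : Finset (ℕ × ℕ)), E ⊆ V ×ˢ W →
    (∀ e ∈ E, IsGoodPair P κ T ψ e.1 e.2) →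
    (∀ e ∈ E, ∀ p ∈ R, a p ≤ e.1.factorization p ∧ b p ≤ e.2.factorization p ∧
      min (e.1.factorization p) (e.2.factorization p) = min (a p) (b p)) →
    ∑ e ∈ E, vertexMass ψ e.1 * vertexMass ψ e.2 ≤
      (∏ p ∈ U, Real.exp (2 * ((κ p - 1) / p) + C * (1 / p) ^ (3/2 : ℝ))) *
      (2 * ((∏ p ∈ R, cellWeight p (κ p) (a p) (b p)) *
        ((∏ p ∈ P, (1 + (κ p - 1) / p)) / T)) ^ (1/4 : ℝ)) *
      ((∑ v ∈ V, vertexMass ψ v) * ∑ w ∈ W, vertexMass ψ w) ^ (3/4 : ℝ) := by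
  have hμ0 := vertexMass_nonneg hψ
  have hQ0 : 0 < (∏ p ∈ P, (1 + (κ p - 1) / p)) / T := div_pos (Finset.prod_pos fun p hp => by
      have : 0 ≤ κ p - 1 := by linarith [hκ p hp]
      positivity) hT
  induction U using Finset.induction_on with
  | empty =>
    intro R _ hUR a b V W E hE hgood hset
    rw [Finset.empty_union] at hUR
    subst hUR
    rw [Finset.prod_empty, one_mul]
    exact edge_mass_le_of_settled hP hκ hT hψ hE hgood hset
  | insert q U hqU ih =>
    intro R hdisj hUR a b V W E hE hgood hset
    rw [Finset.disjoint_insert_left] at hdisj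
    have hqR := hdisj.1
    have hqP : q ∈ P := by rw [← hUR]; simp
    have hIH := ih (insert q R) (by
      rw [Finset.disjoint_insert_right]; exact ⟨hqU, hdisj.2⟩) (by
      rw [← hUR]; simp)
    have hcell0 : 0 < ∏ p ∈ R, cellWeight p (κ p) (a p) (b p) := Finset.prod_pos fun p hp =>
      have hpP : p ∈ P := by rw [← hUR]; simp [hp]
      cellWeight_pos (by exact_mod_cast (hP p hpP).two_le) (hκ p hpP) _ _
    -- one prime at a time
    set Γ := (∏ p ∈ U, Real.exp (2 * ((κ p - 1) / p) + C * (1 / p) ^ (3/2 : ℝ))) *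
      (2 * ((∏ p ∈ R, cellWeight p (κ p) (a p) (b p)) *
        ((∏ p ∈ P, (1 + (κ p - 1) / p)) / T)) ^ (1/4 : ℝ)) with hΓ
    have hΓ0 : 0 < Γ := by
      have : 0 < ∏ p ∈ U, Real.exp (2 * ((κ p - 1) / p) + C * (1 / p) ^ (3/2 : ℝ)) :=
        Finset.prod_pos fun p _ => Real.exp_pos _
      positivity
    have hq2 : (2:ℝ) ≤ q := by exact_mod_cast (hP q hqP).two_le
    have hcell : ∀ i j, ∀ (V' W' : Finset ℕ) (E' : Finset (ℕ × ℕ)), E' ⊆ V' ×ˢ W' → E' ⊆ E →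
        (∀ e ∈ E', i ≤ e.1.factorization q ∧ j ≤ e.2.factorization q ∧
          min (e.1.factorization q) (e.2.factorization q) = min i j) →
        ∑ e ∈ E', vertexMass ψ e.1 * vertexMass ψ e.2 ≤
          Γ * (cellWeight q (κ q) i j ^ (1/4 : ℝ) *
          ((∑ v ∈ V', vertexMass ψ v) * ∑ w ∈ W', vertexMass ψ w) ^ (3/4 : ℝ)) := by
      intro i j V' W' E' hE' hE'E hset'
      refine (hIH (Function.update a q i) (Function.update b q j) V' W' E' hE'
        (fun e he => hgood e (hE'E he)) ?_).trans_eq ?_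
      · intro e he p hp
        by_cases hpq : p = q
        · subst hpq
          simpa using hset' e he
        · rw [Function.update_of_ne hpq, Function.update_of_ne hpq]
          exact hset e (hE'E he) p ((Finset.mem_insert.1 hp).resolve_left hpq)
      · have hcongr : ∏ p ∈ R, cellWeight p (κ p) (Function.update a q i p)
            (Function.update b q j p) = ∏ p ∈ R, cellWeight p (κ p) (a p) (b p) :=
          Finset.prod_congr rfl fun p hp => by
            have hpq : p ≠ q := fun h => hqR (h ▸ hp)
            rw [Function.update_of_ne hpq, Function.update_of_ne hpq]
        rw [Finset.prod_insert hqR, Function.update_self, Function.update_self, hcongr,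
          mul_assoc (cellWeight _ _ _ _),
          Real.mul_rpow (cellWeight_pos hq2 (hκ q hqP) i j).le (by positivity), hΓ]
        ring
    set n := (V ∪ W).sup (fun v => v.factorization q) + 1 with hn
    have hnV : ∀ v ∈ V, v.factorization q ∈ Finset.range n := fun v hv =>
      Finset.mem_range.2 (Nat.lt_succ_of_le
        (Finset.le_sup (f := fun v : ℕ => v.factorization q) (Finset.mem_union_left _ hv)))
    have hnW : ∀ v ∈ W, v.factorization q ∈ Finset.range n := fun v hv =>
      Finset.mem_range.2 (Nat.lt_succ_of_le
        (Finset.le_sup (f := fun v : ℕ => v.factorization q) (Finset.mem_union_right _ hv)))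
    set x : ℕ → ℝ := fun i => ∑ v ∈ V with v.factorization q = i, vertexMass ψ v with hx
    set y : ℕ → ℝ := fun j => ∑ w ∈ W with w.factorization q = j, vertexMass ψ w with hy
    set ee : ℕ → ℕ → ℝ := fun i j => ∑ e ∈ E with
      (e.1.factorization q = i ∧ e.2.factorization q = j), vertexMass ψ e.1 * vertexMass ψ e.2
      with hee
    have hE1 : ∀ e ∈ E, e.1.factorization q ∈ Finset.range n := fun e he =>
      hnV _ (Finset.mem_product.1 (hE he)).1
    have hE2 : ∀ e ∈ E, e.2.factorization q ∈ Finset.range n := fun e he =>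
      hnW _ (Finset.mem_product.1 (hE he)).2
    have hsumee : ∀ (g : ℕ → ℕ → Prop) [∀ i j, Decidable (g i j)],
        ∑ i ∈ Finset.range n, ∑ j ∈ Finset.range n, (if g i j then ee i j else 0) =
        ∑ e ∈ E with g (e.1.factorization q) (e.2.factorization q),
          vertexMass ψ e.1 * vertexMass ψ e.2 := by
      intro g _
      have h1 : ∀ i j, (if g i j then ee i j else 0) = ∑ e ∈ E, if e.1.factorization q = i then
          (if e.2.factorization q = j then (if g (e.1.factorization q) (e.2.factorization q) then
            vertexMass ψ e.1 * vertexMass ψ e.2 else 0) else 0) else 0 := by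
        intro i j
        simp only [hee]
        rw [Finset.sum_filter]
        split_ifs with hg
        · refine Finset.sum_congr rfl fun e _ => ?_
          by_cases h1 : e.1.factorization q = i <;> by_cases h2 : e.2.factorization q = j <;>
            simp [h1, h2, hg]
        · refine (Finset.sum_eq_zero fun e _ => ?_).symm
          by_cases h1 : e.1.factorization q = i <;> by_cases h2 : e.2.factorization q = j <;>
            simp [h1, h2, hg]
      simp_rw [h1]
      rw [Finset.sum_congr rfl fun i _ => Finset.sum_comm, Finset.sum_comm, Finset.sum_filter]
      refine Finset.sum_congr rfl fun e he => ?_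
      rw [Finset.sum_eq_single (e.1.factorization q) (fun i _ hi => Finset.sum_eq_zero
          fun j _ => if_neg fun h => hi h.symm) fun h => absurd (hE1 e he) h,
        Finset.sum_eq_single (e.2.factorization q) (fun j _ hj => by
          rw [if_pos rfl, if_neg fun h => hj h.symm]) fun h => absurd (hE2 e he) h,
        if_pos rfl, if_pos rfl]
    have hsumx : ∀ (S : Finset ℕ), (∀ v ∈ S, v.factorization q ∈ Finset.range n) →
        ∀ (g : ℕ → Prop) [∀ i, Decidable (g i)],
        (∑ i ∈ Finset.range n, if g i then (∑ v ∈ S with v.factorization q = i, vertexMass ψ v)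
          else 0) = ∑ v ∈ S with g (v.factorization q), vertexMass ψ v := by
      intro S hS g _
      have h1 : ∀ i, (if g i then (∑ v ∈ S with v.factorization q = i, vertexMass ψ v) else 0) =
          ∑ v ∈ S, if v.factorization q = i then (if g (v.factorization q) then
            vertexMass ψ v else 0) else 0 := by
        intro i
        rw [Finset.sum_filter]
        split_ifs with hg
        · refine Finset.sum_congr rfl fun e _ => ?_
          by_cases h1 : e.factorization q = i <;> simp [h1, hg]
        · refine (Finset.sum_eq_zero fun e _ => ?_).symm
          by_cases h1 : e.factorization q = i <;> simp [h1, hg]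
      simp_rw [h1]
      rw [Finset.sum_comm, Finset.sum_filter]
      refine Finset.sum_congr rfl fun v hv => ?_
      rw [Finset.sum_eq_single (v.factorization q) (fun i _ hi => if_neg fun h => hi h.symm)
        fun h => absurd (hS v hv) h, if_pos rfl]
    have hmain := hC q (κ q) hq2 (hκ q hqP) (hκK q hqP) n x y (fun i j => ee i j / Γ)
      (fun i => Finset.sum_nonneg fun v _ => hμ0 v) (fun i => Finset.sum_nonneg fun v _ => hμ0 v)
      ?_ ?_
    · have h1 := hsumee (fun _ _ => True)
      have h2 := hsumx V hnV (fun _ => True)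
      have h3 := hsumx W hnW (fun _ => True)
      simp only [if_true, Finset.filter_true] at h1 h2 h3
      simp_rw [← Finset.sum_div] at hmain
      simp only [hx, hy] at hmain
      rw [h1, h2, h3, div_le_iff₀ hΓ0] at hmain
      refine hmain.trans_eq ?_
      rw [Finset.prod_insert hqU, hΓ]
      ring
    · intro i j
      rw [div_le_iff₀' hΓ0]
      refine hcell i j _ _ _ (fun e he => ?_) (Finset.filter_subset _ _) fun e he => ?_
      · rw [Finset.mem_filter] at he
        have := Finset.mem_product.1 (hE he.1)
        simp only [Finset.mem_product, Finset.mem_filter]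
        exact ⟨⟨this.1, he.2.1⟩, this.2, he.2.2⟩
      · rw [Finset.mem_filter] at he
        rw [he.2.1, he.2.2]
        exact ⟨le_rfl, le_rfl, rfl⟩
    · intro k _
      have e1 : ∀ i j, (if min i j = k then ee i j / Γ else 0) =
          (if min i j = k then ee i j else 0) / Γ := by
        intro i j; split_ifs <;> simp
      simp_rw [e1, ← Finset.sum_div]
      rw [hsumee (fun i j => min i j = k), div_le_iff₀' hΓ0]
      simp only [hx, hy]
      rw [hsumx V hnV (fun i => k ≤ i), hsumx W hnW (fun i => k ≤ i)]
      refine hcell k k _ _ _ (fun e he => ?_) (Finset.filter_subset _ _) fun e he => ?_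
      · rw [Finset.mem_filter] at he
        have := Finset.mem_product.1 (hE he.1)
        simp only [Finset.mem_product, Finset.mem_filter]
        exact ⟨⟨this.1, by omega⟩, this.2, by omega⟩
      · rw [Finset.mem_filter] at he
        exact ⟨by omega, by omega, by omega⟩

/-- The bilinear gcd estimate: the mass of the good pairs is small compared to the product of the
masses of the two vertex sets. -/
theorem exists_edge_mass_constant (K : ℝ) (hK : 1 ≤ K) : ∃ C : ℝ, 0 ≤ C ∧
    ∀ {P : Finset ℕ}, (∀ p ∈ P, p.Prime) → ∀ {κ : ℕ → ℝ}, (∀ p ∈ P, 1 ≤ κ p) →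
    (∀ p ∈ P, κ p ≤ K) → ∀ {T : ℝ}, 0 < T → ∀ {ψ : ℕ → ℝ}, (∀ v, 0 ≤ ψ v) →
    ∀ {V W : Finset ℕ} {E : Finset (ℕ × ℕ)}, E ⊆ V ×ˢ W →
    (∀ e ∈ E, IsGoodPair P κ T ψ e.1 e.2) →
    ∑ e ∈ E, vertexMass ψ e.1 * vertexMass ψ e.2 ≤
      C * Real.exp (3 * ∑ p ∈ P, (κ p - 1) / p) * (1 / T) ^ (1/4 : ℝ) *
      ((∑ v ∈ V, vertexMass ψ v) * ∑ w ∈ W, vertexMass ψ w) ^ (3/4 : ℝ) := by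
  obtain ⟨C, hC0, hC⟩ := exists_local_constant K hK
  have hsum : Summable fun n : ℕ => (1 / (n : ℝ)) ^ (3/2 : ℝ) := by
    have := (Real.summable_one_div_nat_rpow (p := 3/2)).2 (by norm_num)
    refine this.congr fun n => ?_
    rw [Real.div_rpow zero_le_one (Nat.cast_nonneg _), Real.one_rpow]
  refine ⟨2 * Real.exp (C * ∑' n : ℕ, (1 / (n : ℝ)) ^ (3/2 : ℝ)), by positivity, ?_⟩
  intro P hP κ hκ hκK T hT ψ hψ V W E hE hgood
  have h := edge_mass_le_of_partially_settled hC hP hκ hκK hT hψ P ∅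
    (Finset.disjoint_empty_right _) (by simp) (fun _ => 0) (fun _ => 0) V W E hE hgood (by simp)
  rw [Finset.prod_empty, one_mul] at h
  refine h.trans ?_
  have hS0 : 0 ≤ ∑ p ∈ P, (κ p - 1) / p := Finset.sum_nonneg fun p hp => by
    have : 0 ≤ κ p - 1 := by linarith [hκ p hp]
    positivity
  have h1 : ∏ p ∈ P, Real.exp (2 * ((κ p - 1) / p) + C * (1 / (p : ℝ)) ^ (3/2 : ℝ)) ≤
      Real.exp (2 * ∑ p ∈ P, (κ p - 1) / p) *
        Real.exp (C * ∑' n : ℕ, (1 / (n : ℝ)) ^ (3/2 : ℝ)) := by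
    rw [← Real.exp_sum, ← Real.exp_add, Finset.sum_add_distrib, ← Finset.mul_sum,
      ← Finset.mul_sum]
    gcongr
    exact hsum.sum_le_tsum _ fun n _ => by positivity
  have h2 : ((∏ p ∈ P, (1 + (κ p - 1) / p)) / T) ^ (1/4 : ℝ) ≤
      Real.exp (∑ p ∈ P, (κ p - 1) / p) * (1 / T) ^ (1/4 : ℝ) := by
    have h3 : ∏ p ∈ P, (1 + (κ p - 1) / p) ≤ Real.exp (∑ p ∈ P, (κ p - 1) / p) := by
      rw [Real.exp_sum]
      refine Finset.prod_le_prod (fun p hp => ?_) fun p _ => ?_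
      · have : 0 ≤ κ p - 1 := by linarith [hκ p hp]
        positivity
      · linarith [Real.add_one_le_exp ((κ p - 1) / p)]
    have h4 : 0 ≤ ∏ p ∈ P, (1 + (κ p - 1) / p) := Finset.prod_nonneg fun p hp => by
      have : 0 ≤ κ p - 1 := by linarith [hκ p hp]
      positivity
    rw [div_eq_mul_one_div, Real.mul_rpow h4 (by positivity)]
    gcongr
    calc _ ≤ Real.exp (∑ p ∈ P, (κ p - 1) / p) ^ (1/4 : ℝ) := by gcongr
      _ ≤ _ := Real.rpow_le_self_of_one_le (Real.one_le_exp hS0) (by norm_num)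
  have h5 : 0 ≤ ((∏ p ∈ P, (1 + (κ p - 1) / p)) / T) ^ (1/4 : ℝ) := by
    refine Real.rpow_nonneg (div_nonneg (Finset.prod_nonneg fun p hp => ?_) hT.le) _
    have : 0 ≤ κ p - 1 := by linarith [hκ p hp]
    positivity
  have hZ : 0 ≤ (∑ v ∈ V, vertexMass ψ v) * ∑ w ∈ W, vertexMass ψ w :=
    mul_nonneg (Finset.sum_nonneg fun v _ => vertexMass_nonneg hψ v)
      (Finset.sum_nonneg fun v _ => vertexMass_nonneg hψ v)
  calc _ ≤ (Real.exp (2 * ∑ p ∈ P, (κ p - 1) / p) *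
        Real.exp (C * ∑' n : ℕ, (1 / (n : ℝ)) ^ (3/2 : ℝ))) *
        (2 * (Real.exp (∑ p ∈ P, (κ p - 1) / p) * (1 / T) ^ (1/4 : ℝ))) *
        ((∑ v ∈ V, vertexMass ψ v) * ∑ w ∈ W, vertexMass ψ w) ^ (3/4 : ℝ) := by
        gcongr
    _ = _ := by
        rw [show 3 * ∑ p ∈ P, (κ p - 1) / p = 2 * ∑ p ∈ P, (κ p - 1) / p +
          ∑ p ∈ P, (κ p - 1) / p by ring, Real.exp_add]
        ring

theorem card_filter_mod_mod {M q : ℕ} (hcop : Nat.Coprime M q) (hM : 0 < M) (hq : 0 < q)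
    (A B : ℕ → Prop) [DecidablePred A] [DecidablePred B] :
    ((Finset.range (M * q)).filter fun k => A (k % M) ∧ B (k % q)).card ≤
      ((Finset.range M).filter A).card * ((Finset.range q).filter B).card := by
  rw [← Finset.card_product]
  refine Finset.card_le_card_of_injOn (fun k => (k % M, k % q)) (fun k hk => ?_)
    fun k hk l hl h => ?_
  · rw [Finset.mem_coe, Finset.mem_filter] at hk
    simp only [Finset.mem_coe, Finset.mem_product, Finset.mem_filter, Finset.mem_range]
    exact ⟨⟨Nat.mod_lt _ hM, hk.2.1⟩, Nat.mod_lt _ hq, hk.2.2⟩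
  · rw [Finset.mem_coe, Finset.mem_filter, Finset.mem_range] at hk hl
    have h1 : k ≡ l [MOD M] := congrArg Prod.fst h
    have h2 : k ≡ l [MOD q] := congrArg Prod.snd h
    exact Nat.ModEq.eq_of_lt_of_lt ((Nat.modEq_and_modEq_iff_modEq_mul hcop).1 ⟨h1, h2⟩) hk.1 hl.1

theorem card_filter_mod_avoid (P : Finset ℕ) (hP : ∀ p ∈ P, p.Prime) (B : ℕ → ℕ → Prop)
    [∀ p, DecidablePred (B p)] :
    ((Finset.range (∏ p ∈ P, p)).filter fun k => ∀ p ∈ P, B p (k % p)).card ≤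
      ∏ p ∈ P, ((Finset.range p).filter (B p)).card := by
  induction P using Finset.induction_on with
  | empty => simp
  | insert q P hq ih =>
    have hP' : ∀ p ∈ P, p.Prime := fun p hp => hP p (Finset.mem_insert_of_mem hp)
    have hqp := hP q (Finset.mem_insert_self _ _)
    have hM : 0 < ∏ p ∈ P, p := Finset.prod_pos fun p hp => (hP' p hp).pos
    have hcop : Nat.Coprime (∏ p ∈ P, p) q := Nat.Coprime.prod_left fun p hp =>
      (Nat.coprime_primes (hP' p hp) hqp).2 fun h => hq (h ▸ hp)
    rw [Finset.prod_insert hq, Finset.prod_insert hq, mul_comm q, mul_comm (Finset.card _)]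
    refine le_trans (le_trans (Finset.card_le_card ?_) (card_filter_mod_mod hcop hM hqp.pos
      (fun k => ∀ p ∈ P, B p (k % p)) (B q))) (Nat.mul_le_mul_right _ (ih hP'))
    intro k hk
    rw [Finset.mem_filter] at hk ⊢
    refine ⟨hk.1, fun p hp => ?_, hk.2 q (Finset.mem_insert_self _ _)⟩
    rw [Nat.mod_mod_of_dvd _ (Finset.dvd_prod_of_mem _ hp)]
    exact hk.2 p (Finset.mem_insert_of_mem hp)

theorem card_filter_range_avoid {g : ℕ} (hg : 0 < g) (B : ℕ → ℕ → Prop)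
    [∀ p, DecidablePred (B p)] :
    (((Finset.range g).filter fun k => ∀ p ∈ g.primeFactors, B p (k % p)).card : ℝ) ≤
      g * ∏ p ∈ g.primeFactors, (((Finset.range p).filter (B p)).card : ℝ) / p := by
  set M := ∏ p ∈ g.primeFactors, p with hM
  have hMg : M ∣ g := Nat.prod_primeFactors_dvd g
  have hM0 : 0 < M := Nat.pos_of_dvd_of_pos hMg hg
  have h1 : ((Finset.range g).filter fun k => ∀ p ∈ g.primeFactors, B p (k % p)).card ≤
      ((Finset.range M).filter fun k => ∀ p ∈ g.primeFactors, B p (k % p)).card * (g / M) := by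
    rw [← Finset.card_range (g / M), ← Finset.card_product]
    refine Finset.card_le_card_of_injOn (fun k => (k % M, k / M)) (fun k hk => ?_)
      fun k hk l hl h => ?_
    · rw [Finset.mem_coe, Finset.mem_filter, Finset.mem_range] at hk
      simp only [Finset.mem_coe, Finset.mem_product, Finset.mem_filter, Finset.mem_range]
      refine ⟨⟨Nat.mod_lt _ hM0, fun p hp => ?_⟩, Nat.div_lt_div_of_lt_of_dvd hMg hk.1⟩
      rw [Nat.mod_mod_of_dvd _ (Finset.dvd_prod_of_mem _ hp)]
      exact hk.2 p hp
    · have h2 : k % M = l % M := congrArg Prod.fst h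
      have h3 : k / M = l / M := congrArg Prod.snd h
      rw [← Nat.div_add_mod k M, ← Nat.div_add_mod l M, h2, h3]
  have h2 := card_filter_mod_avoid g.primeFactors (fun p hp => Nat.prime_of_mem_primeFactors hp) B
  have h3 : (((Finset.range g).filter fun k => ∀ p ∈ g.primeFactors, B p (k % p)).card : ℝ) ≤
      (∏ p ∈ g.primeFactors, ((Finset.range p).filter (B p)).card : ℕ) * ((g / M : ℕ) : ℝ) := by
    exact_mod_cast h1.trans (Nat.mul_le_mul_right _ h2)
  refine h3.trans_eq ?_
  rw [Nat.cast_div hMg (by positivity), Finset.prod_div_distrib, hM]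
  push_cast
  ring

/-- Pairs of reduced numerators `(a, b)` with `a y - b x ≡ h` modulo `g x y`. -/
def reducedPairs (g x y : ℕ) (h : ℤ) : Finset (ℕ × ℕ) :=
  (Finset.range (g * x) ×ˢ Finset.range (g * y)).filter fun e =>
    e.1.Coprime (g * x) ∧ e.2.Coprime (g * y) ∧
      ((g * x * y : ℕ) : ℤ) ∣ (e.1 : ℤ) * y - e.2 * x - h

theorem mem_reducedPairs {g x y : ℕ} {h : ℤ} {e : ℕ × ℕ} : e ∈ reducedPairs g x y h ↔
    (e.1 < g * x ∧ e.2 < g * y) ∧ e.1.Coprime (g * x) ∧ e.2.Coprime (g * y) ∧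
      ((g * x * y : ℕ) : ℤ) ∣ (e.1 : ℤ) * y - e.2 * x - h := by
  simp [reducedPairs]

theorem not_dvd_of_mem_reducedPairs {g x y : ℕ} {h : ℤ} (hxy : x.Coprime y) {e : ℕ × ℕ}
    (he : e ∈ reducedPairs g x y h) {p : ℕ} (hp : p.Prime) (hpx : p ∣ x * y) : ¬ (p : ℤ) ∣ h := by
  rw [mem_reducedPairs] at he
  obtain ⟨-, h1, h2, h3⟩ := he
  intro hph
  have hpl : (p : ℤ) ∣ (g * x * y : ℕ) := by
    rw [mul_assoc]; exact_mod_cast hpx.mul_left g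
  have h4 : (p : ℤ) ∣ (e.1 : ℤ) * y - e.2 * x := by
    have := dvd_add (hpl.trans h3) hph
    simpa using this
  rcases (hp.dvd_mul).1 hpx with hx | hy
  · have h5 : (p : ℤ) ∣ (e.1 : ℤ) * y := by
      have : (p : ℤ) ∣ (e.2 : ℤ) * x := Dvd.dvd.mul_left (by exact_mod_cast hx) _
      have := dvd_add h4 this
      simpa using this
    have h6 : p ∣ e.1 * y := by exact_mod_cast h5
    rcases (hp.dvd_mul).1 h6 with h7 | h7
    · exact Nat.Prime.not_coprime_iff_dvd.2 ⟨p, hp, h7, hx.mul_left g⟩ h1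
    · exact Nat.Prime.not_coprime_iff_dvd.2 ⟨p, hp, hx, h7⟩ hxy
  · have h5 : (p : ℤ) ∣ (e.2 : ℤ) * x := by
      have : (p : ℤ) ∣ (e.1 : ℤ) * y := Dvd.dvd.mul_left (by exact_mod_cast hy) _
      have := dvd_sub this h4
      simpa using this
    have h6 : p ∣ e.2 * x := by exact_mod_cast h5
    rcases (hp.dvd_mul).1 h6 with h7 | h7
    · exact Nat.Prime.not_coprime_iff_dvd.2 ⟨p, hp, h7, hy.mul_left g⟩ h2
    · exact Nat.Prime.not_coprime_iff_dvd.2 ⟨p, hp, h7, hy⟩ hxy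

theorem reducedPairs_eq_empty {g x y : ℕ} {h : ℤ} (hxy : x.Coprime y)
    (hh : ¬ h.natAbs.Coprime (x * y)) : reducedPairs g x y h = ∅ := by
  rw [Finset.eq_empty_iff_forall_notMem]
  intro e he
  obtain ⟨p, hp, h1, h2⟩ := Nat.Prime.not_coprime_iff_dvd.1 hh
  exact not_dvd_of_mem_reducedPairs hxy he hp h2 (Int.natCast_dvd.2 h1)

theorem reducedPairs_subset_image {g x y : ℕ} {h : ℤ} (hg : 0 < g) (hx : 0 < x) (hy : 0 < y)
    (hxy : x.Coprime y) {e : ℕ × ℕ} (he : e ∈ reducedPairs g x y h) :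
    reducedPairs g x y h ⊆ ((Finset.range g).filter fun k => ∀ p ∈ g.primeFactors,
      ¬ p ∣ e.1 + (k % p) * x ∧ ¬ p ∣ e.2 + (k % p) * y).image
        fun k => ((e.1 + k * x) % (g * x), (e.2 + k * y) % (g * y)) := by
  rw [mem_reducedPairs] at he
  obtain ⟨⟨-, -⟩, -, -, h3⟩ := he
  intro f hf
  rw [mem_reducedPairs] at hf
  obtain ⟨⟨hf1, hf2⟩, hf3, hf4, hf5⟩ := hf
  have h6 : ((g * x * y : ℕ) : ℤ) ∣ ((f.1 : ℤ) - e.1) * y - ((f.2 : ℤ) - e.2) * x := by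
    have := dvd_sub hf5 h3
    rwa [show ((f.1 : ℤ) - e.1) * y - ((f.2 : ℤ) - e.2) * x =
      (f.1 : ℤ) * y - f.2 * x - h - (e.1 * y - e.2 * x - h) by ring]
  have hxy' : IsCoprime (x : ℤ) (y : ℤ) := Nat.isCoprime_iff_coprime.2 hxy
  have h7 : (x : ℤ) ∣ (f.1 : ℤ) - e.1 := by
    refine hxy'.dvd_of_dvd_mul_right ?_
    have h8 : (x : ℤ) ∣ ((f.1 : ℤ) - e.1) * y - ((f.2 : ℤ) - e.2) * x :=
      Dvd.dvd.trans (by push_cast; exact ⟨g * y, by ring⟩) h6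
    have := dvd_add h8 (Dvd.intro_left ((f.2 : ℤ) - e.2) rfl : (x : ℤ) ∣ _)
    simpa using this
  have h8 : (y : ℤ) ∣ (f.2 : ℤ) - e.2 := by
    refine hxy'.symm.dvd_of_dvd_mul_right ?_
    have h8 : (y : ℤ) ∣ ((f.1 : ℤ) - e.1) * y - ((f.2 : ℤ) - e.2) * x :=
      Dvd.dvd.trans (by push_cast; exact ⟨g * x, by ring⟩) h6
    have := dvd_sub (Dvd.intro_left ((f.1 : ℤ) - e.1) rfl : (y : ℤ) ∣ _) h8
    simpa using this
  obtain ⟨s, hs⟩ := h7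
  obtain ⟨t, ht⟩ := h8
  have hst : (g : ℤ) ∣ s - t := by
    rw [hs, ht] at h6
    have h9 : ((x * y : ℕ) : ℤ) * g ∣ (x * y : ℕ) * (s - t) := by
      convert h6 using 1 <;> push_cast <;> ring
    exact Int.dvd_of_mul_dvd_mul_left (by exact_mod_cast (Nat.mul_pos hx hy).ne') h9
  have hg' : (0 : ℤ) < g := by exact_mod_cast hg
  set k := (s % g).toNat with hk
  have hk1 : (k : ℤ) = s % g := Int.toNat_of_nonneg (Int.emod_nonneg _ hg'.ne')
  have hk2 : (g : ℤ) ∣ s - k := by rw [hk1]; exact Int.dvd_self_sub_emod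
  have hk3 : (g : ℤ) ∣ t - k := by
    have := dvd_sub hk2 hst
    rwa [show t - (k : ℤ) = s - k - (s - t) by ring]
  have hk4 : k < g := by
    have := Int.emod_lt_of_pos s hg'
    omega
  have e1 : (e.1 + k * x) % (g * x) = f.1 := by
    have : e.1 + k * x ≡ f.1 [MOD g * x] := by
      rw [Nat.modEq_iff_dvd]
      push_cast
      have : (f.1 : ℤ) - (e.1 + k * x) = (s - k) * x := by linear_combination hs
      rw [this]
      exact mul_dvd_mul_right hk2 _
    rw [this, Nat.mod_eq_of_lt hf1]
  have e2 : (e.2 + k * y) % (g * y) = f.2 := by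
    have : e.2 + k * y ≡ f.2 [MOD g * y] := by
      rw [Nat.modEq_iff_dvd]
      push_cast
      have : (f.2 : ℤ) - (e.2 + k * y) = (t - k) * y := by linear_combination ht
      rw [this]
      exact mul_dvd_mul_right hk3 _
    rw [this, Nat.mod_eq_of_lt hf2]
  rw [Finset.mem_image]
  refine ⟨k, ?_, by rw [e1, e2]⟩
  rw [Finset.mem_filter, Finset.mem_range]
  refine ⟨hk4, fun p hp => ⟨fun hd => ?_, fun hd => ?_⟩⟩
  · have hpp := Nat.prime_of_mem_primeFactors hp
    have hpg := Nat.dvd_of_mem_primeFactors hp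
    have h1 : p ∣ e.1 + k * x := by
      have : e.1 + k % p * x ≡ e.1 + k * x [MOD p] :=
        Nat.ModEq.add_left _ (Nat.ModEq.mul_right _ (Nat.mod_modEq k p))
      exact (this.dvd_iff dvd_rfl).1 hd
    have h2 : p ∣ f.1 := by rw [← e1, Nat.dvd_mod_iff (hpg.mul_right x)]; exact h1
    exact Nat.Prime.not_coprime_iff_dvd.2 ⟨p, hpp, h2, hpg.mul_right x⟩ hf3
  · have hpp := Nat.prime_of_mem_primeFactors hp
    have hpg := Nat.dvd_of_mem_primeFactors hp
    have h1 : p ∣ e.2 + k * y := by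
      have : e.2 + k % p * y ≡ e.2 + k * y [MOD p] :=
        Nat.ModEq.add_left _ (Nat.ModEq.mul_right _ (Nat.mod_modEq k p))
      exact (this.dvd_iff dvd_rfl).1 hd
    have h2 : p ∣ f.2 := by rw [← e2, Nat.dvd_mod_iff (hpg.mul_right y)]; exact h1
    exact Nat.Prime.not_coprime_iff_dvd.2 ⟨p, hpp, h2, hpg.mul_right y⟩ hf4

theorem exists_lt_dvd_add_mul {p a x : ℕ} (hp : p.Prime) (hx : ¬ p ∣ x) :
    ∃ k < p, p ∣ a + k * x := by
  have := Fact.mk hp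
  have hx' : (x : ZMod p) ≠ 0 := fun h => hx ((ZMod.natCast_eq_zero_iff _ _).1 h)
  refine ⟨(-(a : ZMod p) / x).val, ZMod.val_lt _, ?_⟩
  rw [← ZMod.natCast_eq_zero_iff]
  push_cast
  rw [ZMod.natCast_zmod_val]
  field_simp
  ring

theorem card_avoid_le {p a b x y : ℕ} {h : ℤ} (hp : p.Prime) (hxy : x.Coprime y)
    (hh : (p : ℤ) ∣ (a : ℤ) * y - b * x - h) :
    (((Finset.range p).filter fun k => ¬ p ∣ a + k * x ∧ ¬ p ∣ b + k * y).card : ℝ) / p ≤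
      (1 - 1 / (p : ℝ)) ^ 2 / (if p ∣ x * y ∨ (p : ℤ) ∣ h then 1 - 1 / (p : ℝ) else 1) := by
  have hp2 : (2 : ℝ) ≤ p := by exact_mod_cast hp.two_le
  have hp0 : (0 : ℝ) < p := by linarith
  have hf : 0 < 1 - 1 / (p : ℝ) := by
    rw [sub_pos, div_lt_one hp0]; linarith
  have key : ∀ S : Finset ℕ, S ⊆ Finset.range p → (∀ k ∈ S, p ∣ a + k * x ∨ p ∣ b + k * y) →
      (((Finset.range p).filter fun k => ¬ p ∣ a + k * x ∧ ¬ p ∣ b + k * y).card : ℝ) ≤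
        p - S.card := by
    intro S hS hS'
    have h1 : ((Finset.range p).filter fun k => ¬ p ∣ a + k * x ∧ ¬ p ∣ b + k * y) ⊆
        Finset.range p \ S := by
      intro k hk
      rw [Finset.mem_filter] at hk
      rw [Finset.mem_sdiff]
      refine ⟨hk.1, fun hkS => ?_⟩
      rcases hS' k hkS with h | h
      · exact hk.2.1 h
      · exact hk.2.2 h
    have h2 := Finset.card_le_card h1
    have h3 := Finset.card_sdiff_add_card_eq_card hS
    rw [Finset.card_range] at h3
    have h4 : (((Finset.range p).filter fun k => ¬ p ∣ a + k * x ∧ ¬ p ∣ b + k * y).card) +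
      S.card ≤ p := by omega
    have h5 : ((((Finset.range p).filter fun k => ¬ p ∣ a + k * x ∧ ¬ p ∣ b + k * y).card : ℕ) : ℝ)
      + S.card ≤ p := by exact_mod_cast h4
    linarith
  split_ifs with hc
  · rw [pow_two, mul_div_assoc, div_self hf.ne', mul_one]
    obtain ⟨k, hkp, hk⟩ : ∃ k < p, p ∣ a + k * x ∨ p ∣ b + k * y := by
      by_cases hx : p ∣ x
      · have hy : ¬ p ∣ y := fun hy => Nat.Prime.not_coprime_iff_dvd.2 ⟨p, hp, hx, hy⟩ hxy
        obtain ⟨k, h1, h2⟩ := exists_lt_dvd_add_mul (a := b) hp hy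
        exact ⟨k, h1, Or.inr h2⟩
      · obtain ⟨k, h1, h2⟩ := exists_lt_dvd_add_mul (a := a) hp hx
        exact ⟨k, h1, Or.inl h2⟩
    have := key {k} (by simpa using hkp) (by simpa using hk)
    rw [div_le_iff₀ hp0, sub_mul, one_div, inv_mul_cancel₀ hp0.ne']
    simpa using this
  · push Not at hc
    rw [div_one]
    have hx : ¬ p ∣ x := fun h => hc.1 (h.mul_right y)
    have hy : ¬ p ∣ y := fun h => hc.1 (h.mul_left x)
    obtain ⟨k, h1, h2⟩ := exists_lt_dvd_add_mul (a := a) hp hx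
    obtain ⟨l, h3, h4⟩ := exists_lt_dvd_add_mul (a := b) hp hy
    have hkl : k ≠ l := by
      rintro rfl
      apply hc.2
      have h5 : (p : ℤ) ∣ (a + k * x) * y := Dvd.dvd.mul_right (by exact_mod_cast h2) _
      have h6 : (p : ℤ) ∣ (b + k * y) * x := Dvd.dvd.mul_right (by exact_mod_cast h4) _
      have := dvd_sub (dvd_sub h5 h6) hh
      rwa [show h = (a + k * x) * y - (b + k * y) * x - ((a : ℤ) * y - b * x - h) by ring]
    have := key {k, l} (by
      intro j hj
      simp only [Finset.mem_insert, Finset.mem_singleton] at hj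
      rcases hj with rfl | rfl <;> simpa) (by
      intro j hj
      simp only [Finset.mem_insert, Finset.mem_singleton] at hj
      rcases hj with rfl | rfl
      · exact Or.inl h2
      · exact Or.inr h4)
    rw [Finset.card_pair hkl] at this
    push_cast at this
    rw [div_le_iff₀ hp0]
    have h7 : (1 - 1 / (p : ℝ)) ^ 2 * p = p - 2 + 1 / p := by field_simp; ring
    rw [h7]
    have : 0 < 1 / (p : ℝ) := by positivity
    linarith

theorem prod_eq_prod_ite_of_subset {S U : Finset ℕ} (h : S ⊆ U) (f : ℕ → ℝ) :
    ∏ p ∈ S, f p = ∏ p ∈ U, if p ∈ S then f p else 1 := by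
  rw [← Finset.prod_filter, Finset.filter_mem_eq_inter, Finset.inter_eq_right.2 h]

theorem card_reducedPairs_le {g x y : ℕ} {h : ℤ} (hg : 0 < g) (hx : 0 < x) (hy : 0 < y)
    (hxy : x.Coprime y) (hh : h ≠ 0) :
    ((reducedPairs g x y h).card : ℝ) ≤
      g * ((g * x).totient / (g * x : ℕ)) * ((g * y).totient / (g * y : ℕ)) *
        ((x * y : ℕ) / (x * y).totient) * (h.natAbs / h.natAbs.totient) := by
  obtain he | ⟨e, he⟩ := (reducedPairs g x y h).eq_empty_or_nonempty
  · rw [he]; simp; positivity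
  have h1 := Finset.card_le_card (reducedPairs_subset_image hg hx hy hxy he)
  have h2 : (reducedPairs g x y h).card ≤ ((Finset.range g).filter fun k => ∀ p ∈ g.primeFactors,
      ¬ p ∣ e.1 + (k % p) * x ∧ ¬ p ∣ e.2 + (k % p) * y).card :=
    h1.trans Finset.card_image_le
  have h3 := card_filter_range_avoid hg
    (fun p k => ¬ p ∣ e.1 + k * x ∧ ¬ p ∣ e.2 + k * y)
  have h4 : ((reducedPairs g x y h).card : ℝ) ≤ g * ∏ p ∈ g.primeFactors,
      (((Finset.range p).filter fun k => ¬ p ∣ e.1 + k * x ∧ ¬ p ∣ e.2 + k * y).card : ℝ) / p :=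
    le_trans (by exact_mod_cast h2) h3
  have hl : ((g * x * y : ℕ) : ℤ) ∣ (e.1 : ℤ) * y - e.2 * x - h := (mem_reducedPairs.1 he).2.2.2
  have h5 : ∏ p ∈ g.primeFactors,
      (((Finset.range p).filter fun k => ¬ p ∣ e.1 + k * x ∧ ¬ p ∣ e.2 + k * y).card : ℝ) / p ≤
      ∏ p ∈ g.primeFactors, ((1 - 1 / (p : ℝ)) ^ 2 /
        (if p ∣ x * y ∨ (p : ℤ) ∣ h then 1 - 1 / (p : ℝ) else 1)) := by
    refine Finset.prod_le_prod (fun p _ => by positivity) fun p hp => ?_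
    refine card_avoid_le (Nat.prime_of_mem_primeFactors hp) hxy (Dvd.dvd.trans ?_ hl)
    rw [mul_assoc]
    exact_mod_cast (Nat.dvd_of_mem_primeFactors hp).mul_right _
  set n := h.natAbs with hn
  have hn0 : n ≠ 0 := Int.natAbs_ne_zero.2 hh
  have hx0 := hx.ne'
  have hy0 := hy.ne'
  have hg0 := hg.ne'
  have h6 : ∏ p ∈ g.primeFactors, ((1 - 1 / (p : ℝ)) ^ 2 /
        (if p ∣ x * y ∨ (p : ℤ) ∣ h then 1 - 1 / (p : ℝ) else 1)) ≤
      ((g * x).totient / (g * x : ℕ)) * ((g * y).totient / (g * y : ℕ)) *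
        ((((x * y).totient : ℝ) / (x * y : ℕ))⁻¹) * ((n.totient : ℝ) / n)⁻¹ := by
    rw [totient_div_eq_prod (by positivity), totient_div_eq_prod (by positivity),
      totient_div_eq_prod (by positivity), totient_div_eq_prod hn0]
    set U := (g * x * y * n).primeFactors with hU
    have hU0 : g * x * y * n ≠ 0 := by positivity
    have hUp : ∀ p ∈ U, p.Prime := fun p hp => Nat.prime_of_mem_primeFactors hp
    rw [prod_eq_prod_ite_of_subset (Nat.primeFactors_mono (⟨x * y * n, by ring⟩ : g ∣ _) hU0),
      prod_eq_prod_ite_of_subset (Nat.primeFactors_mono (⟨y * n, by ring⟩ : g * x ∣ _) hU0),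
      prod_eq_prod_ite_of_subset (Nat.primeFactors_mono (⟨x * n, by ring⟩ : g * y ∣ _) hU0),
      prod_eq_prod_ite_of_subset (Nat.primeFactors_mono (⟨g * n, by ring⟩ : x * y ∣ _) hU0),
      prod_eq_prod_ite_of_subset (Nat.primeFactors_mono (⟨g * x * y, by ring⟩ : n ∣ _) hU0),
      ← Finset.prod_inv_distrib, ← Finset.prod_inv_distrib, ← Finset.prod_mul_distrib,
      ← Finset.prod_mul_distrib, ← Finset.prod_mul_distrib]
    have hf : ∀ p ∈ U, 0 < 1 - 1 / (p : ℝ) := fun p hp => by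
      have : (2 : ℝ) ≤ p := by exact_mod_cast (hUp p hp).two_le
      rw [sub_pos, div_lt_one] <;> linarith
    refine Finset.prod_le_prod (fun p hp => ?_) fun p hp => ?_
    · have := hf p hp
      split_ifs <;> positivity
    · have h0 := hf p hp
      have h1 := one_sub_one_div_le_one p
      have hp' := hUp p hp
      have hinv : 1 ≤ (1 - 1 / (p : ℝ))⁻¹ := (one_le_inv₀ h0).2 h1
      generalize 1 - 1 / (p : ℝ) = f at *
      have hnot : ¬ (p ∣ x ∧ p ∣ y) := fun hd =>
        Nat.Prime.not_coprime_iff_dvd.2 ⟨p, hp', hd.1, hd.2⟩ hxy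
      have e1 : (p : ℤ) ∣ h ↔ p ∣ n := Int.natCast_dvd
      simp only [Nat.mem_primeFactors, hp', hp'.dvd_mul, e1, true_and, ne_eq, mul_eq_zero, hg0,
        hx0, hy0, hn0, or_self, not_false_eq_true, and_true]
      have hff : f * f⁻¹ = 1 := mul_inv_cancel₀ h0.ne'
      by_cases a1 : p ∣ g <;> by_cases a2 : p ∣ x <;> by_cases a3 : p ∣ y <;>
        by_cases a4 : p ∣ n <;> simp only [a1, a2, a3, a4, or_true, true_or, or_self, if_true,
          if_false, and_self, not_true, mul_one, one_mul, inv_one, div_eq_mul_inv, pow_two,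
          mul_assoc, hff] at hnot ⊢ <;>
        first
        | exact le_rfl
        | exact hinv
        | exact h0.le.trans (h1.trans hinv)
        | nlinarith [mul_pos h0 h0]
  calc _ ≤ _ := h4
    _ ≤ g * (((g * x).totient / (g * x : ℕ)) * ((g * y).totient / (g * y : ℕ)) *
        ((((x * y).totient : ℝ) / (x * y : ℕ))⁻¹) * ((n.totient : ℝ) / n)⁻¹) := by
      gcongr
      exact h5.trans h6
    _ = _ := by rw [inv_div, inv_div]; ring

theorem prod_one_add_rpow_le (n : ℕ) (hn : n ≠ 0) :
    ∏ p ∈ n.primeFactors, (1 + (p : ℝ) ^ (-(1/2) : ℝ)) ≤ ∑ d ∈ n.divisors, (d : ℝ) ^ (-(1/2) : ℝ) := by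
  simp_rw [add_comm (1 : ℝ)]
  rw [Finset.prod_add_one]
  have : ∀ t ∈ n.primeFactors.powerset, ∏ p ∈ t, (p : ℝ) ^ (-(1/2) : ℝ) =
      ((∏ p ∈ t, p : ℕ) : ℝ) ^ (-(1/2) : ℝ) := fun t _ => by
    rw [Nat.cast_prod, Real.finsetProd_rpow _ _ fun i _ => Nat.cast_nonneg i]
  rw [Finset.sum_congr rfl this]
  have hp : ∀ t ∈ n.primeFactors.powerset, ∀ p ∈ t, p.Prime := fun t ht p hp =>
    Nat.prime_of_mem_primeFactors (Finset.mem_powerset.1 ht hp)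
  have hinj : Set.InjOn (fun t : Finset ℕ => ∏ p ∈ t, p) (n.primeFactors.powerset : Set (Finset ℕ)) := by
    intro s hs t ht h
    have h' := congrArg Nat.primeFactors h
    simp only at h'
    rwa [Nat.primeFactors_prod (hp s hs), Nat.primeFactors_prod (hp t ht)] at h'
  rw [← Finset.sum_image (f := fun d : ℕ => (d : ℝ) ^ (-(1/2) : ℝ)) hinj]
  refine Finset.sum_le_sum_of_subset_of_nonneg (fun d hd => ?_) fun d _ _ => by positivity
  obtain ⟨t, ht, rfl⟩ := Finset.mem_image.1 hd
  rw [Nat.mem_divisors]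
  exact ⟨(Finset.prod_dvd_prod_of_subset _ _ _ (Finset.mem_powerset.1 ht)).trans
    (Nat.prod_primeFactors_dvd n), hn⟩

theorem inv_one_sub_le {p : ℕ} (hp : p.Prime) :
    (1 - 1 / (p : ℝ))⁻¹ ≤ (if p = 2 then 2 else 1) * (1 + (p : ℝ) ^ (-(1/2) : ℝ)) := by
  split_ifs with h
  · subst h
    have : (0:ℝ) ≤ ((2:ℕ):ℝ) ^ (-(1/2) : ℝ) := by positivity
    norm_num at this ⊢
    linarith
  · have h3 : (3 : ℝ) ≤ p := by
      have := hp.two_le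
      exact_mod_cast (by omega : 3 ≤ p)
    have hp0 : (0 : ℝ) < p := by linarith
    rw [one_mul, Real.rpow_neg hp0.le, ← Real.sqrt_eq_rpow]
    have hs := Real.sq_sqrt hp0.le
    have hs0 := Real.sqrt_pos.2 hp0
    have hs1 : 1.7 ≤ √(p : ℝ) := Real.le_sqrt_of_sq_le (by norm_num; linarith)
    generalize √(p : ℝ) = s at *
    rw [← hs]
    have h1 : (0:ℝ) < 1 - 1 / s ^ 2 := by
      rw [sub_pos, div_lt_one (by positivity)]; nlinarith
    rw [inv_le_iff_one_le_mul₀ h1]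
    have : (1 + s⁻¹) * (1 - 1 / s ^ 2) = 1 + (s ^ 2 - s - 1) / s ^ 3 := by
      field_simp; ring
    rw [this]
    have : 0 ≤ (s ^ 2 - s - 1) / s ^ 3 := div_nonneg (by nlinarith) (by positivity)
    linarith

theorem div_totient_le {n : ℕ} (hn : n ≠ 0) :
    (n : ℝ) / n.totient ≤ 2 * ∑ d ∈ n.divisors, (d : ℝ) ^ (-(1/2) : ℝ) := by
  rw [← inv_div, totient_div_eq_prod hn, ← Finset.prod_inv_distrib]
  calc ∏ p ∈ n.primeFactors, (1 - 1 / (p : ℝ))⁻¹ ≤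
      ∏ p ∈ n.primeFactors, (if p = 2 then 2 else 1) * (1 + (p : ℝ) ^ (-(1/2) : ℝ)) :=
        Finset.prod_le_prod (fun p hp => inv_nonneg.2
          (one_sub_one_div_nonneg (Nat.prime_of_mem_primeFactors hp)))
          fun p hp => inv_one_sub_le (Nat.prime_of_mem_primeFactors hp)
    _ = (∏ p ∈ n.primeFactors, if p = 2 then (2:ℝ) else 1) *
        ∏ p ∈ n.primeFactors, (1 + (p : ℝ) ^ (-(1/2) : ℝ)) := Finset.prod_mul_distrib
    _ ≤ 2 * ∑ d ∈ n.divisors, (d : ℝ) ^ (-(1/2) : ℝ) := by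
      refine mul_le_mul ?_ (prod_one_add_rpow_le n hn)
        (Finset.prod_nonneg fun p _ => by positivity) (by norm_num)
      rw [Finset.prod_ite_eq']
      split_ifs <;> norm_num

theorem card_coprime_Icc_le {M : ℕ} (hM : 0 < M) (n : ℕ) :
    (((Finset.Icc 1 n).filter fun k => k.Coprime M).card : ℝ) ≤
      (M.totient : ℝ) / M * n + M.totient := by
  have h := Nat.Ico_filter_coprime_le 1 n hM.ne'
  have h1 : ((Finset.Icc 1 n).filter fun k => k.Coprime M) =
      (Finset.Ico 1 (1 + n)).filter fun k => M.Coprime k := by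
    ext k
    simp only [Finset.mem_filter, Finset.mem_Icc, Finset.mem_Ico, Nat.coprime_comm]
    omega
  rw [h1]
  calc _ ≤ ((M.totient * (n / M + 1) : ℕ) : ℝ) := by exact_mod_cast h
    _ = M.totient * ((n / M : ℕ) : ℝ) + M.totient := by push_cast; ring
    _ ≤ M.totient * ((n : ℝ) / M) + M.totient := by
      gcongr
      exact Nat.cast_div_le
    _ = _ := by ring

theorem sum_rpow_neg_half_le (N : ℕ) :
    ∑ d ∈ Finset.Icc 1 N, (d : ℝ) ^ (-(1/2) : ℝ) ≤ 2 * √N := by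
  induction N with
  | zero => simp
  | succ n ih =>
    rw [Finset.sum_Icc_succ_top (by omega)]
    refine (add_le_add_left ih _).trans ?_
    have h0 : (0:ℝ) ≤ n := by positivity
    push_cast
    rw [Real.rpow_neg (by positivity), ← Real.sqrt_eq_rpow]
    have h1 := Real.sq_sqrt h0
    have h2 := Real.sq_sqrt (by positivity : (0:ℝ) ≤ n + 1)
    have h3 : 0 < √((n:ℝ) + 1) := Real.sqrt_pos.2 (by positivity)
    have h4 : (√((n:ℝ) + 1))⁻¹ * √((n:ℝ) + 1) = 1 := inv_mul_cancel₀ h3.ne'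
    have h5 := Real.sqrt_nonneg (n : ℝ)
    generalize √((n:ℝ) + 1) = s at *
    generalize √(n:ℝ) = t at *
    have h6 : s⁻¹ * s ≤ (2 * (s - t)) * s := by nlinarith [sq_nonneg (s - t)]
    have := le_of_mul_le_mul_right h6 h3
    linarith

theorem exists_sum_div_totient_constant : ∃ C : ℝ, 0 ≤ C ∧ ∀ {N m M : ℕ}, M ∣ m → 0 < M →
    M ^ 2 ≤ N → ∑ n ∈ (Finset.Icc 1 N).filter (fun n => n.Coprime m), (n : ℝ) / n.totient ≤
      C * N * ((M.totient : ℝ) / M) := by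
  set S := ∑' d : ℕ, (d : ℝ) ^ (-(3/2) : ℝ) with hS
  have hsum : Summable fun d : ℕ => (d : ℝ) ^ (-(3/2) : ℝ) :=
    Real.summable_nat_rpow.2 (by norm_num)
  have hS0 : 0 ≤ S := tsum_nonneg fun d => by positivity
  refine ⟨2 * (S + 2), by positivity, fun {N m M} hMm hM hN => ?_⟩
  calc _ ≤ ∑ n ∈ (Finset.Icc 1 N).filter (fun n => n.Coprime m),
        2 * ∑ d ∈ n.divisors, (d : ℝ) ^ (-(1/2) : ℝ) := by
        refine Finset.sum_le_sum fun n hn => div_totient_le ?_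
        rw [Finset.mem_filter, Finset.mem_Icc] at hn
        omega
    _ = 2 * ∑ n ∈ (Finset.Icc 1 N).filter (fun n => n.Coprime m),
        ∑ d ∈ n.divisors, (d : ℝ) ^ (-(1/2) : ℝ) := by rw [Finset.mul_sum]
    _ = 2 * ∑ d ∈ Finset.Icc 1 N, ∑ n ∈ (Finset.Icc 1 N).filter (fun n => n.Coprime m ∧ d ∣ n),
        (d : ℝ) ^ (-(1/2) : ℝ) := by
      congr 1
      refine Finset.sum_comm' fun n d => ?_
      simp only [Finset.mem_filter, Finset.mem_Icc, Nat.mem_divisors]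
      constructor
      · rintro ⟨⟨⟨h1, h2⟩, h3⟩, h4, h5⟩
        have := Nat.le_of_dvd (by omega) h4
        exact ⟨⟨⟨h1, h2⟩, h3, h4⟩, Nat.pos_of_dvd_of_pos h4 (by omega), by omega⟩
      · rintro ⟨⟨⟨h1, h2⟩, h3, h4⟩, h5⟩
        exact ⟨⟨⟨h1, h2⟩, h3⟩, h4, by omega⟩
    _ ≤ 2 * ∑ d ∈ Finset.Icc 1 N, (((M.totient : ℝ) / M) * N * (d : ℝ) ^ (-(3/2) : ℝ) +
        M.totient * (d : ℝ) ^ (-(1/2) : ℝ)) := by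
      gcongr with d hd
      rw [Finset.mem_Icc] at hd
      have hd0 : (0 : ℝ) < d := by exact_mod_cast hd.1
      rw [Finset.sum_const, nsmul_eq_mul]
      have hcard : ((Finset.Icc 1 N).filter (fun n => n.Coprime m ∧ d ∣ n)).card ≤
          ((Finset.Icc 1 (N / d)).filter fun k => k.Coprime M).card := by
        refine Finset.card_le_card_of_injOn (fun n => n / d) (fun n hn => ?_)
          fun n hn l hl h => ?_
        · simp only [Finset.coe_filter, Set.mem_ofPred_eq, Finset.mem_Icc] at hn ⊢
          obtain ⟨⟨h1, h2⟩, h3, k, rfl⟩ := hn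
          have hdp : 0 < d := hd.1
          rw [Nat.mul_div_cancel_left _ hdp]
          refine ⟨⟨Nat.pos_of_ne_zero ?_, (Nat.le_div_iff_mul_le hdp).2 (by linarith)⟩, ?_⟩
          · rintro rfl; simp at h1
          · exact Nat.Coprime.coprime_dvd_right hMm (Nat.Coprime.coprime_mul_left h3)
        · simp only [Finset.coe_filter, Set.mem_ofPred_eq, Finset.mem_Icc] at hn hl
          exact (Nat.div_left_inj hn.2.2 hl.2.2).1 h
      have h1 := card_coprime_Icc_le hM (N / d)
      have h2 : (((Finset.Icc 1 N).filter (fun n => n.Coprime m ∧ d ∣ n)).card : ℝ) ≤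
          (M.totient : ℝ) / M * (N / d) + M.totient := by
        refine le_trans (by exact_mod_cast hcard) (h1.trans ?_)
        gcongr
        exact Nat.cast_div_le
      have h3 : (d : ℝ) ^ (-(3/2) : ℝ) = (d : ℝ) ^ (-(1/2) : ℝ) / d := by
        rw [show (-(3/2) : ℝ) = -(1/2) - 1 by norm_num, Real.rpow_sub_one hd0.ne']
      rw [h3]
      calc _ ≤ ((M.totient : ℝ) / M * (N / d) + M.totient) * (d : ℝ) ^ (-(1/2) : ℝ) := by gcongr
        _ = _ := by ring
    _ ≤ 2 * (((M.totient : ℝ) / M) * N * S + M.totient * (2 * √N)) := by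
      rw [Finset.sum_add_distrib, ← Finset.mul_sum, ← Finset.mul_sum]
      gcongr
      · exact hsum.sum_le_tsum _ fun d _ => by positivity
      · exact sum_rpow_neg_half_le N
    _ ≤ 2 * (((M.totient : ℝ) / M) * N * S + ((M.totient : ℝ) / M) * (2 * N)) := by
      have hM0 : (0 : ℝ) < M := by exact_mod_cast hM
      have h1 : (M : ℝ) * √N ≤ N := by
        have h2 : (M : ℝ) ≤ √N := Real.le_sqrt_of_sq_le (by exact_mod_cast hN)
        have h3 := Real.mul_self_sqrt (by positivity : (0:ℝ) ≤ N)
        nlinarith [Real.sqrt_nonneg (N:ℝ)]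
      have h4 : (M.totient : ℝ) * (2 * √N) ≤ ((M.totient : ℝ) / M) * (2 * N) := by
        calc (M.totient : ℝ) * (2 * √N) = ((M.totient : ℝ) / M) * (2 * (M * √N)) := by
              field_simp
          _ ≤ _ := by gcongr
      linarith
    _ = _ := by ring

/-- The product of `(1 - 1/p)⁻¹` over the prime factors of `m` exceeding `s`. -/
noncomputable def tailFactor (m s : ℕ) : ℝ :=
  ∏ p ∈ m.primeFactors with s < p, (1 - 1 / (p : ℝ))⁻¹

theorem one_sub_one_div_pos {p : ℕ} (hp : p.Prime) : 0 < 1 - 1 / (p : ℝ) := by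
  have : (1 : ℝ) < p := by exact_mod_cast hp.one_lt
  rw [sub_pos, div_lt_one] <;> linarith

theorem tailFactor_nonneg (m s : ℕ) : 0 ≤ tailFactor m s :=
  Finset.prod_nonneg fun p hp => inv_nonneg.2 (one_sub_one_div_nonneg
    (Nat.prime_of_mem_primeFactors (Finset.mem_of_mem_filter p hp)))

theorem exists_sum_coprime_mul_le : ∃ C : ℝ, 0 ≤ C ∧ ∀ {N m : ℕ}, 0 < N → 0 < m →
    (m : ℝ) / m.totient * ∑ n ∈ (Finset.Icc 1 N).filter (fun n => n.Coprime m),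
      (n : ℝ) / n.totient ≤ C * N * tailFactor m (Nat.log 16 N) := by
  obtain ⟨C, hC0, hC⟩ := exists_sum_div_totient_constant
  refine ⟨C, hC0, fun {N m} hN hm => ?_⟩
  set z := Nat.log 16 N with hz
  set M := ∏ p ∈ m.primeFactors with ¬ z < p, p with hM
  have hPp : ∀ p ∈ m.primeFactors.filter (fun p => ¬ z < p), p.Prime := fun p hp =>
    Nat.prime_of_mem_primeFactors (Finset.mem_of_mem_filter p hp)
  have hMm : M ∣ m := (Finset.prod_dvd_prod_of_subset _ _ _ (Finset.filter_subset _ _)).trans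
    (Nat.prod_primeFactors_dvd m)
  have hM0 : 0 < M := Nat.pos_of_dvd_of_pos hMm hm
  have hM4 : M ≤ 4 ^ z := by
    refine le_trans (Nat.le_of_dvd (primorial_pos z) (Finset.prod_dvd_prod_of_subset _ _ _ ?_))
      (primorial_le_four_pow z)
    intro p hp
    have := hPp p hp
    rw [Finset.mem_filter] at hp ⊢
    rw [Finset.mem_range]
    exact ⟨by omega, this⟩
  have hMN : M ^ 2 ≤ N := by
    calc M ^ 2 ≤ (4 ^ z) ^ 2 := by gcongr
      _ = 16 ^ z := by rw [← pow_mul, mul_comm, pow_mul]; norm_num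
      _ ≤ N := Nat.pow_log_le_self 16 hN.ne'
  have h1 := hC hMm hM0 hMN
  have h2 : (m : ℝ) / m.totient * ((M.totient : ℝ) / M) = tailFactor m z := by
    rw [← inv_div, totient_div_eq_prod hm.ne', totient_div_eq_prod hM0.ne', hM,
      Nat.primeFactors_prod hPp, tailFactor, ← Finset.prod_filter_mul_prod_filter_not
        m.primeFactors (fun p => z < p), mul_inv, mul_assoc, inv_mul_cancel₀, mul_one,
        Finset.prod_inv_distrib]
    exact (Finset.prod_pos fun p hp => one_sub_one_div_pos (hPp p hp)).ne'
  calc _ ≤ (m : ℝ) / m.totient * (C * N * ((M.totient : ℝ) / M)) := by gcongr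
    _ = C * N * ((m : ℝ) / m.totient * ((M.totient : ℝ) / M)) := by ring
    _ = _ := by rw [h2]

theorem exists_sum_card_reducedPairs_le : ∃ C : ℝ, 0 ≤ C ∧ ∀ {g x y N : ℕ}, 0 < g → 0 < x →
    0 < y → x.Coprime y → 0 < N →
    ∑ h ∈ (Finset.Icc (-(N : ℤ)) N).filter (fun h => h ≠ 0), ((reducedPairs g x y h).card : ℝ) ≤
      C * N * g * ((g * x).totient / (g * x : ℕ)) * ((g * y).totient / (g * y : ℕ)) *
        tailFactor (x * y) (Nat.log 16 N) := by
  obtain ⟨C, hC0, hC⟩ := exists_sum_coprime_mul_le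
  refine ⟨2 * C, by positivity, fun {g x y N} hg hx hy hxy hN => ?_⟩
  have h1 := hC (m := x * y) hN (Nat.mul_pos hx hy)
  set D : ℝ := g * ((g * x).totient / (g * x : ℕ)) * ((g * y).totient / (g * y : ℕ)) *
        ((x * y : ℕ) / (x * y).totient) with hD
  have hD0 : 0 ≤ D := by positivity
  set F : ℕ → ℝ := fun n => if n.Coprime (x * y) then D * (n / n.totient) else 0 with hF
  have hF0 : ∀ n, 0 ≤ F n := fun n => by simp only [hF]; split_ifs <;> positivity
  have h2 : ∀ h ∈ (Finset.Icc (-(N : ℤ)) N).filter (fun h => h ≠ 0),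
      ((reducedPairs g x y h).card : ℝ) ≤ F h.natAbs := by
    intro h hh
    rw [Finset.mem_filter] at hh
    simp only [hF]
    split_ifs with hc
    · exact card_reducedPairs_le hg hx hy hxy hh.2
    · rw [reducedPairs_eq_empty hxy hc]; simp
  have h3 : (Finset.Icc (-(N : ℤ)) N).filter (fun h => h ≠ 0) ⊆
      (Finset.Icc 1 N).image (fun n : ℕ => (n : ℤ)) ∪
      (Finset.Icc 1 N).image (fun n : ℕ => -(n : ℤ)) := by
    intro h hh
    rw [Finset.mem_filter, Finset.mem_Icc] at hh
    simp only [Finset.mem_union, Finset.mem_image, Finset.mem_Icc]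
    rcases lt_or_ge h 0 with h0 | h0
    · exact Or.inr ⟨h.natAbs, by omega, by omega⟩
    · exact Or.inl ⟨h.natAbs, by omega, by omega⟩
  have h4 : ∑ n ∈ Finset.Icc 1 N, F n ≤ C * N * g * ((g * x).totient / (g * x : ℕ)) *
      ((g * y).totient / (g * y : ℕ)) * tailFactor (x * y) (Nat.log 16 N) := by
    simp only [hF]
    rw [← Finset.sum_filter, ← Finset.mul_sum, hD]
    calc _ = g * ((g * x).totient / (g * x : ℕ)) * ((g * y).totient / (g * y : ℕ)) *
          ((x * y : ℕ) / (x * y).totient * ∑ n ∈ (Finset.Icc 1 N).filter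
            (fun n => n.Coprime (x * y)), (n : ℝ) / n.totient) := by ring
      _ ≤ g * ((g * x).totient / (g * x : ℕ)) * ((g * y).totient / (g * y : ℕ)) *
          (C * N * tailFactor (x * y) (Nat.log 16 N)) := by gcongr
      _ = _ := by ring
  calc _ ≤ ∑ h ∈ (Finset.Icc (-(N : ℤ)) N).filter (fun h => h ≠ 0), F h.natAbs :=
        Finset.sum_le_sum h2
    _ ≤ ∑ h ∈ (Finset.Icc 1 N).image (fun n : ℕ => (n : ℤ)) ∪
      (Finset.Icc 1 N).image (fun n : ℕ => -(n : ℤ)), F h.natAbs :=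
        Finset.sum_le_sum_of_subset_of_nonneg h3 fun _ _ _ => hF0 _
    _ ≤ ∑ h ∈ (Finset.Icc 1 N).image (fun n : ℕ => (n : ℤ)), F h.natAbs +
        ∑ h ∈ (Finset.Icc 1 N).image (fun n : ℕ => -(n : ℤ)), F h.natAbs := by
        rw [← Finset.sum_union_inter]
        exact le_add_of_nonneg_right (Finset.sum_nonneg fun _ _ => hF0 _)
    _ = 2 * ∑ n ∈ Finset.Icc 1 N, F n := by
        rw [Finset.sum_image (fun a _ b _ h => by simpa using h),
          Finset.sum_image (fun a _ b _ h => by simpa using h)]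
        simp only [Int.natAbs_natCast, Int.natAbs_neg]
        ring
    _ ≤ _ := by linarith

/-- Reduced numerators of fractions with denominator `q`. -/
def numerators (q : ℕ) : Finset ℕ := (Finset.range q).filter fun a => a.Coprime q

theorem card_numerators (q : ℕ) : (numerators q).card = q.totient := by
  rw [numerators, Nat.totient_eq_card_coprime]
  simp only [Nat.coprime_comm]

/-- The open ball of radius `d` about the fraction `a / q` on the unit circle. -/
def fractionBall (q : ℕ) (d : ℝ) (a : ℕ) : Set UnitAddCircle :=
  Metric.ball (((a : ℝ) / q : ℝ) : UnitAddCircle) d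

theorem measureReal_fractionBall_le (q : ℕ) {d : ℝ} (hd : 0 ≤ d) (a : ℕ) :
    volume.real (fractionBall q d a) ≤ 2 * d := by
  have h1 : volume (fractionBall q d a) ≤ ENNReal.ofReal (2 * d) := by
    refine (measure_mono Metric.ball_subset_closedBall).trans ?_
    rw [AddCircle.volume_closedBall]
    exact ENNReal.ofReal_le_ofReal (min_le_right _ _)
  exact ENNReal.toReal_le_of_le_ofReal (by positivity) h1

theorem exists_abs_lt_of_fractionBall_inter {q r a b : ℕ} {d e : ℝ}
    (h : (fractionBall q d a ∩ fractionBall r e b).Nonempty) :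
    ∃ k : ℤ, |(a : ℝ) / q - b / r - k| < d + e := by
  obtain ⟨z, h1, h2⟩ := h
  have h3 : dist (((a : ℝ) / q : ℝ) : UnitAddCircle) (((b : ℝ) / r : ℝ) : UnitAddCircle) < d + e := by
    refine (dist_triangle_left _ _ z).trans_lt (add_lt_add h1 h2)
  rw [dist_eq_norm, ← AddCircle.coe_sub, UnitAddCircle.norm_eq] at h3
  exact ⟨_, h3⟩

theorem sum_measureReal_inter_le {g x y : ℕ} (hg : 0 < g) (hx : 0 < x) (hy : 0 < y)
    (hxy : x.Coprime y) (hne : x ≠ y) {d e : ℝ} (hd : 0 ≤ d) (he : 0 ≤ e) :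
    ∑ a ∈ numerators (g * x), ∑ b ∈ numerators (g * y),
      volume.real (fractionBall (g * x) d a ∩ fractionBall (g * y) e b) ≤
    2 * min d e * ∑ h ∈ (Finset.Icc (-(⌊2 * max d e * (g * x * y : ℕ)⌋₊ : ℤ))
        ⌊2 * max d e * (g * x * y : ℕ)⌋₊).filter (fun h => h ≠ 0),
        ((reducedPairs g x y h).card : ℝ) := by
  classical
  set N := ⌊2 * max d e * (g * x * y : ℕ)⌋₊ with hN
  set H := (Finset.Icc (-(N : ℤ)) N).filter (fun h => h ≠ 0) with hH
  set E := (numerators (g * x) ×ˢ numerators (g * y)).filter fun f =>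
    (fractionBall (g * x) d f.1 ∩ fractionBall (g * y) e f.2).Nonempty with hE
  have hcount : E.card ≤ ∑ h ∈ H, (reducedPairs g x y h).card := by
    refine le_trans (Finset.card_le_card (t := H.biUnion fun h => reducedPairs g x y h) ?_)
      Finset.card_biUnion_le
    intro f hf
    rw [hE, Finset.mem_filter, Finset.mem_product, numerators, numerators, Finset.mem_filter,
      Finset.mem_filter, Finset.mem_range, Finset.mem_range] at hf
    obtain ⟨⟨⟨ha, hac⟩, hb, hbc⟩, hne'⟩ := hf
    obtain ⟨k, hk⟩ := exists_abs_lt_of_fractionBall_inter hne'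
    set h : ℤ := f.1 * y - f.2 * x - k * (g * x * y) with hh
    have hg' : (0 : ℝ) < g := by exact_mod_cast hg
    have hx' : (0 : ℝ) < x := by exact_mod_cast hx
    have hy' : (0 : ℝ) < y := by exact_mod_cast hy
    have h1 : (h : ℝ) = ((f.1 : ℝ) / (g * x : ℕ) - f.2 / (g * y : ℕ) - k) * (g * x * y : ℕ) := by
      rw [hh]; push_cast; field_simp
    have h2 : |(h : ℝ)| < 2 * max d e * (g * x * y : ℕ) := by
      rw [h1, abs_mul, Nat.abs_cast]
      have h3 : d + e ≤ 2 * max d e := by linarith [le_max_left d e, le_max_right d e]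
      have h4 : (0 : ℝ) < (g * x * y : ℕ) := by push_cast; positivity
      nlinarith
    have h3 : h.natAbs ≤ N := by
      refine Nat.le_floor ?_
      rw [Nat.cast_natAbs, Int.cast_abs]
      exact h2.le
    rw [Finset.mem_biUnion]
    refine ⟨h, ?_, ?_⟩
    · rw [hH, Finset.mem_filter, Finset.mem_Icc]
      refine ⟨by omega, fun h0 => hne ?_⟩
      have h5 : (f.1 : ℤ) * y = x * (f.2 + k * g * y) := by linear_combination h0
      have h6 : (f.2 : ℤ) * x = y * (f.1 - k * g * x) := by linear_combination -h0
      have h7 : x ∣ f.1 * y := by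
        have : (x : ℤ) ∣ (f.1 : ℤ) * y := ⟨_, h5⟩
        exact_mod_cast this
      have h8 : y ∣ f.2 * x := by
        have : (y : ℤ) ∣ (f.2 : ℤ) * x := ⟨_, h6⟩
        exact_mod_cast this
      have h9 : x = 1 := Nat.eq_one_of_dvd_coprimes hac (hxy.dvd_of_dvd_mul_right h7)
        (Dvd.intro_left g rfl)
      have h10 : y = 1 := Nat.eq_one_of_dvd_coprimes hbc (hxy.symm.dvd_of_dvd_mul_right h8)
        (Dvd.intro_left g rfl)
      rw [h9, h10]
    · rw [mem_reducedPairs]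
      refine ⟨⟨ha, hb⟩, hac, hbc, ⟨k, ?_⟩⟩
      rw [hh]; push_cast; ring
  have hpt : ∀ f ∈ numerators (g * x) ×ˢ numerators (g * y),
      volume.real (fractionBall (g * x) d f.1 ∩ fractionBall (g * y) e f.2) ≤
      if (fractionBall (g * x) d f.1 ∩ fractionBall (g * y) e f.2).Nonempty
        then 2 * min d e else 0 := by
    intro f _
    split_ifs with h
    · rcases min_cases d e with ⟨h1, -⟩ | ⟨h1, -⟩ <;> rw [h1]
      · exact (measureReal_mono Set.inter_subset_left).trans (measureReal_fractionBall_le _ hd _)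
      · exact (measureReal_mono Set.inter_subset_right).trans (measureReal_fractionBall_le _ he _)
    · rw [Set.not_nonempty_iff_eq_empty.1 h]; simp
  rw [← Finset.sum_product']
  calc _ ≤ _ := Finset.sum_le_sum hpt
    _ = E.card * (2 * min d e) := by
      rw [← Finset.sum_filter, Finset.sum_const, nsmul_eq_mul]
    _ ≤ (∑ h ∈ H, (reducedPairs g x y h).card : ℕ) * (2 * min d e) := by
      have : 0 ≤ min d e := le_min hd he
      gcongr
    _ = _ := by push_cast; ring

/-- Total measure, with multiplicity, of the intersections of balls about fractions of
denominators `q` and `r`, the radius for denominator `n` being `ψ n / n`. -/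
noncomputable def overlap (ψ : ℕ → ℝ) (q r : ℕ) : ℝ :=
  ∑ a ∈ numerators q, ∑ b ∈ numerators r,
    volume.real (fractionBall q (ψ q / q) a ∩ fractionBall r (ψ r / r) b)

theorem exists_overlap_le_tailFactor : ∃ C : ℝ, 0 ≤ C ∧ ∀ {ψ : ℕ → ℝ}, (∀ v, 0 ≤ ψ v) →
    ∀ {q r : ℕ}, 0 < q → 0 < r → q ≠ r → overlap ψ q r ≤ 0 ∨ ∃ N : ℕ, 0 < N ∧
      2 * (r * ψ q) < (N + 1) * Nat.gcd q r ∧ 2 * (q * ψ r) < (N + 1) * Nat.gcd q r ∧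
      overlap ψ q r ≤ C * (vertexMass ψ q * vertexMass ψ r) *
        tailFactor (q / Nat.gcd q r * (r / Nat.gcd q r)) (Nat.log 16 N) := by
  obtain ⟨C, hC0, hC⟩ := exists_sum_card_reducedPairs_le
  refine ⟨4 * C, by positivity, fun {ψ} hψ {q r} hq hr hqr => ?_⟩
  obtain ⟨g, x, y, hg, hxy, hqx, hry⟩ := Nat.exists_coprime' (m := q) (n := r)
    (Nat.gcd_pos_of_pos_left r hq)
  rw [mul_comm] at hqx hry
  have hx : 0 < x := Nat.pos_of_ne_zero (by rintro rfl; simp at hqx; omega)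
  have hy : 0 < y := Nat.pos_of_ne_zero (by rintro rfl; simp at hry; omega)
  have hgcd : Nat.gcd q r = g := by
    rw [hqx, hry, Nat.gcd_mul_left, Nat.Coprime.gcd_eq_one hxy, mul_one]
  have hxne : x ≠ y := fun h => hqr (by rw [hqx, hry, h])
  have hd : 0 ≤ ψ q / q := div_nonneg (hψ q) (by positivity)
  have he : 0 ≤ ψ r / r := div_nonneg (hψ r) (by positivity)
  have h1 := sum_measureReal_inter_le hg hx hy hxy hxne hd he
  rw [← hqx, ← hry] at h1
  set N := ⌊2 * max (ψ q / q) (ψ r / r) * (q * y : ℕ)⌋₊ with hN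
  rcases Nat.eq_zero_or_pos N with h0 | h0
  · left
    rw [h0] at h1
    refine le_trans (le_of_le_of_eq h1 ?_) le_rfl
    have : (Finset.Icc (-((0:ℕ) : ℤ)) (0 : ℕ)).filter (fun h => h ≠ 0) = ∅ := by
      simp
    rw [this]; simp
  right
  have hlt := Nat.lt_floor_add_one (2 * max (ψ q / q) (ψ r / r) * (q * y : ℕ))
  rw [← hN] at hlt
  have hg' : (0 : ℝ) < g := by exact_mod_cast hg
  have hx' : (0 : ℝ) < x := by exact_mod_cast hx
  have hy' : (0 : ℝ) < y := by exact_mod_cast hy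
  have hqc : (q : ℝ) = g * x := by rw [hqx]; push_cast; ring
  have hrc : (r : ℝ) = g * y := by rw [hry]; push_cast; ring
  refine ⟨N, h0, ?_, ?_, ?_⟩
  · have h2 : 2 * (ψ q / q) * (q * y : ℕ) < N + 1 := lt_of_le_of_lt (by
      gcongr; exact le_max_left _ _) hlt
    have h3 : 2 * (ψ q / q) * (q * y : ℕ) * g = 2 * (r * ψ q) := by
      push_cast; rw [hqc, hrc]; field_simp
    rw [hgcd, ← h3]
    gcongr
  · have h2 : 2 * (ψ r / r) * (q * y : ℕ) < N + 1 := lt_of_le_of_lt (by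
      gcongr; exact le_max_right _ _) hlt
    have h3 : 2 * (ψ r / r) * (q * y : ℕ) * g = 2 * (q * ψ r) := by
      push_cast; rw [hqc, hrc]; field_simp
    rw [hgcd, ← h3]
    gcongr
  · have h2 := hC hg hx hy hxy h0
    have hq' : q / Nat.gcd q r = x := by rw [hgcd, hqx, Nat.mul_div_cancel_left _ hg]
    have hr' : r / Nat.gcd q r = y := by rw [hgcd, hry, Nat.mul_div_cancel_left _ hg]
    rw [hq', hr']
    rw [← hqx, ← hry] at h2
    have hmin : 0 ≤ min (ψ q / q) (ψ r / r) := le_min hd he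
    have hfl : (N : ℝ) ≤ 2 * max (ψ q / q) (ψ r / r) * (q * y : ℕ) := Nat.floor_le (by
      have := hd.trans (le_max_left _ (ψ r / r)); positivity)
    have hT := tailFactor_nonneg (x * y) (Nat.log 16 N)
    calc overlap ψ q r ≤ _ := h1
      _ ≤ 2 * min (ψ q / q) (ψ r / r) * (C * N * g * (q.totient / q) * (r.totient / r) *
          tailFactor (x * y) (Nat.log 16 N)) := by gcongr
      _ ≤ 2 * min (ψ q / q) (ψ r / r) * (C * (2 * max (ψ q / q) (ψ r / r) * (q * y : ℕ)) * g *
          (q.totient / q) * (r.totient / r) * tailFactor (x * y) (Nat.log 16 N)) := by gcongr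
      _ = 4 * C * (min (ψ q / q) (ψ r / r) * max (ψ q / q) (ψ r / r)) * (q * y : ℕ) * g *
          (q.totient / q) * (r.totient / r) * tailFactor (x * y) (Nat.log 16 N) := by ring
      _ = _ := by
        rw [min_mul_max, vertexMass, vertexMass]
        push_cast
        rw [hqc, hrc]
        field_simp

/-- Sum of the reciprocals of the prime factors of `m` exceeding `s`. -/
noncomputable def tailSum (m s : ℕ) : ℝ := ∑ p ∈ m.primeFactors with s < p, 1 / (p : ℝ)

theorem tailFactor_le_exp (m s : ℕ) : tailFactor m s ≤ Real.exp (2 * tailSum m s) := by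
  rw [tailFactor, tailSum, Finset.mul_sum, Real.exp_sum]
  refine Finset.prod_le_prod (fun p hp => inv_nonneg.2 (one_sub_one_div_nonneg
    (Nat.prime_of_mem_primeFactors (Finset.mem_of_mem_filter p hp)))) fun p hp => ?_
  have hp' := Nat.prime_of_mem_primeFactors (Finset.mem_of_mem_filter p hp)
  refine le_trans ?_ (Real.add_one_le_exp _)
  have h2 : 1 / (p : ℝ) ≤ 1 / 2 := one_div_le_one_div_of_le (by norm_num)
    (by exact_mod_cast hp'.two_le)
  have h0 : 0 ≤ 1 / (p : ℝ) := by positivity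
  rw [inv_le_iff_one_le_mul₀ (by linarith)]
  nlinarith

theorem tailSum_antitone (m : ℕ) : Antitone (tailSum m) := fun s t hst =>
  Finset.sum_le_sum_of_subset_of_nonneg (Finset.monotone_filter_right _ fun p _ h => hst.trans_lt h)
    fun p _ _ => by positivity

theorem tailSum_self (m : ℕ) : tailSum m m = 0 := by
  rw [tailSum, Finset.filter_false_of_mem, Finset.sum_empty]
  intro p hp
  rw [Nat.mem_primeFactors] at hp
  exact (Nat.le_of_dvd (Nat.pos_of_ne_zero hp.2.2) hp.2.1).not_gt

theorem tailSum_le_add_harmonic (m s t : ℕ) : tailSum m s ≤ tailSum m t + harmonic t := by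
  have h1 : m.primeFactors.filter (fun p => s < p) ⊆
      m.primeFactors.filter (fun p => t < p) ∪ Finset.Icc 1 t := by
    intro p hp
    rw [Finset.mem_filter] at hp
    rw [Finset.mem_union, Finset.mem_filter, Finset.mem_Icc]
    by_cases h : t < p
    · exact Or.inl ⟨hp.1, h⟩
    · exact Or.inr ⟨by omega, by omega⟩
  rw [harmonic_eq_sum_Icc]
  push_cast
  refine (Finset.sum_le_sum_of_subset_of_nonneg h1 fun p _ _ => by positivity).trans ?_
  simp only [tailSum, one_div]
  rw [← Finset.sum_union_inter]
  exact le_add_of_nonneg_right (Finset.sum_nonneg fun _ _ => by positivity)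

/-- Either the tail factor is bounded, or `m` has many prime factors beyond some `τ > z`. -/
theorem tailFactor_dichotomy {m : ℕ} (z : ℕ) : tailFactor m z ≤ Real.exp 4 ∨
    ∃ τ, z < τ ∧ τ ≤ m ∧ 2 ≤ tailSum m (τ - 1) ∧
      tailFactor m z ≤ Real.exp 6 * (τ : ℝ) ^ 2 := by
  classical
  by_cases hz : tailSum m z < 2
  · left
    exact (tailFactor_le_exp m z).trans (Real.exp_le_exp.2 (by linarith))
  right
  push Not at hz
  set t := Nat.findGreatest (fun s => 2 ≤ tailSum m s) m with ht
  have hzm : z < m := by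
    by_contra! h
    have := tailSum_antitone m h
    rw [tailSum_self] at this
    linarith
  have h1 : 2 ≤ tailSum m t := Nat.findGreatest_spec (P := fun s => 2 ≤ tailSum m s) hzm.le hz
  have hzt : z ≤ t := Nat.le_findGreatest hzm.le hz
  have htm : t < m := by
    by_contra! h
    have := tailSum_antitone m h
    rw [tailSum_self] at this
    linarith
  refine ⟨t + 1, by omega, htm, by simpa using h1, ?_⟩
  have h2 : tailSum m (t + 1) < 2 := by
    by_contra! h
    have := Nat.le_findGreatest (P := fun s => 2 ≤ tailSum m s) htm h
    omega
  have h3 := tailSum_le_add_harmonic m z (t + 1)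
  have h4 := harmonic_le_one_add_log (t + 1)
  refine (tailFactor_le_exp m z).trans ?_
  have h5 : Real.exp 6 * ((t + 1 : ℕ) : ℝ) ^ 2 =
      Real.exp (6 + (Real.log (t + 1 : ℕ) + Real.log (t + 1 : ℕ))) := by
    rw [Real.exp_add, Real.exp_add, Real.exp_log (by positivity), pow_two]
  rw [h5]
  exact Real.exp_le_exp.2 (by linarith)

theorem sum_inv_sq_ge_le {P : Finset ℕ} {τ : ℕ} (hτ : 1 ≤ τ) :
    ∑ p ∈ P with τ ≤ p, ((p : ℝ) ^ 2)⁻¹ ≤ 2 / τ := by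
  have h1 : P.filter (fun p => τ ≤ p) ⊆ Finset.Ioo (τ - 1) (P.sup id + 1) := by
    intro p hp
    rw [Finset.mem_filter] at hp
    have := Finset.le_sup (f := id) hp.1
    simp only [id] at this
    rw [Finset.mem_Ioo]
    omega
  refine (Finset.sum_le_sum_of_subset_of_nonneg h1 fun p _ _ => by positivity).trans ?_
  have h2 := sum_Ioo_inv_sq_le (α := ℝ) (τ - 1) (P.sup id + 1)
  rwa [Nat.cast_sub hτ, Nat.cast_one, sub_add_cancel] at h2

/-- Prime weights concentrated on primes at least `τ`. -/
noncomputable def tailWeight (τ p : ℕ) : ℝ := if τ ≤ p then Real.exp (12 * τ / p) else 1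

theorem one_le_tailWeight (τ p : ℕ) : 1 ≤ tailWeight τ p := by
  unfold tailWeight
  split_ifs
  · exact Real.one_le_exp (by positivity)
  · exact le_rfl

theorem tailWeight_le {τ p : ℕ} (hp : 0 < p) : tailWeight τ p ≤ Real.exp 12 := by
  unfold tailWeight
  split_ifs with h
  · have h1 : (τ : ℝ) ≤ p := by exact_mod_cast h
    have h2 : (0 : ℝ) < p := by exact_mod_cast hp
    exact Real.exp_le_exp.2 ((div_le_iff₀ h2).2 (by linarith))
  · exact Real.one_le_exp (by norm_num)

theorem tailWeight_sub_one_le {τ p : ℕ} (hp : 0 < p) :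
    (tailWeight τ p - 1) / p ≤ if τ ≤ p then 12 * Real.exp 12 * τ * ((p : ℝ) ^ 2)⁻¹ else 0 := by
  have h0 := tailWeight_le (τ := τ) hp
  unfold tailWeight at *
  split_ifs at * with h
  · have h2 : (0 : ℝ) < p := by exact_mod_cast hp
    have h3 : Real.exp (12 * τ / p) - 1 ≤ (12 * τ / p) * Real.exp (12 * τ / p) := by
      have h4 := Real.add_one_le_exp (-(12 * τ / p : ℝ))
      have h5 : Real.exp (-(12 * τ / p : ℝ)) * Real.exp (12 * τ / p) = 1 := by
        rw [← Real.exp_add]; simp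
      have h6 := Real.exp_pos (12 * τ / p : ℝ)
      nlinarith
    calc _ ≤ (12 * τ / p) * Real.exp (12 * τ / p) / p := by gcongr
      _ ≤ (12 * τ / p) * Real.exp 12 / p := by gcongr
      _ = _ := by field_simp
  · simp

theorem sum_tailWeight_le {P : Finset ℕ} (hP : ∀ p ∈ P, p.Prime) {τ : ℕ} (hτ : 1 ≤ τ) :
    ∑ p ∈ P, (tailWeight τ p - 1) / p ≤ 24 * Real.exp 12 := by
  have h0 : (0 : ℝ) < τ := by exact_mod_cast hτ
  calc _ ≤ ∑ p ∈ P, if τ ≤ p then 12 * Real.exp 12 * τ * ((p : ℝ) ^ 2)⁻¹ else 0 :=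
        Finset.sum_le_sum fun p hp => tailWeight_sub_one_le (hP p hp).pos
    _ = 12 * Real.exp 12 * τ * ∑ p ∈ P with τ ≤ p, ((p : ℝ) ^ 2)⁻¹ := by
        rw [← Finset.sum_filter, Finset.mul_sum]
    _ ≤ 12 * Real.exp 12 * τ * (2 / τ) := by gcongr; exact sum_inv_sq_ge_le hτ
    _ = _ := by field_simp; norm_num

theorem exp_le_primeWeight_tailWeight {P : Finset ℕ} {n τ : ℕ} (hτ : 1 ≤ τ)
    (hP : n.primeFactors ⊆ P) (h : 1 ≤ tailSum n (τ - 1)) :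
    Real.exp (12 * τ) ≤ primeWeight P (tailWeight τ) n := by
  unfold primeWeight
  have h1 : n.primeFactors.filter (fun p => τ - 1 < p) ⊆ P :=
    (Finset.filter_subset _ _).trans hP
  rw [← Finset.prod_sdiff h1]
  have h2 : ∏ p ∈ n.primeFactors with τ - 1 < p, (if p ∣ n then tailWeight τ p else 1) =
      Real.exp (12 * τ * tailSum n (τ - 1)) := by
    rw [tailSum, Finset.mul_sum, Real.exp_sum]
    refine Finset.prod_congr rfl fun p hp => ?_
    rw [Finset.mem_filter] at hp
    rw [if_pos (Nat.dvd_of_mem_primeFactors hp.1), tailWeight, if_pos (by omega)]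
    congr 1; ring
  rw [h2]
  have h3 : 1 ≤ ∏ p ∈ P \ n.primeFactors.filter (fun p => τ - 1 < p),
      (if p ∣ n then tailWeight τ p else 1) := by
    refine Finset.prod_induction _ (fun x : ℝ => 1 ≤ x) (fun _ _ => one_le_mul_of_one_le_of_one_le) le_rfl
      fun p _ => ?_
    split_ifs
    exacts [one_le_tailWeight τ p, le_rfl]
  have h4 : Real.exp (12 * τ) ≤ Real.exp (12 * τ * tailSum n (τ - 1)) :=
    Real.exp_le_exp.2 (le_mul_of_one_le_right (by positivity) h)
  exact h4.trans (le_mul_of_one_le_left (Real.exp_pos _).le h3)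

/-- Pairs `(v, w)` for which `v / gcd v w` has many prime factors beyond `τ`. -/
noncomputable def tailPairs (ψ : ℕ → ℝ) (V : Finset ℕ) (τ : ℕ) : Finset (ℕ × ℕ) := by
  classical
  exact (V ×ˢ V).filter fun e => 1 ≤ tailSum (e.1 / Nat.gcd e.1 e.2) (τ - 1) ∧
    e.2 * ψ e.1 ≤ 16 ^ τ * Nat.gcd e.1 e.2 ∧ e.1 * ψ e.2 ≤ 16 ^ τ * Nat.gcd e.1 e.2

theorem exists_tailPairs_mass_constant : ∃ C : ℝ, 0 ≤ C ∧ ∀ {ψ : ℕ → ℝ}, (∀ v, 0 ≤ ψ v) →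
    ∀ {V : Finset ℕ}, (∀ v ∈ V, 0 < v ∧ 0 < ψ v) → ∀ {τ : ℕ}, 1 ≤ τ →
    ∑ e ∈ tailPairs ψ V τ, vertexMass ψ e.1 * vertexMass ψ e.2 ≤
      C * (1 / 2) ^ τ * ((∑ v ∈ V, vertexMass ψ v) * ∑ v ∈ V, vertexMass ψ v) ^ (3/4 : ℝ) := by
  obtain ⟨C, hC0, hC⟩ := exists_edge_mass_constant (Real.exp 12) (Real.one_le_exp (by norm_num))
  refine ⟨C * Real.exp (3 * (24 * Real.exp 12)), by positivity, fun {ψ} hψ {V} hV {τ} hτ => ?_⟩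
  set P := V.biUnion Nat.primeFactors with hP
  have hPp : ∀ p ∈ P, p.Prime := fun p hp => by
    obtain ⟨v, -, hv⟩ := Finset.mem_biUnion.1 hp
    exact Nat.prime_of_mem_primeFactors hv
  have hVP : ∀ v ∈ V, v.primeFactors ⊆ P := fun v hv => Finset.subset_biUnion_of_mem _ hv
  have hψ' : ∀ v, 0 ≤ ψ v / 16 ^ τ := fun v => div_nonneg (hψ v) (by positivity)
  have h1 := hC hPp (κ := tailWeight τ) (fun p _ => one_le_tailWeight τ p)
    (fun p hp => tailWeight_le (hPp p hp).pos) (Real.exp_pos (12 * τ))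
    (ψ := fun v => ψ v / 16 ^ τ) hψ' (V := V) (W := V) (E := tailPairs ψ V τ)
    (Finset.filter_subset _ _) (by
      rintro ⟨v, w⟩ he
      obtain ⟨hvw, h1, h2, h3⟩ := Finset.mem_filter.1 he
      obtain ⟨hv, hw⟩ := Finset.mem_product.1 hvw
      have hv1 := hV v hv
      have hw1 := hV w hw
      dsimp only at *
      have h16 : (0:ℝ) < 16 ^ τ := by positivity
      refine ⟨hv1.1, hw1.1, hVP v hv, hVP w hw, div_pos hv1.2 h16, div_pos hw1.2 h16, ?_, ?_, ?_⟩
      · rw [← mul_div_assoc, div_le_iff₀ h16, mul_comm (Nat.gcd v w : ℝ)]; exact h2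
      · rw [← mul_div_assoc, div_le_iff₀ h16, mul_comm (Nat.gcd v w : ℝ)]; exact h3
      · refine exp_le_primeWeight_tailWeight hτ ?_ h1
        exact (Nat.primeFactors_mono (Nat.div_dvd_of_dvd (Nat.gcd_dvd_left v w))
          hv1.1.ne').trans (hVP v hv))
  have hvm : ∀ v, vertexMass (fun v => ψ v / 16 ^ τ) v = vertexMass ψ v * (1 / 16 ^ τ) := fun v => by
    unfold vertexMass; ring
  simp only [hvm] at h1
  rw [← Finset.sum_mul] at h1
  set m := ∑ v ∈ V, vertexMass ψ v with hm
  have hm0 : 0 ≤ m := Finset.sum_nonneg fun v _ => vertexMass_nonneg hψ v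
  have h2 : ∑ e ∈ tailPairs ψ V τ, vertexMass ψ e.1 * (1 / 16 ^ τ) *
      (vertexMass ψ e.2 * (1 / 16 ^ τ)) =
      (∑ e ∈ tailPairs ψ V τ, vertexMass ψ e.1 * vertexMass ψ e.2) * (1 / 256 ^ τ) := by
    rw [Finset.sum_mul]
    refine Finset.sum_congr rfl fun e _ => ?_
    rw [show (256:ℝ) = 16 * 16 by norm_num, mul_pow]
    field_simp
  have h3 : (m * (1 / 16 ^ τ) * (m * (1 / 16 ^ τ))) ^ (3/4 : ℝ) =
      (m * m) ^ (3/4 : ℝ) * (1 / 64 ^ τ) := by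
    rw [show m * (1 / 16 ^ τ) * (m * (1 / 16 ^ τ)) = m * m * ((1 / 4 ^ τ) ^ (4:ℕ)) by
      rw [show (16:ℝ) = 4 ^ 2 by norm_num, ← pow_mul]; field_simp; ring]
    rw [Real.mul_rpow (by positivity) (by positivity), ← Real.rpow_natCast (1 / 4 ^ τ) 4,
      ← Real.rpow_mul (by positivity)]
    rw [show ((4:ℕ):ℝ) * (3/4) = (3:ℕ) by norm_num, Real.rpow_natCast,
      show (64:ℝ) = 4 ^ 3 by norm_num, ← pow_mul, one_div_pow, ← pow_mul, mul_comm τ]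
  have h4 : (1 / Real.exp (12 * τ)) ^ (1/4 : ℝ) ≤ (1 / 8) ^ τ := by
    rw [one_div, ← Real.exp_neg, ← Real.exp_mul]
    have h5 : (-(12 * (τ:ℝ)) * (1/4)) = (τ : ℝ) * (-3) := by ring
    rw [h5, Real.exp_nat_mul]
    gcongr
    rw [Real.exp_neg, one_div]
    gcongr
    have h6 : (2:ℝ) ≤ Real.exp 1 := by have := Real.add_one_le_exp (1:ℝ); linarith
    calc (8:ℝ) = 2 ^ 3 := by norm_num
      _ ≤ Real.exp 1 ^ 3 := by gcongr
      _ = Real.exp 3 := by rw [← Real.exp_nat_mul]; norm_num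
  rw [h2, h3] at h1
  have h5 : Real.exp (3 * ∑ p ∈ P, (tailWeight τ p - 1) / p) ≤ Real.exp (3 * (24 * Real.exp 12)) :=
    Real.exp_le_exp.2 (by linarith [sum_tailWeight_le hPp hτ])
  have h6 : (∑ e ∈ tailPairs ψ V τ, vertexMass ψ e.1 * vertexMass ψ e.2) * (1 / 256 ^ τ) ≤
      C * Real.exp (3 * (24 * Real.exp 12)) * (1 / 8) ^ τ * ((m * m) ^ (3/4 : ℝ) * (1 / 64 ^ τ)) :=
    h1.trans (by gcongr)
  have h7 : (0:ℝ) < 256 ^ τ := by positivity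
  rw [mul_one_div, div_le_iff₀ h7] at h6
  refine h6.trans_eq ?_
  rw [show (256:ℝ) = 64 * 4 by norm_num, mul_pow, show (1/8 : ℝ) = (1/2) * (1/4) by norm_num,
    mul_pow (1/2 : ℝ), one_div_pow 4]
  field_simp

theorem tailSum_mul_le {x y : ℕ} (hx : x ≠ 0) (hy : y ≠ 0) (s : ℕ) :
    tailSum (x * y) s ≤ tailSum x s + tailSum y s := by
  rw [tailSum, Nat.primeFactors_mul hx hy, Finset.filter_union, tailSum, tailSum,
    ← Finset.sum_union_inter]
  exact le_add_of_nonneg_right (Finset.sum_nonneg fun _ _ => by positivity)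

theorem mem_tailPairs {ψ : ℕ → ℝ} {V : Finset ℕ} {τ v w : ℕ} : (v, w) ∈ tailPairs ψ V τ ↔
    (v ∈ V ∧ w ∈ V) ∧ 1 ≤ tailSum (v / Nat.gcd v w) (τ - 1) ∧
    w * ψ v ≤ 16 ^ τ * Nat.gcd v w ∧ v * ψ w ≤ 16 ^ τ * Nat.gcd v w := by
  simp [tailPairs]

theorem exists_sum_overlap_constant : ∃ C : ℝ, 0 ≤ C ∧ ∀ {ψ : ℕ → ℝ}, (∀ v, 0 ≤ ψ v) →
    ∀ {V : Finset ℕ}, (∀ v ∈ V, 0 < v ∧ 0 < ψ v) →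
    ∑ e ∈ V ×ˢ V with e.1 ≠ e.2, overlap ψ e.1 e.2 ≤
      C * ((∑ v ∈ V, vertexMass ψ v) * (∑ v ∈ V, vertexMass ψ v) +
        ((∑ v ∈ V, vertexMass ψ v) * ∑ v ∈ V, vertexMass ψ v) ^ (3/4 : ℝ)) := by
  classical
  obtain ⟨C, hC0, hC⟩ := exists_overlap_le_tailFactor
  obtain ⟨D, hD0, hD⟩ := exists_tailPairs_mass_constant
  have hsum : Summable fun τ : ℕ => (τ : ℝ) ^ 2 * (1/2) ^ τ :=
    summable_pow_mul_geometric_of_norm_lt_one 2 (by norm_num)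
  set S := ∑' τ : ℕ, (τ : ℝ) ^ 2 * (1/2) ^ τ with hS
  have hS0 : 0 ≤ S := tsum_nonneg fun τ => by positivity
  refine ⟨C * (Real.exp 4 + 2 * Real.exp 6 * D * S), by positivity, fun {ψ} hψ {V} hV => ?_⟩
  set R := V.sup id * V.sup id with hR
  set μ := vertexMass ψ with hμ
  have hμ0 : ∀ v, 0 ≤ μ v := vertexMass_nonneg hψ
  set M := ∑ v ∈ V, μ v with hM
  have hM0 : 0 ≤ M := Finset.sum_nonneg fun v _ => hμ0 v
  set F : ℕ → ℕ × ℕ → ℝ := fun τ e => if e ∈ tailPairs ψ V τ then μ e.1 * μ e.2 else 0 with hF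
  have hF0 : ∀ τ e, 0 ≤ F τ e := fun τ e => by
    simp only [hF]; split_ifs
    exacts [mul_nonneg (hμ0 _) (hμ0 _), le_rfl]
  have hpt : ∀ e ∈ (V ×ˢ V).filter (fun e => e.1 ≠ e.2), overlap ψ e.1 e.2 ≤
      C * (Real.exp 4 * (μ e.1 * μ e.2) +
        ∑ τ ∈ Finset.Icc 1 R, Real.exp 6 * (τ : ℝ) ^ 2 * (F τ e + F τ e.swap)) := by
    rintro ⟨v, w⟩ he
    obtain ⟨he, hvw⟩ := Finset.mem_filter.1 he
    obtain ⟨hv, hw⟩ := Finset.mem_product.1 he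
    dsimp only at *
    have hv1 := hV v hv
    have hw1 := hV w hw
    have hμμ := mul_nonneg (hμ0 v) (hμ0 w)
    have hsum0 : 0 ≤ ∑ τ ∈ Finset.Icc 1 R, Real.exp 6 * (τ : ℝ) ^ 2 *
        (F τ (v, w) + F τ (v, w).swap) := Finset.sum_nonneg fun τ _ =>
      mul_nonneg (by positivity) (add_nonneg (hF0 _ _) (hF0 _ _))
    rcases hC hψ hv1.1 hw1.1 hvw with h | ⟨N, hN0, h1, h2, h3⟩
    · exact h.trans (by positivity)
    rw [mul_assoc] at h3
    refine h3.trans (mul_le_mul_of_nonneg_left ?_ hC0)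
    set g := Nat.gcd v w with hg
    have hg0 : 0 < g := Nat.gcd_pos_of_pos_left w hv1.1
    have hx : 0 < v / g := Nat.div_pos (Nat.le_of_dvd hv1.1 (Nat.gcd_dvd_left v w)) hg0
    have hy : 0 < w / g := Nat.div_pos (Nat.le_of_dvd hw1.1 (Nat.gcd_dvd_right v w)) hg0
    rcases tailFactor_dichotomy (m := v / g * (w / g)) (Nat.log 16 N) with h4 | ⟨τ, h4, h5, h6, h7⟩
    · refine le_add_of_le_of_nonneg ?_ hsum0
      rw [mul_comm]
      gcongr
    refine le_add_of_nonneg_of_le (by positivity) ?_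
    have hτ1 : 1 ≤ τ := by omega
    have hτR : τ ≤ R := by
      refine h5.trans (Nat.mul_le_mul ?_ ?_)
      · exact (Nat.div_le_self _ _).trans (Finset.le_sup (f := id) hv)
      · exact (Nat.div_le_self _ _).trans (Finset.le_sup (f := id) hw)
    have hNτ : ((N : ℝ) + 1) ≤ 16 ^ τ := by
      have : N < 16 ^ τ := Nat.lt_pow_of_log_lt (by norm_num) h4
      exact_mod_cast this
    have hgr : (0 : ℝ) ≤ g := by positivity
    have h8 : w * ψ v ≤ 16 ^ τ * g := by
      have := mul_nonneg (Nat.cast_nonneg (α := ℝ) w) (hψ v)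
      nlinarith
    have h9 : v * ψ w ≤ 16 ^ τ * g := by
      have := mul_nonneg (Nat.cast_nonneg (α := ℝ) v) (hψ w)
      nlinarith
    have h10 := tailSum_mul_le hx.ne' hy.ne' (τ - 1)
    have h11 : μ v * μ w ≤ F τ (v, w) + F τ (v, w).swap := by
      by_cases ha : 1 ≤ tailSum (v / g) (τ - 1)
      · refine le_add_of_le_of_nonneg ?_ (hF0 _ _)
        simp only [hF]
        rw [if_pos (mem_tailPairs.2 ⟨⟨hv, hw⟩, ha, h8, h9⟩)]
      · refine le_add_of_nonneg_of_le (hF0 _ _) ?_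
        simp only [hF, Prod.swap]
        rw [if_pos (mem_tailPairs.2 ⟨⟨hw, hv⟩, ?_, ?_, ?_⟩), mul_comm]
        · rw [Nat.gcd_comm]; linarith
        · rw [Nat.gcd_comm]; exact h9
        · rw [Nat.gcd_comm]; exact h8
    calc μ v * μ w * tailFactor (v / g * (w / g)) (Nat.log 16 N) ≤
        μ v * μ w * (Real.exp 6 * (τ : ℝ) ^ 2) := by gcongr
      _ = Real.exp 6 * (τ : ℝ) ^ 2 * (μ v * μ w) := by ring
      _ ≤ Real.exp 6 * (τ : ℝ) ^ 2 * (F τ (v, w) + F τ (v, w).swap) := by gcongr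
      _ ≤ _ := Finset.single_le_sum (f := fun τ : ℕ => Real.exp 6 * (τ : ℝ) ^ 2 *
          (F τ (v, w) + F τ (v, w).swap)) (fun τ _ => mul_nonneg (by positivity)
          (add_nonneg (hF0 _ _) (hF0 _ _))) (Finset.mem_Icc.2 ⟨hτ1, hτR⟩)
  have hFsum : ∀ τ ∈ Finset.Icc 1 R, ∑ e ∈ V ×ˢ V, F τ e ≤ D * (1/2) ^ τ * (M * M) ^ (3/4 : ℝ) := by
    intro τ hτ
    simp only [hF]
    rw [← Finset.sum_filter]
    refine le_trans (le_of_eq (Finset.sum_congr ?_ fun _ _ => rfl)) (hD hψ hV (Finset.mem_Icc.1 hτ).1)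
    ext e
    rw [Finset.mem_filter, and_iff_right_iff_imp]
    intro h
    exact Finset.filter_subset _ _ h
  have hswap : ∀ τ, ∑ e ∈ V ×ˢ V, F τ e.swap = ∑ e ∈ V ×ˢ V, F τ e := by
    intro τ
    refine Finset.sum_nbij' Prod.swap Prod.swap ?_ ?_ ?_ ?_ ?_ <;>
      simp +contextual [Finset.mem_product]
  have hMM : ∑ e ∈ V ×ˢ V, μ e.1 * μ e.2 = M * M := by
    rw [hM, Finset.sum_mul_sum, ← Finset.sum_product']
  calc _ ≤ ∑ e ∈ V ×ˢ V with e.1 ≠ e.2, C * (Real.exp 4 * (μ e.1 * μ e.2) +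
        ∑ τ ∈ Finset.Icc 1 R, Real.exp 6 * (τ : ℝ) ^ 2 * (F τ e + F τ e.swap)) :=
        Finset.sum_le_sum hpt
    _ ≤ ∑ e ∈ V ×ˢ V, C * (Real.exp 4 * (μ e.1 * μ e.2) +
        ∑ τ ∈ Finset.Icc 1 R, Real.exp 6 * (τ : ℝ) ^ 2 * (F τ e + F τ e.swap)) := by
        refine Finset.sum_le_sum_of_subset_of_nonneg (Finset.filter_subset _ _) fun e _ _ => ?_
        refine mul_nonneg hC0 (add_nonneg (mul_nonneg (Real.exp_pos _).le
          (mul_nonneg (hμ0 _) (hμ0 _))) (Finset.sum_nonneg fun τ _ => ?_))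
        exact mul_nonneg (by positivity) (add_nonneg (hF0 _ _) (hF0 _ _))
    _ = C * (Real.exp 4 * (M * M) + ∑ τ ∈ Finset.Icc 1 R, Real.exp 6 * (τ : ℝ) ^ 2 *
        (2 * ∑ e ∈ V ×ˢ V, F τ e)) := by
        rw [← Finset.mul_sum, Finset.sum_add_distrib, ← Finset.mul_sum, hMM, Finset.sum_comm]
        congr 2
        refine Finset.sum_congr rfl fun τ _ => ?_
        rw [← Finset.mul_sum, Finset.sum_add_distrib, hswap, two_mul]
    _ ≤ C * (Real.exp 4 * (M * M) + ∑ τ ∈ Finset.Icc 1 R, Real.exp 6 * (τ : ℝ) ^ 2 *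
        (2 * (D * (1/2) ^ τ * (M * M) ^ (3/4 : ℝ)))) := by
        gcongr with τ hτ
        exact hFsum τ hτ
    _ = C * (Real.exp 4 * (M * M) + 2 * Real.exp 6 * D * (M * M) ^ (3/4 : ℝ) *
        ∑ τ ∈ Finset.Icc 1 R, (τ : ℝ) ^ 2 * (1/2) ^ τ) := by
        rw [Finset.mul_sum (Finset.Icc 1 R)]
        congr 2
        exact Finset.sum_congr rfl fun τ _ => by ring
    _ ≤ C * (Real.exp 4 * (M * M) + 2 * Real.exp 6 * D * (M * M) ^ (3/4 : ℝ) * S) := by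
        gcongr
        exact hsum.sum_le_tsum _ fun τ _ => by positivity
    _ ≤ _ := by
        have h1 : 0 ≤ (M * M) ^ (3/4 : ℝ) := by positivity
        have h2 : 0 ≤ M * M := by positivity
        have h3 : 0 ≤ 2 * Real.exp 6 * D * S := by positivity
        rw [mul_assoc C]
        gcongr C * ?_
        nlinarith [mul_nonneg h3 h2, mul_nonneg (Real.exp_pos 4).le h1]

/-- Second moment method: quasi-independence on average bounds a union from below. -/
theorem one_div_le_measureReal_biUnion {Ω ι : Type*} [MeasurableSpace Ω] {μ : Measure Ω}
    [IsProbabilityMeasure μ] (I : Finset ι) {B : ι → Set Ω} (hB : ∀ i, MeasurableSet (B i))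
    {K : ℝ} (hK : 0 < K) (hS : 0 < ∑ i ∈ I, μ.real (B i))
    (h2 : ∑ i ∈ I, ∑ j ∈ I, μ.real (B i ∩ B j) ≤ K * (∑ i ∈ I, μ.real (B i)) ^ 2) :
    1 / K ≤ μ.real (⋃ i ∈ I, B i) := by
  classical
  set S := ∑ i ∈ I, μ.real (B i) with hSdef
  set U := ⋃ i ∈ I, B i with hU
  have hUm : MeasurableSet U := I.measurableSet_biUnion fun i _ => hB i
  set f : Ω → ℝ := fun x => ∑ i ∈ I, (B i).indicator 1 x with hf
  have hind : ∀ {s : Set Ω}, MeasurableSet s → Integrable (s.indicator (1 : Ω → ℝ)) μ :=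
    fun hs => (integrable_const (1 : ℝ)).indicator hs
  have hfi : Integrable f μ := integrable_finsetSum _ fun i _ => hind (hB i)
  have hfsq : ∀ x, f x ^ 2 = ∑ i ∈ I, ∑ j ∈ I, (B i ∩ B j).indicator (1 : Ω → ℝ) x := by
    intro x
    rw [hf, sq, Finset.sum_mul_sum]
    refine Finset.sum_congr rfl fun i _ => Finset.sum_congr rfl fun j _ => ?_
    rw [Set.inter_indicator_one]; rfl
  have hfsi : Integrable (fun x => f x ^ 2) μ := by
    simp only [hfsq]
    exact integrable_finsetSum _ fun i _ => integrable_finsetSum _ fun j _ =>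
      hind ((hB i).inter (hB j))
  have hint1 : ∫ x, f x ∂μ = S := by
    rw [hf, integral_finsetSum _ fun i _ => hind (hB i)]
    exact Finset.sum_congr rfl fun i _ => integral_indicator_one (hB i)
  have hint2 : ∫ x, f x ^ 2 ∂μ = ∑ i ∈ I, ∑ j ∈ I, μ.real (B i ∩ B j) := by
    simp only [hfsq]
    rw [integral_finsetSum _ fun i _ => integrable_finsetSum _ fun j _ =>
      hind ((hB i).inter (hB j))]
    refine Finset.sum_congr rfl fun i _ => ?_
    rw [integral_finsetSum _ fun j _ => hind ((hB i).inter (hB j))]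
    exact Finset.sum_congr rfl fun j _ => integral_indicator_one ((hB i).inter (hB j))
  set t := 1 / (K * S) with ht
  have hpt : ∀ x, 2 * t * f x - t ^ 2 * f x ^ 2 ≤ U.indicator (1 : Ω → ℝ) x := by
    intro x
    by_cases hx : x ∈ U
    · rw [Set.indicator_of_mem hx, Pi.one_apply]
      nlinarith [sq_nonneg (t * f x - 1)]
    · rw [Set.indicator_of_notMem hx]
      have : f x = 0 := Finset.sum_eq_zero fun i hi => Set.indicator_of_notMem
        (fun h => hx (Set.mem_biUnion hi h)) _
      rw [this]; simp
  have hmono := integral_mono ((hfi.const_mul (2 * t)).sub (hfsi.const_mul (t ^ 2))) (hind hUm) hpt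
  rw [integral_indicator_one hUm, integral_sub' (hfi.const_mul (2 * t)) (hfsi.const_mul (t ^ 2)),
    integral_const_mul, integral_const_mul, hint1, hint2] at hmono
  refine le_trans ?_ hmono
  have h3 : t ^ 2 * ∑ i ∈ I, ∑ j ∈ I, μ.real (B i ∩ B j) ≤ t ^ 2 * (K * S ^ 2) := by gcongr
  have h4 : t ^ 2 * (K * S ^ 2) = 1 / K := by rw [ht]; field_simp
  have h5 : 2 * t * S = 2 * (1 / K) := by rw [ht]; field_simp
  linarith

theorem measureReal_fractionBall (q : ℕ) {d : ℝ} (hd : 0 ≤ d) (hd1 : 2 * d ≤ 1) (a : ℕ) :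
    volume.real (fractionBall q d a) = 2 * d := by
  rw [fractionBall, measureReal_def,
    ← measure_congr (AddCircle.closedBall_ae_eq_ball (ε := d)), AddCircle.volume_closedBall,
    min_eq_right hd1, ENNReal.toReal_ofReal (by positivity)]

theorem overlap_self_le {ψ : ℕ → ℝ} {q : ℕ} (hq : 0 < q) (h0 : 0 ≤ ψ q) (h1 : ψ q ≤ 1 / 2) :
    overlap ψ q q ≤ 2 * vertexMass ψ q := by
  have hq' : (0 : ℝ) < q := by exact_mod_cast hq
  have hle : overlap ψ q q ≤ ∑ a ∈ numerators q, 2 * (ψ q / q) := by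
    refine Finset.sum_le_sum fun a ha => ?_
    rw [Finset.sum_eq_single a]
    · exact (measureReal_mono Set.inter_subset_left).trans
        (measureReal_fractionBall_le q (by positivity) a)
    · intro b hb hab
      by_contra hvol
      have hne := nonempty_of_measureReal_ne_zero hvol
      obtain ⟨k, hk⟩ := exists_abs_lt_of_fractionBall_inter hne
      rw [numerators, Finset.mem_filter, Finset.mem_range] at ha hb
      have h2 : |((a : ℤ) - b - k * q : ℤ)| < 1 := by
        have h3 : (((a : ℤ) - b - k * q : ℤ) : ℝ) = ((a : ℝ) / q - b / q - k) * q := by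
          push_cast; field_simp
        have h4 : |(((a : ℤ) - b - k * q : ℤ) : ℝ)| < 1 := by
          rw [h3, abs_mul, Nat.abs_cast]
          calc _ < (ψ q / q + ψ q / q) * q := by gcongr
            _ = 2 * ψ q := by field_simp; ring
            _ ≤ 1 := by linarith
        exact_mod_cast h4
      rw [Int.abs_lt_one_iff] at h2
      apply hab
      have h5 : (b : ℤ) % q = a % q := by
        have : (a : ℤ) = b + k * q := by linarith
        rw [this, Int.add_mul_emod_self_right]
      have h6 : b % q = a % q := by exact_mod_cast h5
      rwa [Nat.mod_eq_of_lt ha.1, Nat.mod_eq_of_lt hb.1] at h6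
    · exact fun h => absurd ha h
  refine hle.trans (le_of_eq ?_)
  rw [Finset.sum_const, card_numerators, vertexMass, nsmul_eq_mul]
  field_simp

theorem exists_measureReal_biUnion_fractionBall_ge : ∃ c : ℝ, 0 < c ∧ ∀ {ψ : ℕ → ℝ},
    (∀ q, 0 ≤ ψ q) → (∀ q, ψ q ≤ 1 / 2) → ∀ {V : Finset ℕ}, (∀ v ∈ V, 0 < v ∧ 0 < ψ v) →
    1 ≤ ∑ v ∈ V, vertexMass ψ v → c ≤ volume.real
      (⋃ i ∈ V.sigma numerators, fractionBall i.1 (ψ i.1 / i.1) i.2) := by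
  obtain ⟨C, hC0, hC⟩ := exists_sum_overlap_constant
  refine ⟨1 / ((2 + 2 * C) / 4), by positivity, fun {ψ} h0 h1 {V} hV hM => ?_⟩
  set M := ∑ v ∈ V, vertexMass ψ v with hMdef
  have hS : ∑ i ∈ V.sigma numerators, volume.real (fractionBall i.1 (ψ i.1 / i.1) i.2) =
      2 * M := by
    rw [Finset.sum_sigma, hMdef, Finset.mul_sum]
    refine Finset.sum_congr rfl fun q hq => ?_
    have hq' : (1 : ℝ) ≤ q := by exact_mod_cast (hV q hq).1
    have h2 : 2 * (ψ q / q) ≤ 1 := by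
      have : ψ q / q ≤ ψ q := div_le_self (h0 q) hq'
      linarith [h1 q]
    rw [Finset.sum_congr rfl fun a _ => measureReal_fractionBall q
      (div_nonneg (h0 q) (by positivity)) h2 a, Finset.sum_const, card_numerators, vertexMass,
      nsmul_eq_mul]
    ring
  have : IsProbabilityMeasure (volume : Measure UnitAddCircle) := ⟨UnitAddCircle.measure_univ⟩
  refine one_div_le_measureReal_biUnion (B := fun i : (_ : ℕ) × ℕ =>
    fractionBall i.1 (ψ i.1 / i.1) i.2) _ (fun i => Metric.isOpen_ball.measurableSet)
    (by positivity) (by rw [hS]; linarith) ?_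
  rw [hS]
  have h2 : ∑ i ∈ V.sigma numerators, ∑ j ∈ V.sigma numerators,
      volume.real (fractionBall i.1 (ψ i.1 / i.1) i.2 ∩ fractionBall j.1 (ψ j.1 / j.1) j.2) =
      ∑ e ∈ V ×ˢ V, overlap ψ e.1 e.2 := by
    rw [Finset.sum_product, Finset.sum_sigma]
    refine Finset.sum_congr rfl fun q _ => ?_
    simp only [Finset.sum_sigma, overlap]
    rw [Finset.sum_comm]
  rw [h2, ← Finset.sum_filter_add_sum_filter_not (V ×ˢ V) (fun e => e.1 ≠ e.2)]
  have h3 : ∑ e ∈ V ×ˢ V with ¬ e.1 ≠ e.2, overlap ψ e.1 e.2 ≤ 2 * M := by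
    have : (V ×ˢ V).filter (fun e => ¬ e.1 ≠ e.2) = V.diag := by
      ext e; simp [Finset.mem_diag]; grind
    rw [this, Finset.sum_diag, hMdef, Finset.mul_sum]
    exact Finset.sum_le_sum fun q hq => overlap_self_le (hV q hq).1 (h0 q) (h1 q)
  have h4 : (M * M) ^ (3 / 4 : ℝ) ≤ M * M := by
    conv_rhs => rw [← Real.rpow_one (M * M)]
    exact Real.rpow_le_rpow_of_exponent_le (by nlinarith) (by norm_num)
  have h5 := hC h0 hV
  rw [← hMdef] at h5
  nlinarith [mul_le_mul_of_nonneg_left h4 hC0]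

theorem exists_finset_one_le_sum {f : ℕ → ℝ} (hf : ∀ n, 0 ≤ f n) (h : ¬ Summable f) (n : ℕ) :
    ∃ V : Finset ℕ, (∀ v ∈ V, n ≤ v ∧ 0 < f v) ∧ 1 ≤ ∑ v ∈ V, f v := by
  rw [← summable_nat_add_iff n, not_summable_iff_tendsto_nat_atTop_of_nonneg
    (fun k => hf _)] at h
  obtain ⟨m, hm⟩ := (h.eventually_ge_atTop 1).exists
  refine ⟨(Finset.Ico n (n + m)).filter fun v => 0 < f v, fun v hv => ?_, ?_⟩
  · rw [Finset.mem_filter, Finset.mem_Ico] at hv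
    exact ⟨hv.1.1, hv.2⟩
  · rw [Finset.sum_filter_of_ne fun v _ hv => lt_of_le_of_ne (hf v) (Ne.symm hv),
      Finset.sum_Ico_eq_sum_range]
    simpa [add_comm] using hm

/-- The **Duffin–Schaeffer theorem** (divergence case), due to Koukoulopoulos and Maynard. -/
theorem ae_mem_addWellApproximable_of_not_summable {ψ : ℕ → ℝ} (h0 : ∀ q, 0 ≤ ψ q)
    (h1 : ∀ q, ψ q ≤ 1 / 2) (hdiv : ¬ Summable (vertexMass ψ)) :
    ∀ᵐ x : UnitAddCircle, x ∈ addWellApproximable UnitAddCircle (fun q => ψ q / q) := by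
  obtain ⟨c, hc, hcV⟩ := exists_measureReal_biUnion_fractionBall_ge
  set U : ℕ → Set UnitAddCircle := fun n =>
    ⋃ q ∈ Set.Ici n, ⋃ m ∈ numerators q, fractionBall q (ψ q / q) m with hU
  have hUo : ∀ n, IsOpen (U n) := fun n => isOpen_biUnion fun q _ => isOpen_biUnion fun m _ =>
    Metric.isOpen_ball
  have hUa : Antitone U := fun n m hnm =>
    Set.biUnion_subset_biUnion_left (Set.Ici_subset_Ici.2 hnm)
  have hUc : ∀ n, ENNReal.ofReal c ≤ volume (U n) := by
    intro n
    obtain ⟨V, hV, hV1⟩ := exists_finset_one_le_sum (vertexMass_nonneg h0) hdiv (max n 1)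
    have h2 : ∀ v ∈ V, 0 < v ∧ 0 < ψ v := by
      intro v hv
      refine ⟨lt_of_lt_of_le (by simp) (hV v hv).1, ?_⟩
      have := (hV v hv).2
      rw [vertexMass] at this
      exact (h0 v).lt_of_ne fun h => by simp [← h] at this
    have h3 := hcV h0 h1 h2 hV1
    rw [measureReal_def] at h3
    refine (ENNReal.ofReal_le_of_le_toReal h3).trans (measure_mono ?_)
    refine Set.iUnion₂_subset fun i hi => ?_
    rw [Finset.mem_sigma] at hi
    refine fun x hx => Set.mem_biUnion (x := i.1) ?_ (Set.mem_biUnion hi.2 hx)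
    exact (le_max_left _ _).trans (hV i.1 hi.1).1
  have hsub : ⋂ n, U n ⊆ addWellApproximable UnitAddCircle (fun q => ψ q / q) := by
    intro x hx
    rw [UnitAddCircle.mem_addWellApproximable_iff, Set.infinite_iff_exists_gt]
    intro n
    obtain ⟨q, hq, hx⟩ := Set.mem_iUnion₂.1 (Set.mem_iInter.1 hx (n + 1))
    obtain ⟨m, hm, hx⟩ := Set.mem_iUnion₂.1 hx
    rw [numerators, Finset.mem_filter, Finset.mem_range] at hm
    refine ⟨q, ⟨m, hm.1, hm.2, ?_⟩, Nat.lt_of_succ_le hq⟩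
    rwa [fractionBall, Metric.mem_ball, dist_eq_norm] at hx
  have hlim := tendsto_measure_iInter_atTop (μ := volume) (s := U)
    (fun n => (hUo n).measurableSet.nullMeasurableSet) hUa ⟨0, measure_ne_top _ _⟩
  have hge : ENNReal.ofReal c ≤ volume (⋂ n, U n) := ge_of_tendsto' hlim hUc
  have hδ : Tendsto (fun q : ℕ => ψ q / q) atTop (nhds 0) :=
    squeeze_zero (fun q => div_nonneg (h0 q) (by positivity))
      (fun q => div_le_div_of_nonneg_right (h1 q) (by positivity))
      (tendsto_const_div_atTop_nhds_zero_nat _)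
  refine (AddCircle.addWellApproximable_ae_empty_or_univ _ hδ).resolve_left fun h => ?_
  have h2 : volume (⋂ n, U n) = 0 := measure_mono_null hsub (by
    rw [ae_iff] at h
    simpa using h)
  rw [h2, nonpos_iff_eq_zero, ENNReal.ofReal_eq_zero] at hge
  linarith

/-- `k` is a floored difference of two of the terms `a 1, …, a N`. -/
def IsFloorDiff (a : ℕ → ℝ) (N k : ℕ) : Prop :=
  ∃ m n : ℕ, 1 ≤ m ∧ m ≤ N ∧ 1 ≤ n ∧ n ≤ N ∧ m ≠ n ∧ (k : ℤ) = ⌊|a m - a n|⌋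

theorem IsFloorDiff.mono {a : ℕ → ℝ} {M N k : ℕ} (h : IsFloorDiff a M k) (hMN : M ≤ N) :
    IsFloorDiff a N k := by
  obtain ⟨m, n, hm, hmM, hn, hnM, h⟩ := h
  exact ⟨m, n, hm, hmM.trans hMN, hn, hnM.trans hMN, h⟩

theorem calN_le_iff {a : ℕ → ℝ} {k N : ℕ} : calN a k ≤ N ↔ IsFloorDiff a N k := by
  constructor
  · intro h
    have hne : {M : ℕ∞ | ∃ M' : ℕ, M = (M' : ℕ∞) ∧ 1 ≤ M' ∧ IsFloorDiff a M' k}.Nonempty := by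
      by_contra hne
      rw [Set.not_nonempty_iff_eq_empty] at hne
      have htop : calN a k = ⊤ := by
        rw [calN]
        exact (congrArg sInf hne).trans sInf_empty
      rw [htop, top_le_iff] at h
      exact ENat.natCast_ne_top N h
    obtain ⟨M', hM, -, hd⟩ := csInf_mem hne
    refine hd.mono ?_
    rw [← Nat.cast_le (α := ℕ∞), ← hM]
    exact h
  · intro h
    obtain ⟨m, n, hm, hmN, h'⟩ := id h
    exact sInf_le ⟨N, rfl, hm.trans hmN, h⟩

theorem nint_nonneg (x : ℝ) : 0 ≤ nint x := abs_nonneg _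

theorem nint_le (x : ℝ) (n : ℤ) : nint x ≤ |x - n| := round_le x n

theorem IsFloorDiff.floorDeltaMin_le {a : ℕ → ℝ} {N k : ℕ} (h : IsFloorDiff a N k) (α : ℝ) :
    floorDeltaMin a α N ≤ nint (α * k) := by
  obtain ⟨m, n, hm, hmN, hn, hnN, hne, hk⟩ := h
  refine csInf_le ⟨0, ?_⟩ ⟨m, n, hm, hmN, hn, hnN, hne, by rw [← hk]; simp⟩
  rintro _ ⟨m, n, -, -, -, -, -, rfl⟩
  exact nint_nonneg _

theorem exists_isFloorDiff_eq_floorDeltaMin {a : ℕ → ℝ}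
    (hsep : ∀ m n, 1 ≤ m → 1 ≤ n → m ≠ n → 1 ≤ |a m - a n|) {N : ℕ} (hN : 2 ≤ N) (α : ℝ) :
    ∃ k : ℕ, 1 ≤ k ∧ IsFloorDiff a N k ∧ floorDeltaMin a α N = nint (α * k) := by
  set S := {d : ℝ | ∃ m n : ℕ, 1 ≤ m ∧ m ≤ N ∧ 1 ≤ n ∧ n ≤ N ∧ m ≠ n ∧
    d = nint (α * (⌊|a m - a n|⌋ : ℝ))} with hS
  have hfin : S.Finite := by
    refine (((Set.finite_Iic N).prod (Set.finite_Iic N)).image fun p : ℕ × ℕ =>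
      nint (α * (⌊|a p.1 - a p.2|⌋ : ℝ))).subset ?_
    rintro _ ⟨m, n, -, hm, -, hn, -, rfl⟩
    exact ⟨(m, n), ⟨hm, hn⟩, rfl⟩
  have hne : S.Nonempty := ⟨_, 1, 2, le_rfl, by omega, by omega, hN, by omega, rfl⟩
  obtain ⟨m, n, hm, hmN, hn, hnN, hmn, h⟩ := hne.csInf_mem hfin
  have h1 : 1 ≤ ⌊|a m - a n|⌋ := Int.le_floor.2 (by exact_mod_cast hsep m n hm hn hmn)
  obtain ⟨k, hk⟩ := Int.eq_ofNat_of_zero_le (zero_le_one.trans h1)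
  refine ⟨k, by omega, ⟨m, n, hm, hmN, hn, hnN, hmn, hk.symm⟩, ?_⟩
  rw [floorDeltaMin, ← hS, h, hk]
  simp

theorem finite_isFloorDiff (a : ℕ → ℝ) (N : ℕ) : {k | IsFloorDiff a N k}.Finite := by
  refine (((Set.finite_Iic N).prod (Set.finite_Iic N)).image fun p : ℕ × ℕ =>
    ⌊|a p.1 - a p.2|⌋.toNat).subset ?_
  rintro k ⟨m, n, -, hm, -, hn, -, hk⟩
  exact ⟨(m, n), ⟨hm, hn⟩, by simp [← hk]⟩

theorem infinite_isFloorDiff {a : ℕ → ℝ}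
    (hsep : ∀ m n, 1 ≤ m → 1 ≤ n → m ≠ n → 1 ≤ |a m - a n|) :
    {k | ∃ N, IsFloorDiff a N k}.Infinite := by
  refine Set.infinite_of_forall_exists_gt fun K => ?_
  by_contra! hK
  have hbd : ∀ m, 2 ≤ m → |a m - a 1| < K + 1 := by
    intro m hm
    by_contra! h
    have h1 : ((K + 1 : ℕ) : ℤ) ≤ ⌊|a m - a 1|⌋ := Int.le_floor.2 (by push_cast; exact h)
    obtain ⟨k, hk⟩ := Int.eq_ofNat_of_zero_le ((Int.natCast_nonneg _).trans h1)
    have := hK k ⟨m, m, 1, by omega, le_rfl, le_rfl, by omega, by omega, hk.symm⟩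
    omega
  have hmap : Set.MapsTo (fun m => ⌊a m⌋) (Set.Ici 2)
      (Set.Icc ⌊a 1 - (K + 1)⌋ ⌊a 1 + (K + 1)⌋) := by
    intro m hm
    have := abs_lt.1 (hbd m hm)
    exact ⟨Int.floor_le_floor (by linarith), Int.floor_le_floor (by linarith)⟩
  obtain ⟨m, hm, n, hn, hmn, h⟩ :=
    (Set.Ici_infinite 2).exists_ne_map_eq_of_mapsTo hmap (Set.finite_Icc _ _)
  rw [Set.mem_Ici] at hm hn
  exact (Int.abs_sub_lt_one_of_floor_eq_floor h).not_ge (hsep m n (by omega) (by omega) hmn)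

/-- Almost every point has multiples by elements of an infinite set arbitrarily close to the
integers. -/
theorem volume_forall_le_abs_sub_eq_zero {D : Set ℕ} (hD : D.Infinite) {ε : ℝ} (hε : 0 < ε) :
    volume {x ∈ Set.Icc (0 : ℝ) 1 | ∀ q ∈ D, ∀ i : ℤ, ε ≤ |q * x - i|} = 0 := by
  wlog hε2 : ε ≤ 1 / 4 generalizing ε
  · refine measure_mono_null ?_ (this (ε := 1 / 4) (by norm_num) le_rfl)
    exact fun x hx => ⟨hx.1, fun q hq i => (not_le.1 hε2).le.trans (hx.2 q hq i)⟩
  set E := {x ∈ Set.Icc (0 : ℝ) 1 | ∀ q ∈ D, ∀ i : ℤ, ε ≤ |q * x - i|} with hE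
  have hEc : IsClosed E := by
    have : E = Set.Icc (0 : ℝ) 1 ∩ ⋂ q ∈ D, ⋂ i : ℤ, {x : ℝ | ε ≤ |q * x - i|} := by
      ext x; simp [hE]
    rw [this]
    refine isClosed_Icc.inter (isClosed_biInter fun q _ => isClosed_iInter fun i => ?_)
    exact isClosed_le continuous_const (by fun_prop)
  have hEfin : volume E ≠ ⊤ := ((measure_mono (fun x hx => hx.1)).trans_lt
    (by simp : volume (Set.Icc (0 : ℝ) 1) < ⊤)).ne
  have hkey : ∀ q ∈ D, 0 < q →
      volume E ≤ ENNReal.ofReal (1 - 2 * ε) * volume (Metric.thickening (2 / q) E) := by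
    intro q hq hq0
    have hq' : (0 : ℝ) < q := by exact_mod_cast hq0
    classical
    set J : ℕ → Set ℝ := fun i => Set.Ico ((i : ℝ) / q) ((i + 1) / q) with hJ
    set F := (Finset.range (q + 1)).filter fun i => (E ∩ J i).Nonempty with hF
    have hcov : E ⊆ ⋃ i ∈ F, Set.Icc (((i : ℝ) + ε) / q) ((i + 1 - ε) / q) := by
      intro x hx
      have hx0 : 0 ≤ x * q := mul_nonneg hx.1.1 hq'.le
      have h1 := Nat.floor_le hx0
      have h2 := Nat.lt_floor_add_one (x * q)
      set i := ⌊x * q⌋₊ with hi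
      have hiq : i ≤ q := by
        have h3 : x * q ≤ q := mul_le_of_le_one_left hq'.le hx.1.2
        exact_mod_cast h1.trans h3
      have hiF : i ∈ F := by
        rw [hF, Finset.mem_filter, Finset.mem_range]
        exact ⟨by omega, x, hx, (div_le_iff₀ hq').2 h1, (lt_div_iff₀ hq').2 h2⟩
      refine Set.mem_biUnion hiF ⟨(div_le_iff₀ hq').2 ?_, (le_div_iff₀ hq').2 ?_⟩
      · have := hx.2 q hq i
        rw [Int.cast_natCast, abs_of_nonneg (by linarith)] at this
        linarith
      · have := hx.2 q hq (i + 1)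
        push_cast at this
        rw [abs_of_nonpos (by linarith)] at this
        linarith
    have hvol : volume E ≤ F.card * ENNReal.ofReal ((1 - 2 * ε) / q) := by
      refine (measure_mono hcov).trans ((measure_biUnion_finset_le _ _).trans ?_)
      rw [← nsmul_eq_mul]
      refine Finset.sum_le_card_nsmul _ _ _ fun i _ => ?_
      rw [Real.volume_Icc]
      exact ENNReal.ofReal_le_ofReal (le_of_eq (by field_simp; ring))
    have hthick : F.card * ENNReal.ofReal (1 / q) ≤ volume (Metric.thickening (2 / q) E) := by
      have h1 : volume (⋃ i ∈ F, J i) = F.card * ENNReal.ofReal (1 / q) := by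
        rw [measure_biUnion_finset _ fun i _ => measurableSet_Ico, ← nsmul_eq_mul,
          ← Finset.sum_const]
        · refine Finset.sum_congr rfl fun i _ => ?_
          rw [Real.volume_Ico]
          congr 1; field_simp; ring
        · intro i _ j _ hij
          rw [Function.onFun, Set.disjoint_left]
          rintro x ⟨h1, h2⟩ ⟨h3, h4⟩
          rw [div_le_iff₀ hq'] at h1 h3
          rw [lt_div_iff₀ hq'] at h2 h4
          apply hij
          have h5 : (i : ℝ) < j + 1 := by linarith
          have h6 : (j : ℝ) < i + 1 := by linarith
          norm_cast at h5 h6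
          omega
      rw [← h1]
      refine measure_mono (Set.iUnion₂_subset fun i hi x hx => ?_)
      rw [hF, Finset.mem_filter] at hi
      obtain ⟨-, y, hy, hyJ⟩ := hi
      refine Metric.mem_thickening_iff.2 ⟨y, hy, ?_⟩
      rw [Real.dist_eq, abs_lt]
      have h7 : ((i : ℝ) + 1) / q = i / q + 1 / q := by ring
      have h8 : (2 : ℝ) / q = 1 / q + 1 / q := by ring
      have h9 : 0 < 1 / (q : ℝ) := by positivity
      obtain ⟨h1, h2⟩ := hx
      obtain ⟨h3, h4⟩ := hyJ
      constructor <;> linarith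
    refine hvol.trans ?_
    calc F.card * ENNReal.ofReal ((1 - 2 * ε) / q)
        = ENNReal.ofReal (1 - 2 * ε) * (F.card * ENNReal.ofReal (1 / q)) := by
          rw [div_eq_mul_one_div, ENNReal.ofReal_mul (by linarith)]; ring
      _ ≤ _ := by gcongr
  have hlim : Tendsto (fun r => ENNReal.ofReal (1 - 2 * ε) * volume (Metric.thickening r E))
      (nhdsWithin 0 (Set.Ioi 0)) (nhds (ENNReal.ofReal (1 - 2 * ε) * volume E)) := by
    refine ENNReal.Tendsto.const_mul (tendsto_measure_thickening_of_isClosed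
      ⟨1, one_pos, ?_⟩ hEc) (Or.inr ENNReal.ofReal_ne_top)
    refine ((Bornology.IsBounded.subset (Metric.isBounded_Icc 0 1) fun x hx => hx.1
      ).thickening).measure_lt_top.ne
  have hle : volume E ≤ ENNReal.ofReal (1 - 2 * ε) * volume E := by
    have hseq : Tendsto (fun q : ℕ => 2 / (q : ℝ)) atTop (nhdsWithin 0 (Set.Ioi 0)) :=
      tendsto_nhdsWithin_iff.2 ⟨tendsto_const_div_atTop_nhds_zero_nat 2,
        (eventually_gt_atTop 0).mono fun q hq => by
          have : (0 : ℝ) < q := by exact_mod_cast hq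
          exact div_pos two_pos this⟩
    refine ge_of_tendsto_of_frequently (hlim.comp hseq) ?_
    refine ((Nat.frequently_atTop_iff_infinite.2 hD).and_eventually
      (eventually_gt_atTop 0)).mono fun q hq => hkey q hq.1 hq.2
  by_contra h0
  have hlt : ENNReal.ofReal (1 - 2 * ε) * volume E < 1 * volume E := by
    refine ENNReal.mul_lt_mul_left h0 hEfin ?_
    rw [← ENNReal.ofReal_one]
    exact (ENNReal.ofReal_lt_ofReal_iff one_pos).2 (by linarith)
  rw [one_mul] at hlt
  exact hlt.not_ge hle

/-- Supremum of `η` over the indices from which `k` occurs as a floored difference. -/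
noncomputable def tailSup (a : ℕ → ℝ) (η : ℕ → ℝ) (k : ℕ) : ℝ≥0∞ :=
  ⨆ (ℓ : ℕ) (_ : calN a k ≤ (ℓ : ℕ∞)), ENNReal.ofReal (η ℓ)

/-- The approximation radius attached to reduced fractions with denominator `k`. -/
noncomputable def approxRadius (a : ℕ → ℝ) (η : ℕ → ℝ) (k : ℕ) : ℝ≥0∞ :=
  ⨆ (b : ℕ) (_ : 1 ≤ b), tailSup a η (b * k) / ((b * k : ℕ) : ℝ≥0∞)

theorem seriesTerm_eq (a η : ℕ → ℝ) (k : ℕ) :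
    seriesTerm a η k = k.totient * approxRadius a η k := rfl

theorem le_tailSup {a η : ℕ → ℝ} {k N : ℕ} (h : IsFloorDiff a N k) :
    ENNReal.ofReal (η N) ≤ tailSup a η k :=
  le_iSup₂_of_le N (calN_le_iff.2 h) le_rfl

theorem le_approxRadius {a η : ℕ → ℝ} {k b : ℕ} (hb : 1 ≤ b) :
    tailSup a η (b * k) / ((b * k : ℕ) : ℝ≥0∞) ≤ approxRadius a η k :=
  le_iSup₂_of_le b hb le_rfl

theorem tsum_seriesTerm_eq_top {a η : ℕ → ℝ}
    (hsep : ∀ m n, 1 ≤ m → 1 ≤ n → m ≠ n → 1 ≤ |a m - a n|)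
    {δ : ℝ} (hδ : 0 < δ) (h : ∃ᶠ N in atTop, δ ≤ η N) : ∑' k, seriesTerm a η k = ⊤ := by
  by_contra hne
  have htail := ENNReal.tendsto_sum_nat_add _ hne
  obtain ⟨K, hK⟩ := (htail.eventually (gt_mem_nhds (ENNReal.ofReal_pos.2 (half_pos hδ)))).exists
  obtain ⟨q, ⟨M, hqM⟩, hqK⟩ := (infinite_isFloorDiff hsep).exists_gt (2 * K * K)
  have hq0 : 0 < q := by omega
  have hsup : ENNReal.ofReal δ ≤ tailSup a η q := by
    obtain ⟨N, hN, hMN⟩ := (h.and_eventually (eventually_ge_atTop M)).exists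
    exact (ENNReal.ofReal_le_ofReal hN).trans (le_tailSup (hqM.mono hMN))
  set F := q.divisors.filter fun k => K ≤ k with hF
  have hcard : q ≤ 2 * ∑ k ∈ F, k.totient := by
    have h1 := Nat.sum_totient q
    rw [← Finset.sum_filter_add_sum_filter_not _ (fun k => K ≤ k), ← hF] at h1
    have h2 : ∑ k ∈ q.divisors.filter (fun k => ¬ K ≤ k), k.totient ≤ K * K := by
      calc _ ≤ ∑ k ∈ Finset.range K, K := by
            refine (Finset.sum_le_sum fun k hk => ?_).trans
              (Finset.sum_le_sum_of_subset_of_nonneg (f := fun _ => K) ?_ fun _ _ _ => Nat.zero_le _)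
            · rw [Finset.mem_filter] at hk
              exact (Nat.totient_le k).trans (by omega)
            · intro k hk
              rw [Finset.mem_filter] at hk
              exact Finset.mem_range.2 (by omega)
        _ = K * K := by simp
    nlinarith
  have hterm : ∀ k ∈ F, (k.totient : ℝ≥0∞) * (ENNReal.ofReal δ / q) ≤ seriesTerm a η k := by
    intro k hk
    rw [hF, Finset.mem_filter, Nat.mem_divisors] at hk
    obtain ⟨b, hb⟩ := hk.1.1
    have hbpos : 1 ≤ b := Nat.one_le_iff_ne_zero.2 (by rintro rfl; simp at hb; omega)
    rw [seriesTerm_eq]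
    gcongr
    refine le_trans ?_ (le_approxRadius hbpos)
    rw [mul_comm b k, ← hb]
    gcongr
  have hsum : ENNReal.ofReal (δ / 2) ≤ ∑ k ∈ F, seriesTerm a η k := by
    refine le_trans ?_ (Finset.sum_le_sum hterm)
    rw [← Finset.sum_mul, ← Nat.cast_sum, ← ENNReal.ofReal_natCast q,
      ← ENNReal.ofReal_natCast (∑ k ∈ F, k.totient),
      ← ENNReal.ofReal_div_of_pos (by exact_mod_cast hq0), ← ENNReal.ofReal_mul (by positivity)]
    refine ENNReal.ofReal_le_ofReal ?_
    have hq' : (0 : ℝ) < q := by exact_mod_cast hq0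
    have h1 : (q : ℝ) ≤ 2 * ((∑ k ∈ F, k.totient : ℕ) : ℝ) := by exact_mod_cast hcard
    rw [mul_div_assoc', div_le_div_iff₀ two_pos hq']
    nlinarith
  have hle : ∑ k ∈ F, seriesTerm a η k ≤ ∑' k, seriesTerm a η (k + K) := by
    calc ∑ k ∈ F, seriesTerm a η k = ∑ k ∈ F.image (fun k => k - K), seriesTerm a η (k + K) := by
          rw [Finset.sum_image]
          · refine Finset.sum_congr rfl fun k hk => ?_
            rw [Nat.sub_add_cancel (Finset.mem_filter.1 hk).2]
          · intro x hx y hy hxy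
            have := (Finset.mem_filter.1 hx).2
            have := (Finset.mem_filter.1 hy).2
            simp only at hxy
            omega
      _ ≤ _ := ENNReal.sum_le_tsum _
  exact (hsum.trans hle).not_gt hK

/-- Points of `[0, 1]` approximated by a reduced fraction with denominator `k`. -/
def reducedBalls (r : ℕ → ℝ≥0∞) (k : ℕ) : Set ℝ :=
  ⋃ p ∈ (Finset.range (k + 1)).filter fun p => p.Coprime k, Metric.closedEBall ((p : ℝ) / k) (r k)

theorem volume_reducedBalls_le (r : ℕ → ℝ≥0∞) {k : ℕ} (hk : 0 < k) :
    volume (reducedBalls r k) ≤ 4 * (k.totient * r k) := by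
  have hcard : ((Finset.range (k + 1)).filter fun p => p.Coprime k).card ≤ 2 * k.totient := by
    rw [Finset.range_add_one, Finset.filter_insert]
    have h1 : ((Finset.range k).filter fun p => p.Coprime k).card = k.totient :=
      card_numerators k
    have h2 := Nat.totient_pos.2 hk
    split_ifs
    · exact (Finset.card_insert_le _ _).trans (by omega)
    · omega
  have h3 : volume (reducedBalls r k) ≤
      ((Finset.range (k + 1)).filter fun p => p.Coprime k).card * (2 * r k) := by
    refine (measure_biUnion_finset_le _ _).trans ?_
    rw [← nsmul_eq_mul]
    exact Finset.sum_le_card_nsmul _ _ _ fun p _ => (Real.volume_closedEBall _ _).le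
  refine h3.trans ((mul_le_mul_left (Nat.cast_le.2 hcard) _).trans (le_of_eq ?_))
  push_cast; ring

theorem ae_finite_mem_reducedBalls {r : ℕ → ℝ≥0∞} (h : ∑' k, (k.totient : ℝ≥0∞) * r k ≠ ⊤) :
    ∀ᵐ α : ℝ, ∀ᶠ k in atTop, α ∉ reducedBalls r (k + 1) := by
  refine ae_eventually_notMem ?_
  refine ne_top_of_le_ne_top (b := 4 * ∑' k, (k.totient : ℝ≥0∞) * r k)
    (ENNReal.mul_ne_top (by simp) h) ?_
  rw [← ENNReal.tsum_mul_left]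
  refine le_trans (ENNReal.tsum_le_tsum fun k => ?_)
    (ENNReal.tsum_comp_le_tsum_of_injective (add_left_injective 1) _)
  exact volume_reducedBalls_le r k.succ_pos

theorem eventually_floorDeltaMin_gt {a η : ℕ → ℝ}
    (hsep : ∀ m n, 1 ≤ m → 1 ≤ n → m ≠ n → 1 ≤ |a m - a n|)
    (hlim : ∀ δ > 0, ∀ᶠ N in atTop, η N < δ) {α : ℝ} (hα : α ∈ Set.Icc (0 : ℝ) 1)
    (hirr : Irrational α)
    (hfin : ∀ᶠ k in atTop, α ∉ reducedBalls (approxRadius a η) (k + 1)) :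
    ∀ᶠ N in atTop, η N < floorDeltaMin a α N := by
  obtain ⟨K, hK⟩ := eventually_atTop.1 hfin
  obtain ⟨δ, hδ, hδK⟩ : ∃ δ > 0, ∀ k ∈ Finset.Icc 1 K, δ ≤ nint (α * k) := by
    rcases (Finset.Icc 1 K).eq_empty_or_nonempty with h | h
    · exact ⟨1, one_pos, by simp [h]⟩
    obtain ⟨k, hk, hmin⟩ := Finset.exists_min_image (Finset.Icc 1 K) (fun k => nint (α * k)) h
    refine ⟨nint (α * k), abs_pos.2 (sub_ne_zero.2 ?_), hmin⟩
    have hk0 : k ≠ 0 := by rw [Finset.mem_Icc] at hk; omega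
    exact (hirr.mul_natCast hk0).ne_int _
  filter_upwards [hlim δ hδ, eventually_ge_atTop 2] with N hN hN2
  by_contra! hle
  obtain ⟨k, hk, hkN, heq⟩ := exists_isFloorDiff_eq_floorDeltaMin hsep hN2 α
  rw [heq] at hle
  have hk' : (0 : ℝ) < k := by exact_mod_cast hk
  obtain ⟨p, hp⟩ : ∃ p : ℕ, round (α * k) = p := by
    refine Int.eq_ofNat_of_zero_le ?_
    rw [round_eq]
    exact Int.floor_nonneg.2 (by have := mul_nonneg hα.1 hk'.le; linarith)
  have hpk : p ≤ k := by
    have h1 : round (α * k) < k + 1 := by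
      rw [round_eq, Int.floor_lt]
      push_cast
      have := mul_le_of_le_one_left hk'.le hα.2
      linarith
    omega
  obtain ⟨g, p', k', hg, hcop, hpg, hkg⟩ := Nat.exists_coprime' (m := p) (n := k)
    (Nat.gcd_pos_of_pos_right p hk)
  have hk'0 : 0 < k' := Nat.pos_of_ne_zero (by rintro rfl; simp at hkg; omega)
  have hg' : (1 : ℝ) ≤ g := by exact_mod_cast hg
  have hk'' : (0 : ℝ) < k' := by exact_mod_cast hk'0
  have hnint : nint (α * k) = |α * k' - p'| * g := by
    have h1 : α * k - (p : ℤ) = (α * k' - p') * g := by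
      rw [hpg, hkg]; push_cast; ring
    rw [nint, hp, h1, abs_mul, Nat.abs_cast]
  rw [hnint] at hle
  have hKk : K ≤ k' - 1 := by
    by_contra! h
    have h1 := hδK k' (Finset.mem_Icc.2 ⟨hk'0, by omega⟩)
    have h2 := nint_le (α * k') p'
    rw [Int.cast_natCast] at h2
    nlinarith [abs_nonneg (α * k' - p')]
  refine hK (k' - 1) hKk ?_
  rw [Nat.sub_add_cancel hk'0]
  refine Set.mem_biUnion (x := p') ?_ ?_
  · refine Finset.mem_coe.2 (Finset.mem_filter.2 ⟨Finset.mem_range.2 ?_, hcop⟩)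
    rw [hpg, hkg] at hpk
    exact Nat.lt_succ_of_le (Nat.le_of_mul_le_mul_right hpk hg)
  · rw [Metric.mem_closedEBall, edist_dist, Real.dist_eq]
    refine le_trans ?_ (le_approxRadius (b := g) hg)
    rw [mul_comm g k', ← hkg]
    refine le_trans ?_ (ENNReal.div_le_div_right (le_tailSup hkN) _)
    rw [← ENNReal.ofReal_natCast k, ← ENNReal.ofReal_div_of_pos hk']
    refine ENNReal.ofReal_le_ofReal ?_
    rw [le_div_iff₀ hk']
    refine le_of_eq_of_le ?_ hle
    have h1 : α * k' - p' = (α - p' / k') * k' := by field_simp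
    rw [h1, abs_mul, Nat.abs_cast, hkg]
    push_cast; ring

theorem volume_frequently_floorDeltaMin_le_eq_zero {a η : ℕ → ℝ}
    (hsep : ∀ m n, 1 ≤ m → 1 ≤ n → m ≠ n → 1 ≤ |a m - a n|)
    (hconv : ∑' k, seriesTerm a η k ≠ ⊤) :
    volume {α ∈ Set.Icc (0 : ℝ) 1 | ∃ᶠ N in atTop, floorDeltaMin a α N ≤ η N} = 0 := by
  have hlim : ∀ δ > 0, ∀ᶠ N in atTop, η N < δ := by
    intro δ hδ
    by_contra h
    exact hconv (tsum_seriesTerm_eq_top hsep hδ (by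
      simpa only [not_eventually, not_lt] using h))
  have hirr : ∀ᵐ α : ℝ, Irrational α :=
    (Set.countable_range ((↑) : ℚ → ℝ)).ae_notMem volume
  have hae : ∀ᵐ α : ℝ, ¬ (α ∈ Set.Icc (0 : ℝ) 1 ∧
      ∃ᶠ N in atTop, floorDeltaMin a α N ≤ η N) := by
    filter_upwards [hirr, ae_finite_mem_reducedBalls hconv] with α h1 h2 ⟨h3, h4⟩
    refine h4 ?_
    simpa only [not_le] using eventually_floorDeltaMin_gt hsep hlim h3 h1 h2
  rw [ae_iff] at hae
  simpa only [not_not] using hae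

theorem volume_eq_one_of_ae_restrict {P : ℝ → Prop}
    (h : ∀ᵐ α ∂volume.restrict (Set.Ioc (0 : ℝ) 1), P α) :
    volume {α ∈ Set.Icc (0 : ℝ) 1 | P α} = 1 := by
  refine le_antisymm ((measure_mono fun α hα => hα.1).trans_eq (by simp : volume (Set.Icc (0 : ℝ) 1) = 1)) ?_
  rw [ae_restrict_iff' measurableSet_Ioc] at h
  calc (1 : ℝ≥0∞) = volume (Set.Ioc (0 : ℝ) 1) := by simp
    _ ≤ _ := measure_mono_ae (h.mono fun α hα hmem => ⟨⟨hmem.1.le, hmem.2⟩, hα hmem⟩)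

theorem ae_frequently_floorDeltaMin_le_of_frequently_ge {a η : ℕ → ℝ}
    (hsep : ∀ m n, 1 ≤ m → 1 ≤ n → m ≠ n → 1 ≤ |a m - a n|)
    {δ : ℝ} (hδ : 0 < δ) (h : ∃ᶠ N in atTop, δ ≤ η N) :
    ∀ᵐ α ∂volume.restrict (Set.Ioc (0 : ℝ) 1), ∃ᶠ N in atTop, floorDeltaMin a α N ≤ η N := by
  rw [ae_restrict_iff' measurableSet_Ioc, ae_iff]
  refine measure_mono_null ?_
    (volume_forall_le_abs_sub_eq_zero (infinite_isFloorDiff hsep) hδ)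
  intro α hα
  rw [Set.mem_ofPred_eq, Classical.not_imp] at hα
  refine ⟨⟨hα.1.1.le, hα.1.2⟩, fun q ⟨M, hqM⟩ i => ?_⟩
  by_contra! hlt
  refine hα.2 ((h.and_eventually (eventually_ge_atTop M)).mono fun N ⟨hN, hMN⟩ => ?_)
  refine ((hqM.mono hMN).floorDeltaMin_le α).trans ((nint_le _ i).trans ?_)
  rw [mul_comm]
  exact hlt.le.trans hN

theorem eventually_tailSup_le {a η : ℕ → ℝ} (hlim : ∀ δ > 0, ∀ᶠ N in atTop, η N < δ)
    {δ : ℝ} (hδ : 0 < δ) : ∀ᶠ k in atTop, tailSup a η k ≤ ENNReal.ofReal δ := by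
  obtain ⟨M, hM⟩ := eventually_atTop.1 (hlim δ hδ)
  have h1 : ∀ᶠ k in atTop, ¬ IsFloorDiff a M k := by
    rw [← Nat.cofinite_eq_atTop]
    exact (finite_isFloorDiff a M).eventually_cofinite_notMem
  filter_upwards [h1] with k hk
  refine iSup₂_le fun ℓ hℓ => ENNReal.ofReal_le_ofReal (hM ℓ ?_).le
  by_contra! h
  exact hk ((calN_le_iff.1 hℓ).mono h.le)

theorem approxRadius_le {a η : ℕ → ℝ} {k : ℕ} {B : ℝ≥0∞} (h : ∀ j, k ≤ j → tailSup a η j ≤ B) :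
    approxRadius a η k ≤ B / k := by
  refine iSup₂_le fun b hb => ?_
  have h1 : k ≤ b * k := Nat.le_mul_of_pos_left k hb
  exact ENNReal.div_le_div (h _ h1) (Nat.cast_le.2 h1)

theorem tailSup_ne_top {a η : ℕ → ℝ} (hlim : ∀ δ > 0, ∀ᶠ N in atTop, η N < δ) :
    ∃ B : ℝ≥0∞, B ≠ ⊤ ∧ ∀ k, tailSup a η k ≤ B := by
  obtain ⟨M, hM⟩ := eventually_atTop.1 (hlim 1 one_pos)
  refine ⟨∑ N ∈ Finset.range M, ENNReal.ofReal (η N) + 1, by simp, fun k =>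
    iSup₂_le fun ℓ _ => ?_⟩
  by_cases h : ℓ < M
  · exact (Finset.single_le_sum (f := fun N => ENNReal.ofReal (η N)) (fun _ _ => zero_le)
      (Finset.mem_range.2 h)).trans le_self_add
  · refine le_trans ?_ le_add_self
    rw [← ENNReal.ofReal_one]
    exact ENNReal.ofReal_le_ofReal (hM ℓ (not_lt.1 h)).le

theorem ae_frequently_floorDeltaMin_le_of_tendsto {a η : ℕ → ℝ}
    (hlim : ∀ δ > 0, ∀ᶠ N in atTop, η N < δ) (hdiv : ∑' k, seriesTerm a η k = ⊤) :
    ∀ᵐ α ∂volume.restrict (Set.Ioc (0 : ℝ) 1), ∃ᶠ N in atTop, floorDeltaMin a α N ≤ η N := by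
  obtain ⟨K, hK⟩ := eventually_atTop.1 (eventually_tailSup_le (a := a) hlim one_half_pos)
  obtain ⟨B, hB, hBk⟩ := tailSup_ne_top (a := a) hlim
  set ψ : ℕ → ℝ := fun k => if K + 1 ≤ k then k * (approxRadius a η k).toReal else 0 with hψ
  have hrad : ∀ k, 0 < k → approxRadius a η k ≠ ⊤ := fun k hk =>
    ne_top_of_le_ne_top (ENNReal.div_ne_top hB (by exact_mod_cast hk.ne'))
      (approxRadius_le fun j _ => hBk j)
  have h0 : ∀ k, 0 ≤ ψ k := by
    intro k; rw [hψ]; dsimp only; split_ifs <;> positivity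
  have h1 : ∀ k, ψ k ≤ 1 / 2 := by
    intro k
    rw [hψ]; dsimp only
    split_ifs with hk
    · have hk0 : (0 : ℝ) < k := by exact_mod_cast (by omega : 0 < k)
      have h2 := approxRadius_le (k := k) fun j hj => hK j (by omega)
      rw [← ENNReal.ofReal_natCast k, ← ENNReal.ofReal_div_of_pos hk0] at h2
      have h3 := ENNReal.toReal_le_of_le_ofReal (by positivity) h2
      rw [le_div_iff₀ hk0] at h3
      linarith
    · norm_num
  have hns : ¬ Summable (vertexMass ψ) := by
    intro hs
    have h2 : ∑' k, ENNReal.ofReal (vertexMass ψ k) ≠ ⊤ := by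
      rw [← ENNReal.ofReal_tsum_of_nonneg (vertexMass_nonneg h0) hs]
      exact ENNReal.ofReal_ne_top
    rw [← Summable.sum_add_tsum_nat_add' (k := K + 1) ENNReal.summable,
      ENNReal.add_eq_top] at hdiv
    rcases hdiv with h | h
    · obtain ⟨k, -, hk⟩ := ENNReal.sum_eq_top.1 h
      rw [seriesTerm_eq] at hk
      rcases Nat.eq_zero_or_pos k with rfl | hk0
      · simp at hk
      · exact ENNReal.mul_ne_top (ENNReal.natCast_ne_top _) (hrad k hk0) hk
    · refine h2 (top_le_iff.1 ?_)
      rw [← h]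
      refine le_trans (ENNReal.tsum_le_tsum fun k => ?_)
        (ENNReal.tsum_comp_le_tsum_of_injective (add_left_injective (K + 1)) _)
      have hk0 : ((k + (K + 1) : ℕ) : ℝ) ≠ 0 := by positivity
      have h3 : vertexMass ψ (k + (K + 1)) = ((k + (K + 1)).totient : ℝ) *
          (approxRadius a η (k + (K + 1))).toReal := by
        rw [vertexMass, hψ]; dsimp only
        rw [if_pos (by omega)]
        field_simp
      rw [h3, seriesTerm_eq, ENNReal.ofReal_mul (by positivity), ENNReal.ofReal_natCast,
        ENNReal.ofReal_toReal (hrad _ (by omega))]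
  have hDS := (UnitAddCircle.measurePreserving_mk 0).quasiMeasurePreserving.ae
    (ae_mem_addWellApproximable_of_not_summable h0 h1 hns)
  rw [zero_add] at hDS
  refine hDS.mono fun α hα => ?_
  rw [UnitAddCircle.mem_addWellApproximable_iff] at hα
  rw [frequently_atTop]
  intro M
  have hfin : ∀ᶠ k in atTop, ¬ IsFloorDiff a M k := by
    rw [← Nat.cofinite_eq_atTop]
    exact (finite_isFloorDiff a M).eventually_cofinite_notMem
  obtain ⟨L, hL⟩ := eventually_atTop.1 hfin
  obtain ⟨k, ⟨p, -, -, hp⟩, hkL⟩ := hα.exists_gt L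
  have hk : (0 : ℝ) < k := by exact_mod_cast (Nat.zero_le L).trans_lt hkL
  have hp' : ‖(α : UnitAddCircle) - ((p : ℝ) / k : ℝ)‖ < (approxRadius a η k).toReal := by
    by_cases h : K + 1 ≤ k
    · have h2 : ψ k / k = (approxRadius a η k).toReal := by
        rw [hψ]; dsimp only
        rw [if_pos h]
        field_simp
      rwa [h2] at hp
    · have h2 : ψ k / k = 0 := by
        rw [hψ]; dsimp only
        rw [if_neg h, zero_div]
      rw [h2] at hp
      exact absurd hp (norm_nonneg _).not_gt
  rw [← AddCircle.coe_sub, UnitAddCircle.norm_eq] at hp'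
  set i := round (α - (p : ℝ) / k) with hi
  have h2 := (ENNReal.ofReal_lt_iff_lt_toReal (abs_nonneg _)
    (hrad k (by exact_mod_cast hk))).2 hp'
  rw [approxRadius, lt_iSup_iff] at h2
  obtain ⟨b, h2⟩ := h2
  obtain ⟨hb, h2⟩ := lt_iSup_iff.1 h2
  have hbk : 0 < b * k := Nat.mul_pos hb (by exact_mod_cast hk)
  rw [ENNReal.lt_div_iff_mul_lt (Or.inl (by exact_mod_cast hbk.ne'))
    (Or.inl (ENNReal.natCast_ne_top _)), tailSup, lt_iSup_iff] at h2
  obtain ⟨ℓ, h2⟩ := h2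
  obtain ⟨hℓ, h2⟩ := lt_iSup_iff.1 h2
  rw [← ENNReal.ofReal_natCast, ← ENNReal.ofReal_mul (abs_nonneg _)] at h2
  have h3 := (ENNReal.ofReal_lt_ofReal_iff_of_nonneg (by positivity)).1 h2
  have hd := calN_le_iff.1 hℓ
  refine ⟨ℓ, ?_, ?_⟩
  · by_contra! h
    exact hL (b * k) (hkL.le.trans (Nat.le_mul_of_pos_left k hb)) (hd.mono h.le)
  · refine (hd.floorDeltaMin_le α).trans ((nint_le _ (b * p + b * k * i)).trans ?_)
    have h4 : α * (b * k : ℕ) - ((b * p + b * k * i : ℤ) : ℝ) =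
        (α - p / k - i) * (b * k : ℕ) := by
      push_cast; field_simp; ring
    rw [h4, abs_mul, Nat.abs_cast]
    exact h3.le

theorem stmt7 (a : ℕ → ℝ)
    (hpos : ∀ n, 1 ≤ n → 0 < a n)
    (hsep : ∀ m n, 1 ≤ m → 1 ≤ n → m ≠ n → 1 ≤ |a m - a n|)
    (η : ℕ → ℝ) (hη : ∀ N, 0 ≤ η N) :
    ((∑' k : ℕ, seriesTerm a η k) ≠ ⊤ →
      volume {α ∈ Set.Icc (0:ℝ) 1 | ∃ᶠ N in atTop, floorDeltaMin a α N ≤ η N} = 0) ∧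
    ((∑' k : ℕ, seriesTerm a η k) = ⊤ →
      volume {α ∈ Set.Icc (0:ℝ) 1 | ∃ᶠ N in atTop, floorDeltaMin a α N ≤ η N} = 1) := by
  refine ⟨volume_frequently_floorDeltaMin_le_eq_zero hsep, fun hdiv =>
    volume_eq_one_of_ae_restrict ?_⟩
  by_cases hlim : ∀ δ > 0, ∀ᶠ N in atTop, η N < δ
  · exact ae_frequently_floorDeltaMin_le_of_tendsto hlim hdiv
  · push Not at hlim
    obtain ⟨δ, hδ, h⟩ := hlim
    exact ae_frequently_floorDeltaMin_le_of_frequently_ge hsep hδ h
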